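/- For every a > 0 there exists a constant C > 0, depending only on Ω and a, such that for every λ > 0 the following holds: if φ is a Neumann eigenfunction of Ω with eigenvalue λ² whose boundary trace satisfies the asymptotic Schiffer condition ∫₀^L ((φ∘γ)′(t))² dt ≥ e^{−2aλ} ∫₀^L φ(γ(t))² dt, then the set of boundary critical points {t ∈ [0, L) : (φ∘γ)′(t) = 0} is finite and has cardinality at most C(1 + λ). -/

import Mathlib

open MeasureTheory

/-- The Euclidean Laplacian of a function on ℝ², as the sum of its second
partial derivatives. -/
noncomputable def lap2 (φ : EuclideanSpace ℝ (Fin 2) → ℝ) (x : EuclideanSpace ℝ (Fin 2)) : ℝ :=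
  ∑ i, fderiv ℝ (fun y => fderiv ℝ φ y (EuclideanSpace.single i 1)) x (EuclideanSpace.single i 1)

/-- φ is a Neumann eigenfunction of Ω (with boundary parametrized by γ) with
eigenvalue λ². -/
def IsNeumannEigenfunction (Ω : Set (EuclideanSpace ℝ (Fin 2)))
    (γ : ℝ → EuclideanSpace ℝ (Fin 2)) (lam : ℝ)
    (φ : EuclideanSpace ℝ (Fin 2) → ℝ) : Prop :=
  (∃ U : Set (EuclideanSpace ℝ (Fin 2)), IsOpen U ∧ closure Ω ⊆ U ∧ ContDiffOn ℝ (⊤ : ℕ∞) φ U)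
  ∧ ¬ Set.EqOn φ 0 (closure Ω)
  ∧ (∀ x ∈ Ω, lap2 φ x = -lam ^ 2 * φ x)
  ∧ (∀ t : ℝ, ∃ c : ℝ, gradient φ (γ t) = c • deriv γ t)

/-- The mass of a Lipschitz function near a curve is controlled by its integral along the curve. -/
theorem integral_le_of_near_curve {c : ℝ → ℂ} {L : ℝ} (hL : 0 < L) (hc : LipschitzWith 1 c)
    {P : ℂ → ℝ} {K : NNReal} (hP : LipschitzWith K P) {N : Set ℂ} {ε : ℝ} (hε : 0 < ε)
    (hεL : ε ≤ L) (hN : MeasurableSet N)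
    (hNc : ∀ x ∈ N, ∃ t ∈ Set.Icc 0 L, dist x (c t) ≤ ε) :
    ∫ x in N, |P x| ≤
      ε * (4 * Real.pi * ((∫ t in (0 : ℝ)..(2 * L), |P (c t)|) + 4 * K * L * ε)) := by
  have hPc : Continuous P := hP.continuous
  have hcc : Continuous c := hc.continuous
  have hPm : Measurable P := hPc.measurable
  set I : Set ℝ := Set.Icc 0 (2 * L) with hI
  have hmeas : MeasurableSet {p : ℂ × ℝ | dist p.1 (c p.2) ≤ 2 * ε} :=
    (isClosed_le (by fun_prop) continuous_const).measurableSet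
  have h1 : ∀ x ∈ N, ENNReal.ofReal ε ≤
      ∫⁻ t in I, {p : ℂ × ℝ | dist p.1 (c p.2) ≤ 2 * ε}.indicator 1 (x, t) := by
    intro x hx
    obtain ⟨t₀, ht₀, hd⟩ := hNc x hx
    calc ENNReal.ofReal ε = ∫⁻ t in Set.Icc t₀ (t₀ + ε), 1 := by simp
      _ ≤ ∫⁻ t in Set.Icc t₀ (t₀ + ε),
            {p : ℂ × ℝ | dist p.1 (c p.2) ≤ 2 * ε}.indicator 1 (x, t) := by
          refine setLIntegral_mono' measurableSet_Icc fun t ht => ?_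
          rw [Set.indicator_of_mem]
          · simp
          · have h2 : dist (c t₀) (c t) ≤ ε := by
              refine (hc.dist_le_mul t₀ t).trans ?_
              rw [Real.dist_eq, abs_sub_comm, abs_of_nonneg (by linarith [ht.1])]
              simp only [NNReal.coe_one, one_mul]
              linarith [ht.2]
            show dist x (c t) ≤ 2 * ε
            linarith [dist_triangle x (c t₀) (c t)]
      _ ≤ _ := lintegral_mono_set (Set.Icc_subset_Icc ht₀.1 (by linarith [ht₀.2]))
  have h2 : ENNReal.ofReal ε * ∫⁻ x in N, ‖P x‖ₑ ≤
      ∫⁻ t in I, ENNReal.ofReal (4 * Real.pi * ε ^ 2 * (|P (c t)| + K * (2 * ε))) := by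
    calc ENNReal.ofReal ε * ∫⁻ x in N, ‖P x‖ₑ
        = ∫⁻ x in N, ENNReal.ofReal ε * ‖P x‖ₑ := by
          rw [lintegral_const_mul _ (by fun_prop)]
      _ ≤ ∫⁻ x in N, (∫⁻ t in I, {p : ℂ × ℝ | dist p.1 (c p.2) ≤ 2 * ε}.indicator 1 (x, t))
            * ‖P x‖ₑ := by
          refine setLIntegral_mono' hN fun x hx => ?_
          gcongr
          exact h1 x hx
      _ ≤ ∫⁻ x, (∫⁻ t in I, {p : ℂ × ℝ | dist p.1 (c p.2) ≤ 2 * ε}.indicator 1 (x, t))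
            * ‖P x‖ₑ := setLIntegral_le_lintegral _ _
      _ = ∫⁻ x, ∫⁻ t in I, {p : ℂ × ℝ | dist p.1 (c p.2) ≤ 2 * ε}.indicator 1 (x, t)
            * ‖P x‖ₑ := by
          refine lintegral_congr fun x => ?_
          rw [lintegral_mul_const]
          exact (measurable_one.indicator hmeas).comp measurable_prodMk_left
      _ = ∫⁻ t in I, ∫⁻ x, {p : ℂ × ℝ | dist p.1 (c p.2) ≤ 2 * ε}.indicator 1 (x, t)
            * ‖P x‖ₑ := by
          rw [lintegral_lintegral_swap]
          refine Measurable.aemeasurable ?_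
          exact Measurable.mul (measurable_one.indicator hmeas) (hPm.comp measurable_fst).enorm
      _ ≤ _ := by
          refine lintegral_mono fun t => ?_
          calc ∫⁻ x, {p : ℂ × ℝ | dist p.1 (c p.2) ≤ 2 * ε}.indicator 1 (x, t) * ‖P x‖ₑ
              ≤ ∫⁻ x, (Metric.closedBall (c t) (2 * ε)).indicator
                  (fun _ => ENNReal.ofReal (|P (c t)| + K * (2 * ε))) x := by
                refine lintegral_mono fun x => ?_
                by_cases hx : dist x (c t) ≤ 2 * ε
                · rw [Set.indicator_of_mem (by exact hx), Set.indicator_of_mem (by exact hx)]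
                  simp only [Pi.one_apply, one_mul]
                  rw [← ofReal_norm]
                  apply ENNReal.ofReal_le_ofReal
                  have := hP.dist_le_mul x (c t)
                  rw [Real.dist_eq] at this
                  have h3 : (K : ℝ) * dist x (c t) ≤ K * (2 * ε) := by gcongr
                  rw [Real.norm_eq_abs]
                  have h4 := abs_sub_abs_le_abs_sub (P x) (P (c t))
                  linarith
                · rw [Set.indicator_of_notMem (by exact hx)]
                  simp
            _ = _ := by
                rw [lintegral_indicator_const Metric.isClosed_closedBall.measurableSet,
                  Complex.volume_closedBall]
                have h5 : (NNReal.pi : ENNReal) = ENNReal.ofReal Real.pi := by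
                  rw [← NNReal.coe_real_pi, ENNReal.ofReal_coe_nnreal]
                rw [h5, ← ENNReal.ofReal_pow (by positivity), ← ENNReal.ofReal_mul (by positivity),
                  ← ENNReal.ofReal_mul (by positivity)]
                congr 1
                ring
  have hint : Continuous fun t => 4 * Real.pi * ε ^ 2 * (|P (c t)| + K * (2 * ε)) := by fun_prop
  rw [← ofReal_integral_eq_lintegral_ofReal (hint.integrableOn_Icc)
    (Filter.Eventually.of_forall fun t => by positivity)] at h2
  have h3 : ∫ x in N, |P x| = (∫⁻ x in N, ‖P x‖ₑ).toReal := by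
    rw [← integral_norm_eq_lintegral_enorm (by fun_prop)]
    rfl
  have h4 := ENNReal.toReal_mono ENNReal.ofReal_ne_top h2
  rw [ENNReal.toReal_mul, ← h3, ENNReal.toReal_ofReal hε.le, ENNReal.toReal_ofReal
    (integral_nonneg fun t => by positivity)] at h4
  rw [integral_Icc_eq_integral_Ioc, ← intervalIntegral.integral_of_le (by linarith),
    intervalIntegral.integral_const_mul, intervalIntegral.integral_add
      (Continuous.intervalIntegrable (by fun_prop) _ _) (by simp),
    intervalIntegral.integral_const, smul_eq_mul] at h4
  refine le_of_mul_le_mul_left (h4.trans (le_of_eq ?_)) hε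
  ring

theorem abs_integral_fderiv_le {D : Set ℂ} (hD : IsOpen D) (hDb : Bornology.IsBounded D)
    {c : ℝ → ℂ} {L : ℝ} (hL : 0 < L) (hc : LipschitzWith 1 c) (hper : ∀ t, c (t + L) = c t)
    (hfr : frontier D = c '' Set.Ico 0 L)
    {P : ℂ → ℝ} (hP : ContDiff ℝ 1 P) (hPs : HasCompactSupport P) {v : ℂ} (hv : ‖v‖ = 1) :
    |∫ x in D, fderiv ℝ P x v| ≤ 8 * Real.pi * ∫ t in (0 : ℝ)..L, |P (c t)| := by
  have hcc : Continuous c := hc.continuous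
  have hPc : Continuous P := hP.continuous
  obtain ⟨K, hK⟩ := hP.lipschitzWith_of_hasCompactSupport hPs one_ne_zero
  have hDu : D ≠ Set.univ := by
    rintro rfl
    exact NormedSpace.unbounded_univ ℝ ℂ hDb
  have hDc : (Dᶜ).Nonempty := Set.nonempty_compl.2 hDu
  have hfrne : (frontier D).Nonempty := by
    rw [hfr]; exact ⟨c 0, 0, ⟨le_rfl, hL⟩, rfl⟩
  have hfrc : IsCompact (frontier D) :=
    Metric.isCompact_of_isClosed_isBounded isClosed_frontier
      (hDb.closure.subset frontier_subset_closure)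
  have hperP : ∫ t in (0 : ℝ)..(2 * L), |P (c t)| = 2 * ∫ t in (0 : ℝ)..L, |P (c t)| := by
    have hp : Function.Periodic (fun t => |P (c t)|) L := fun t => by simp [hper]
    have := hp.intervalIntegral_add_eq_add 0 L (fun a b =>
      Continuous.intervalIntegrable (by fun_prop) a b)
    rw [zero_add] at this
    rw [two_mul, this, two_mul]
  have hdP : Continuous fun x => fderiv ℝ P x v := by
    have := hP.continuous_fderiv one_ne_zero
    fun_prop
  set ev : ℕ → ℝ := fun n => L / (n + 1) with hev
  have hev0 : ∀ n, 0 < ev n := fun n => by positivity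
  have hevL : ∀ n, ev n ≤ L := fun n => div_le_self hL.le (by linarith [n.cast_nonneg (α := ℝ)])
  have hevlim : Filter.Tendsto ev Filter.atTop (nhds 0) :=
    by simpa [hev, div_eq_mul_inv] using tendsto_one_div_add_atTop_nhds_zero_nat.const_mul L
  set η : ℕ → ℂ → ℝ := fun n x => min 1 (Metric.infDist x Dᶜ / ev n) with hη
  have hη0 : ∀ n x, 0 ≤ η n x := fun n x =>
    le_min zero_le_one (div_nonneg Metric.infDist_nonneg (hev0 n).le)
  have hη1 : ∀ n x, η n x ≤ 1 := fun n x => min_le_left _ _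
  have hηD : ∀ n x, x ∉ D → η n x = 0 := fun n x hx => by
    simp [hη, Metric.infDist_zero_of_mem (show x ∈ Dᶜ from hx)]
  have hηlip : ∀ n, LipschitzWith (Real.toNNReal (1 / ev n)) (η n) := by
    intro n
    have h1 : LipschitzWith (Real.toNNReal (1 / ev n)) fun x => Metric.infDist x Dᶜ / ev n := by
      refine LipschitzWith.of_dist_le_mul fun x y => ?_
      rw [Real.coe_toNNReal _ (by have := hev0 n; positivity), Real.dist_eq, ← sub_div, abs_div,
        abs_of_pos (hev0 n), div_mul_eq_mul_div, one_mul]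
      have := (Metric.lipschitz_infDist_pt Dᶜ).dist_le_mul x y
      rw [Real.dist_eq] at this
      have h0 := hev0 n
      gcongr
      simpa using this
    exact h1.const_min 1
  have hmain : ∀ n, |∫ x in D, η n x * fderiv ℝ P x v| ≤
      4 * Real.pi * ((∫ t in (0 : ℝ)..(2 * L), |P (c t)|) + 4 * K * L * ev n) := by
    intro n
    set N : Set ℂ := {x | Metric.infDist x (frontier D) ≤ ev n} with hNdef
    have hNclosed : IsClosed N := isClosed_le (Metric.continuous_infDist_pt _) continuous_const
    have hN := hNclosed.measurableSet
    have hNc : ∀ x ∈ N, ∃ t ∈ Set.Icc 0 L, dist x (c t) ≤ ev n := by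
      intro x hx
      obtain ⟨y, hy, hxy⟩ := hfrc.exists_infDist_eq_dist hfrne x
      rw [hfr] at hy
      obtain ⟨t, ht, rfl⟩ := hy
      exact ⟨t, Set.Ico_subset_Icc_self ht, by rw [← hxy]; exact hx⟩
    have hld : ∀ x, ‖lineDeriv ℝ (η n) x v * P x‖ ≤ N.indicator (fun x => 1 / ev n * |P x|) x := by
      intro x
      by_cases hx : x ∈ N
      · rw [Set.indicator_of_mem hx, norm_mul]
        have := norm_lineDeriv_le_of_lipschitz ℝ (x₀ := x) (v := v) (hηlip n)
        rw [hv, mul_one, Real.coe_toNNReal _ (by have := hev0 n; positivity)] at this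
        exact mul_le_mul_of_nonneg_right this (norm_nonneg _)
      · have : lineDeriv ℝ (η n) x v = 0 := by
          by_cases hxD : x ∈ D
          · have : η n =ᶠ[nhds x] fun _ => 1 := by
              filter_upwards [hD.mem_nhds hxD, hNclosed.isOpen_compl.mem_nhds hx] with y hy hyN
              obtain ⟨w, hw, hyw⟩ := exists_mem_frontier_infDist_compl_eq_dist hy hDu
              have h1 : ev n < Metric.infDist y (frontier D) := not_le.1 hyN
              have h2 := Metric.infDist_le_dist_of_mem (x := y) hw
              simp only [hη, hyw]
              rw [min_eq_left]
              rw [one_le_div (hev0 n)]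
              linarith
            rw [this.lineDeriv_eq]; simp [lineDeriv]
          · have hxc : x ∉ closure D := by
              intro h
              have hxf : x ∈ frontier D := ⟨h, by rwa [hD.interior_eq]⟩
              apply hx
              show Metric.infDist x (frontier D) ≤ ev n
              rw [Metric.infDist_zero_of_mem hxf]
              exact (hev0 n).le
            have : η n =ᶠ[nhds x] fun _ => 0 := by
              filter_upwards [isClosed_closure.isOpen_compl.mem_nhds hxc] with y hy
              exact hηD n y fun h => hy (subset_closure h)
            rw [this.lineDeriv_eq]; simp [lineDeriv]
        rw [this]
        simp [Set.indicator_of_notMem hx]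
    have h1 : ∫ x in D, η n x * fderiv ℝ P x v = ∫ x, η n x * fderiv ℝ P x v := by
      refine setIntegral_eq_integral_of_forall_compl_eq_zero fun x hx => ?_
      rw [hηD n x hx, zero_mul]
    have h2 : ∫ x, η n x * fderiv ℝ P x v = - ∫ x, lineDeriv ℝ (η n) x v * P x := by
      rw [(hηlip n).integral_lineDeriv_mul_eq hK hPs v, ← integral_neg]
      refine integral_congr_ae (Filter.Eventually.of_forall fun x => ?_)
      have : DifferentiableAt ℝ P x := (hP.differentiable one_ne_zero).differentiableAt
      simp only [this.lineDeriv_eq_fderiv, map_neg]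
      ring
    rw [h1, h2, abs_neg]
    have hint : Integrable (N.indicator fun x => 1 / ev n * |P x|) :=
      ((hPc.integrable_of_hasCompactSupport hPs).norm.const_mul _).indicator hN
    calc |∫ x, lineDeriv ℝ (η n) x v * P x|
        ≤ ∫ x, N.indicator (fun x => 1 / ev n * |P x|) x :=
          norm_integral_le_of_norm_le hint (Filter.Eventually.of_forall hld)
      _ = 1 / ev n * ∫ x in N, |P x| := by
          rw [integral_indicator hN, integral_const_mul]
      _ ≤ 1 / ev n * (ev n * (4 * Real.pi * ((∫ t in (0 : ℝ)..(2 * L), |P (c t)|)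
            + 4 * K * L * ev n))) := by
          have := hev0 n
          gcongr
          exact integral_le_of_near_curve hL hc hK this (hevL n) hN hNc
      _ = _ := by
          have := (hev0 n).ne'
          field_simp
  have hlim1 : Filter.Tendsto (fun n => ∫ x in D, η n x * fderiv ℝ P x v) Filter.atTop
      (nhds (∫ x in D, fderiv ℝ P x v)) := by
    refine tendsto_integral_of_dominated_convergence (fun x => ‖fderiv ℝ P x v‖) ?_ ?_ ?_ ?_
    · intro n
      have := (hηlip n).continuous
      exact Continuous.aestronglyMeasurable (by fun_prop)
    · refine (Continuous.integrable_of_hasCompactSupport hdP ?_).norm.integrableOn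
      exact hPs.fderiv_apply ℝ v
    · intro n
      refine Filter.Eventually.of_forall fun x => ?_
      rw [norm_mul, Real.norm_eq_abs, abs_of_nonneg (hη0 n x)]
      exact mul_le_of_le_one_left (norm_nonneg _) (hη1 n x)
    · rw [ae_restrict_iff' hD.measurableSet]
      refine Filter.Eventually.of_forall fun x hx => ?_
      have hpos : 0 < Metric.infDist x Dᶜ :=
        (hD.isClosed_compl.notMem_iff_infDist_pos hDc).1 (by simpa using hx)
      refine tendsto_const_nhds.congr' ?_
      filter_upwards [hevlim.eventually_lt_const hpos] with n hn
      simp only [hη]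
      rw [min_eq_left, one_mul]
      rw [one_le_div (hev0 n)]
      exact hn.le
  have hlim2 : Filter.Tendsto (fun n => 4 * Real.pi * ((∫ t in (0 : ℝ)..(2 * L), |P (c t)|)
      + 4 * K * L * ev n)) Filter.atTop
      (nhds (4 * Real.pi * ((∫ t in (0 : ℝ)..(2 * L), |P (c t)|) + 4 * K * L * 0))) :=
    ((hevlim.const_mul _).const_add _).const_mul _
  have := le_of_tendsto_of_tendsto' hlim1.abs hlim2 hmain
  rw [hperP] at this
  linarith

/-- Rellich's estimate: the energy of a Helmholtz solution is controlled by its Cauchy data. -/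
theorem rellich_energy_le {D : Set ℂ} (hD : IsOpen D) (hDb : Bornology.IsBounded D)
    {c : ℝ → ℂ} {L : ℝ} (hL : 0 < L) (hc : LipschitzWith 1 c) (hper : ∀ t, c (t + L) = c t)
    (hfr : frontier D = c '' Set.Ico 0 L) {ρ : ℝ} (hρ : ∀ t, ‖c t‖ ≤ ρ) {lam : ℝ}
    {ψ : ℂ → ℝ} (hψ : ContDiff ℝ (⊤ : ℕ∞) ψ) (hψs : HasCompactSupport ψ)
    (hlap : ∀ x ∈ D, fderiv ℝ (fun y => fderiv ℝ ψ y 1) x 1 +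
      fderiv ℝ (fun y => fderiv ℝ ψ y Complex.I) x Complex.I = -lam ^ 2 * ψ x) :
    lam ^ 2 * ∫ x in D, ψ x ^ 2 ≤ 32 * Real.pi * ρ *
        ∫ t in (0 : ℝ)..L, (fderiv ℝ ψ (c t) 1 ^ 2 + fderiv ℝ ψ (c t) Complex.I ^ 2
          + lam ^ 2 * ψ (c t) ^ 2) ∧
      ∫ x in D, (fderiv ℝ ψ x 1 ^ 2 + fderiv ℝ ψ x Complex.I ^ 2) ≤
        lam ^ 2 * (∫ x in D, ψ x ^ 2) + 8 * Real.pi *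
        ∫ t in (0 : ℝ)..L, (fderiv ℝ ψ (c t) 1 ^ 2 + fderiv ℝ ψ (c t) Complex.I ^ 2
          + ψ (c t) ^ 2) := by
  set p : ℂ → ℝ := fun y => fderiv ℝ ψ y 1 with hp
  set r : ℂ → ℝ := fun y => fderiv ℝ ψ y Complex.I with hr
  have hcc : Continuous c := hc.continuous
  have hf1 : ContDiff ℝ (⊤ : ℕ∞) (fderiv ℝ ψ) := hψ.fderiv_right (by simp)
  have hpc : ContDiff ℝ (⊤ : ℕ∞) p := hf1.clm_apply contDiff_const
  have hrc : ContDiff ℝ (⊤ : ℕ∞) r := hf1.clm_apply contDiff_const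
  have hps : HasCompactSupport p := hψs.fderiv_apply ℝ 1
  have hrs : HasCompactSupport r := hψs.fderiv_apply ℝ Complex.I
  have hne : ((⊤ : ℕ∞) : WithTop ℕ∞) ≠ 0 := by simp
  have dψ : ∀ x, HasFDerivAt ψ (fderiv ℝ ψ x) x := fun x =>
    (hψ.differentiable hne x).hasFDerivAt
  have dp : ∀ x, HasFDerivAt p (fderiv ℝ p x) x := fun x =>
    (hpc.differentiable hne x).hasFDerivAt
  have dr : ∀ x, HasFDerivAt r (fderiv ℝ r x) x := fun x =>
    (hrc.differentiable hne x).hasFDerivAt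
  have dre : ∀ x, HasFDerivAt (fun z : ℂ => z.re) Complex.reCLM x := fun x =>
    Complex.reCLM.hasFDerivAt
  have dim : ∀ x, HasFDerivAt (fun z : ℂ => z.im) Complex.imCLM x := fun x =>
    Complex.imCLM.hasFDerivAt
  have hreC : ContDiff ℝ (⊤ : ℕ∞) fun z : ℂ => z.re := Complex.reCLM.contDiff
  have himC : ContDiff ℝ (⊤ : ℕ∞) fun z : ℂ => z.im := Complex.imCLM.contDiff
  have hsymm : ∀ x, fderiv ℝ p x Complex.I = fderiv ℝ r x 1 := by
    intro x
    have hs : IsSymmSndFDerivAt ℝ ψ x := hψ.contDiffAt.isSymmSndFDerivAt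
      (by
        simp only [minSmoothness_of_isRCLikeNormedField]
        show ((2 : ℕ∞) : WithTop ℕ∞) ≤ ((⊤ : ℕ∞) : WithTop ℕ∞); exact WithTop.coe_le_coe.2 le_top)
    have hd : DifferentiableAt ℝ (fderiv ℝ ψ) x := hf1.differentiable hne x
    have e1 : fderiv ℝ p x Complex.I = fderiv ℝ (fderiv ℝ ψ) x Complex.I 1 := by
      rw [hp, fderiv_clm_apply hd (by fun_prop)]; simp
    have e2 : fderiv ℝ r x 1 = fderiv ℝ (fderiv ℝ ψ) x 1 Complex.I := by
      rw [hr, fderiv_clm_apply hd (by fun_prop)]; simp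
    rw [e1, e2]
    exact hs.eq _ _
  set F₁ : ℂ → ℝ := fun x => 2 * (x.re * p x + x.im * r x) * p x
    - x.re * (p x ^ 2 + r x ^ 2) + lam ^ 2 * (x.re * ψ x ^ 2) with hF₁
  set F₂ : ℂ → ℝ := fun x => 2 * (x.re * p x + x.im * r x) * r x
    - x.im * (p x ^ 2 + r x ^ 2) + lam ^ 2 * (x.im * ψ x ^ 2) with hF₂
  have F₁C : ContDiff ℝ 1 F₁ := ContDiff.of_le (by fun_prop) (by simp : (1 : WithTop ℕ∞) ≤ (⊤ : ℕ∞))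
  have F₂C : ContDiff ℝ 1 F₂ := ContDiff.of_le (by fun_prop) (by simp : (1 : WithTop ℕ∞) ≤ (⊤ : ℕ∞))
  have dF₁ : ∀ x v, fderiv ℝ F₁ x v = 2 * (v.re * p x + x.re * fderiv ℝ p x v + v.im * r x
      + x.im * fderiv ℝ r x v) * p x + 2 * (x.re * p x + x.im * r x) * fderiv ℝ p x v
      - v.re * (p x ^ 2 + r x ^ 2) - x.re * (2 * p x * fderiv ℝ p x v + 2 * r x * fderiv ℝ r x v)
      + lam ^ 2 * (v.re * ψ x ^ 2 + x.re * (2 * ψ x * fderiv ℝ ψ x v)) := by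
    intro x v
    have h := ((((((dre x).mul (dp x)).add ((dim x).mul (dr x))).const_mul 2).mul (dp x)).sub
      ((dre x).mul (((dp x).pow 2).add ((dr x).pow 2)))).add
      (((dre x).mul ((dψ x).pow 2)).const_mul (lam ^ 2))
    have e := h.fderiv
    have e' : fderiv ℝ F₁ x = _ := e
    rw [e']
    simp
    ring
  have dF₂ : ∀ x v, fderiv ℝ F₂ x v = 2 * (v.re * p x + x.re * fderiv ℝ p x v + v.im * r x
      + x.im * fderiv ℝ r x v) * r x + 2 * (x.re * p x + x.im * r x) * fderiv ℝ r x v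
      - v.im * (p x ^ 2 + r x ^ 2) - x.im * (2 * p x * fderiv ℝ p x v + 2 * r x * fderiv ℝ r x v)
      + lam ^ 2 * (v.im * ψ x ^ 2 + x.im * (2 * ψ x * fderiv ℝ ψ x v)) := by
    intro x v
    have h := ((((((dre x).mul (dp x)).add ((dim x).mul (dr x))).const_mul 2).mul (dr x)).sub
      ((dim x).mul (((dp x).pow 2).add ((dr x).pow 2)))).add
      (((dim x).mul ((dψ x).pow 2)).const_mul (lam ^ 2))
    have e := h.fderiv
    have e' : fderiv ℝ F₂ x = _ := e
    rw [e']
    simp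
    ring
  have hzero : ∀ x, x ∉ tsupport ψ → ψ x = 0 ∧ p x = 0 ∧ r x = 0 := by
    intro x hx
    have h1 : fderiv ℝ ψ x = 0 := by
      by_contra h
      exact hx (support_fderiv_subset ℝ h)
    exact ⟨image_eq_zero_of_notMem_tsupport hx, by simp [hp, h1], by simp [hr, h1]⟩
  have supp : ∀ F : ℂ → ℝ, (∀ x, ψ x = 0 ∧ p x = 0 ∧ r x = 0 → F x = 0) → HasCompactSupport F :=
    fun F hF => HasCompactSupport.intro hψs fun x hx => hF x (hzero x hx)
  have ip : ∀ (P : ℂ → ℝ) (v : ℂ), ContDiff ℝ 1 P → HasCompactSupport P →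
      IntegrableOn (fun x => fderiv ℝ P x v) D := fun P v hP hs => by
    have := hP.continuous_fderiv one_ne_zero
    exact (Continuous.integrable_of_hasCompactSupport (by fun_prop)
      (hs.fderiv_apply ℝ v)).integrableOn
  have div_le : ∀ P Q : ℂ → ℝ, ContDiff ℝ 1 P → HasCompactSupport P → ContDiff ℝ 1 Q →
      HasCompactSupport Q → ∫ x in D, (fderiv ℝ P x 1 + fderiv ℝ Q x Complex.I) ≤
        8 * Real.pi * ∫ t in (0 : ℝ)..L, (|P (c t)| + |Q (c t)|) := by
    intro P Q hP hPs hQ hQs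
    have hPc := hP.continuous
    have hQc := hQ.continuous
    rw [integral_add (ip P 1 hP hPs) (ip Q _ hQ hQs), intervalIntegral.integral_add
      (Continuous.intervalIntegrable (by fun_prop) _ _)
      (Continuous.intervalIntegrable (by fun_prop) _ _), mul_add]
    exact add_le_add
      ((le_abs_self _).trans (abs_integral_fderiv_le hD hDb hL hc hper hfr hP hPs (by simp)))
      ((le_abs_self _).trans (abs_integral_fderiv_le hD hDb hL hc hper hfr hQ hQs (by simp)))
  have hψC := hψ.continuous
  have hpC := hpc.continuous
  have hrC := hrc.continuous
  have hle1 : (1 : WithTop ℕ∞) ≤ (⊤ : ℕ∞) := by simp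
  have hρ0 : 0 ≤ ρ := (norm_nonneg _).trans (hρ 0)
  constructor
  · have e1 : ∫ x in D, (fderiv ℝ F₁ x 1 + fderiv ℝ F₂ x Complex.I) =
        2 * (lam ^ 2 * ∫ x in D, ψ x ^ 2) := by
      rw [← integral_const_mul, ← integral_const_mul]
      refine setIntegral_congr_fun hD.measurableSet fun x hx => ?_
      simp only [dF₁, dF₂, Complex.one_re, Complex.one_im, Complex.I_re, Complex.I_im, hsymm]
      have h1 : fderiv ℝ ψ x 1 = p x := rfl
      have h2 : fderiv ℝ ψ x Complex.I = r x := rfl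
      rw [h1, h2]
      have h3 := hlap x hx
      linear_combination (2 * (x.re * p x + x.im * r x)) * h3
    have e2 := div_le F₁ F₂ F₁C (supp _ fun x ⟨h1, h2, h3⟩ => by simp [hF₁, h1, h2, h3]) F₂C
      (supp _ fun x ⟨h1, h2, h3⟩ => by simp [hF₂, h1, h2, h3])
    rw [e1] at e2
    have e3 : ∫ t in (0 : ℝ)..L, (|F₁ (c t)| + |F₂ (c t)|) ≤
        ∫ t in (0 : ℝ)..L, 8 * ρ * (p (c t) ^ 2 + r (c t) ^ 2 + lam ^ 2 * ψ (c t) ^ 2) := by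
      have := F₁C.continuous
      have := F₂C.continuous
      refine intervalIntegral.integral_mono_on hL.le
        (Continuous.intervalIntegrable (by fun_prop) _ _)
        (Continuous.intervalIntegrable (by fun_prop) _ _) fun t _ => ?_
      have hx : |(c t).re| ≤ ρ := (Complex.abs_re_le_norm _).trans (hρ t)
      have hy : |(c t).im| ≤ ρ := (Complex.abs_im_le_norm _).trans (hρ t)
      generalize c t = z at hx hy
      have q1 : ∀ a b m n k : ℝ, |a| ≤ ρ → |b| ≤ ρ →
          |a * (m ^ 2 - n ^ 2 + k ^ 2) + b * (2 * m * n)| ≤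
            ρ * (2 * m ^ 2 + 2 * n ^ 2 + k ^ 2) := by
        intro a b m n k ha hb
        have h1 : |m ^ 2 - n ^ 2 + k ^ 2| ≤ m ^ 2 + n ^ 2 + k ^ 2 := by
          rw [abs_le]; constructor <;> nlinarith [sq_nonneg m, sq_nonneg n, sq_nonneg k]
        have h2 : |2 * m * n| ≤ m ^ 2 + n ^ 2 := by
          rw [abs_le]; constructor <;> nlinarith [sq_nonneg (m + n), sq_nonneg (m - n)]
        refine (abs_add_le _ _).trans ?_
        rw [abs_mul, abs_mul]
        have h3 := mul_le_mul ha h1 (abs_nonneg _) hρ0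
        have h4 := mul_le_mul hb h2 (abs_nonneg _) hρ0
        linarith
      have g1 := q1 z.re z.im (p z) (r z) (lam * ψ z) hx hy
      have g2 := q1 z.im z.re (r z) (p z) (lam * ψ z) hy hx
      have e1 : F₁ z = z.re * (p z ^ 2 - r z ^ 2 + (lam * ψ z) ^ 2) + z.im * (2 * p z * r z) := by
        simp only [hF₁]; ring
      have e2 : F₂ z = z.im * (r z ^ 2 - p z ^ 2 + (lam * ψ z) ^ 2) + z.re * (2 * r z * p z) := by
        simp only [hF₂]; ring
      rw [e1, e2]
      nlinarith [mul_nonneg hρ0 (sq_nonneg (p z)), mul_nonneg hρ0 (sq_nonneg (r z)),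
        mul_nonneg hρ0 (sq_nonneg (lam * ψ z))]
    rw [intervalIntegral.integral_const_mul] at e3
    have : 8 * Real.pi * ∫ t in (0 : ℝ)..L, (|F₁ (c t)| + |F₂ (c t)|) ≤ 8 * Real.pi *
      (8 * ρ * ∫ t in (0 : ℝ)..L, (p (c t) ^ 2 + r (c t) ^ 2 + lam ^ 2 * ψ (c t) ^ 2)) := by gcongr
    show _ ≤ 32 * Real.pi * ρ *
      ∫ t in (0 : ℝ)..L, (p (c t) ^ 2 + r (c t) ^ 2 + lam ^ 2 * ψ (c t) ^ 2)
    linarith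
  · have e1 : ∫ x in D, (fderiv ℝ (fun x => ψ x * p x) x 1 +
        fderiv ℝ (fun x => ψ x * r x) x Complex.I) =
        (∫ x in D, (p x ^ 2 + r x ^ 2)) - lam ^ 2 * ∫ x in D, ψ x ^ 2 := by
      rw [← integral_const_mul, ← integral_sub]
      · refine setIntegral_congr_fun hD.measurableSet fun x hx => ?_
        have h0 : ∀ v, fderiv ℝ (fun x => ψ x * p x) x v =
            ψ x * fderiv ℝ p x v + p x * fderiv ℝ ψ x v := fun v => by
          have : fderiv ℝ (fun x => ψ x * p x) x = _ := ((dψ x).mul (dp x)).fderiv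
          rw [this]; simp
        have h0' : ∀ v, fderiv ℝ (fun x => ψ x * r x) x v =
            ψ x * fderiv ℝ r x v + r x * fderiv ℝ ψ x v := fun v => by
          have : fderiv ℝ (fun x => ψ x * r x) x = _ := ((dψ x).mul (dr x)).fderiv
          rw [this]; simp
        have h1 : fderiv ℝ ψ x 1 = p x := rfl
        have h2 : fderiv ℝ ψ x Complex.I = r x := rfl
        simp only [h0, h0', h1, h2]
        have h3 := hlap x hx
        linear_combination ψ x * h3
      · exact (Continuous.integrable_of_hasCompactSupport (by fun_prop)
          (supp _ fun x ⟨h1, h2, h3⟩ => by simp [h2, h3])).integrableOn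
      · exact (Continuous.integrable_of_hasCompactSupport (by fun_prop)
          (supp _ fun x ⟨h1, h2, h3⟩ => by simp [h1])).integrableOn
    have e2 := div_le (fun x => ψ x * p x) (fun x => ψ x * r x)
      ((hψ.mul hpc).of_le hle1) (supp _ fun x ⟨h1, h2, h3⟩ => by simp [h1])
      ((hψ.mul hrc).of_le hle1) (supp _ fun x ⟨h1, h2, h3⟩ => by simp [h1])
    rw [e1] at e2
    have e3 : ∫ t in (0 : ℝ)..L, (|ψ (c t) * p (c t)| + |ψ (c t) * r (c t)|) ≤
        ∫ t in (0 : ℝ)..L, (p (c t) ^ 2 + r (c t) ^ 2 + ψ (c t) ^ 2) := by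
      refine intervalIntegral.integral_mono_on hL.le
        (Continuous.intervalIntegrable (by fun_prop) _ _)
        (Continuous.intervalIntegrable (by fun_prop) _ _) fun t _ => ?_
      generalize c t = z
      simp only [abs_mul]
      nlinarith [sq_nonneg (|ψ z| - |p z|), sq_nonneg (|ψ z| - |r z|), sq_abs (ψ z), sq_abs (p z),
        sq_abs (r z), sq_nonneg (p z), sq_nonneg (r z)]
    have : 8 * Real.pi * ∫ t in (0 : ℝ)..L, (|ψ (c t) * p (c t)| + |ψ (c t) * r (c t)|) ≤
      8 * Real.pi * ∫ t in (0 : ℝ)..L, (p (c t) ^ 2 + r (c t) ^ 2 + ψ (c t) ^ 2) := by gcongr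
    show _ ≤ lam ^ 2 * (∫ x in D, ψ x ^ 2) + 8 * Real.pi *
      ∫ t in (0 : ℝ)..L, (p (c t) ^ 2 + r (c t) ^ 2 + ψ (c t) ^ 2)
    linarith

/-- Jensen's bound for the number of zeros of an analytic function in a smaller disc. -/
theorem card_zeros_le_of_analyticOnNhd_closedBall {h : ℂ → ℂ} {r R M : ℝ} (hr : 0 < r) (hrR : r < R)
    (hh : AnalyticOnNhd ℂ h (Metric.closedBall 0 R)) (h0 : h 0 ≠ 0) (h0M : ‖h 0‖ ≤ M)
    (hM : ∀ z ∈ Metric.sphere (0 : ℂ) R, ‖h z‖ ≤ M) (S : Finset ℂ)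
    (hS : ∀ z ∈ S, ‖z‖ ≤ r ∧ h z = 0) :
    (S.card : ℝ) ≤ Real.log (M / ‖h 0‖) / Real.log (R / r) := by
  have hn : 0 < ‖h 0‖ := norm_pos_iff.2 h0
  set g : ℂ → ℂ := fun z => (h 0)⁻¹ * h z with hg
  have hga : AnalyticOnNhd ℂ g (Metric.closedBall 0 R) := fun z hz =>
    analyticAt_const.mul (hh z hz)
  have hR : |R| = R := abs_of_pos (hr.trans hrR)
  have hr' : |r| = r := abs_of_pos hr
  have g0 : g 0 = 1 := by simp [hg, h0]
  have key := AnalyticOnNhd.sum_divisor_le (c := 0) (r := r) (R := R) (M := M / ‖h 0‖) (f := g)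
    (by rwa [hr']) (by rwa [hr', hR]) (by rwa [one_le_div hn]) (by rwa [hR])
    (by rw [g0]; exact one_ne_zero)
    (by
      intro z hz
      rw [hR] at hz
      simp only [hg, norm_mul, norm_inv]
      rw [inv_mul_eq_div]
      gcongr
      exact hM z hz)
  rw [g0, norm_one, div_one, hr'] at key
  refine le_trans ?_ key
  set D := MeromorphicOn.divisor g (Metric.closedBall 0 r)
  have hgr : AnalyticOnNhd ℂ g (Metric.closedBall 0 r) :=
    hga.mono (Metric.closedBall_subset_closedBall hrR.le)
  have hpre : IsPreconnected (Metric.closedBall (0 : ℂ) r) :=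
    (convex_closedBall 0 r).isPreconnected
  have hD0 : ∀ z, 0 ≤ D z := fun z => MeromorphicOn.AnalyticOnNhd.divisor_nonneg hgr z
  have hD1 : ∀ z ∈ S, 1 ≤ D z := by
    intro z hz
    have hzb : z ∈ Metric.closedBall (0 : ℂ) r := by simpa using (hS z hz).1
    have h1 : analyticOrderAt g z ≠ 0 := by
      rw [Ne, (hgr z hzb).analyticOrderAt_eq_zero]
      simp [hg, (hS z hz).2]
    have h2 : analyticOrderAt g z ≠ ⊤ := by
      refine hgr.analyticOrderAt_ne_top_of_isPreconnected (x := 0) hpre (by simp [hr.le]) hzb ?_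
      rw [(hgr 0 (by simp [hr.le])).analyticOrderAt_eq_zero.2 (by rw [g0]; exact one_ne_zero)]
      exact ENat.zero_ne_top
    obtain ⟨n, hn'⟩ := ENat.ne_top_iff_exists.1 h2
    have e : D z = (n : ℤ) := by
      rw [MeromorphicOn.AnalyticOnNhd.divisor_apply hgr hzb, ← hn']
      simp
    rw [← hn'] at h1
    have : n ≠ 0 := by exact_mod_cast h1
    omega
  have hfin : (Function.support D).Finite :=
    D.finiteSupport (isCompact_closedBall _ _)
  have : (S.card : ℤ) ≤ ∑ᶠ u, D u := by
    rw [finsum_eq_sum_of_support_subset (s := hfin.toFinset) _ (by simp)]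
    calc (S.card : ℤ) = ∑ z ∈ S, 1 := by simp
      _ ≤ ∑ z ∈ S, D z := Finset.sum_le_sum hD1
      _ ≤ _ := by
        refine Finset.sum_le_sum_of_subset_of_nonneg ?_ (fun z _ _ => hD0 z)
        intro z hz
        have := hD1 z hz
        simp only [Set.Finite.mem_toFinset, Function.mem_support]
        omega
  exact_mod_cast this

/-- The number of real zeros, on a segment, of a function that is bounded and holomorphic on a
strip around the real axis is controlled by the logarithm of its growth. -/
theorem exists_card_zeros_le_of_strip {L τ : ℝ} (hL : 0 < L) (hτ : 0 < τ) :
    ∃ K > (0 : ℝ), ∀ (V : ℂ → ℂ) (M : ℝ) (t₀ : ℝ),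
      (∀ z : ℂ, |z.im| < τ → DifferentiableAt ℂ V z) → (∀ z : ℂ, |z.im| < τ → ‖V z‖ ≤ M) →
      t₀ ∈ Set.Icc 0 L → V t₀ ≠ 0 →
      ∀ S : Finset ℝ, (∀ t ∈ S, t ∈ Set.Icc 0 L ∧ V t = 0) →
        (S.card : ℝ) ≤ K * Real.log (M / ‖V t₀‖) := by
  set b : ℝ := 2 * τ / Real.pi with hb
  have hbpos : 0 < b := by positivity
  set E : ℝ := Real.exp (L / b)
  have hE : 1 < E := Real.one_lt_exp_iff.2 (by positivity)
  set r : ℝ := (E - 1) / (E + 1) with hr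
  have hr0 : 0 < r := div_pos (by linarith) (by linarith)
  have hr1 : r < 1 := by rw [hr, div_lt_one (by linarith)]; linarith
  set R : ℝ := (1 + r) / 2 with hR
  have hrR : r < R := by rw [hR]; linarith
  have hR1 : R < 1 := by rw [hR]; linarith
  have hlog : 0 < Real.log (R / r) := Real.log_pos (by rwa [one_lt_div hr0])
  refine ⟨1 / Real.log (R / r), by positivity, ?_⟩
  intro V M t₀ hV hVM ht₀ hV0 S hS
  set T : ℂ → ℂ := fun ζ => (t₀ : ℂ) + b * Complex.log ((1 + ζ) / (1 - ζ)) with hT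
  have hre : ∀ ζ : ℂ, ‖ζ‖ < 1 → 1 - ζ ≠ 0 ∧ 0 < ((1 + ζ) / (1 - ζ)).re := by
    intro ζ hζ
    have h1 : 1 - ζ ≠ 0 := by
      intro h
      have : ζ = 1 := by linear_combination -h
      simp [this] at hζ
    refine ⟨h1, ?_⟩
    have h2 : ζ.re ^ 2 + ζ.im ^ 2 < 1 := by
      have := Complex.sq_norm ζ
      rw [Complex.normSq_apply] at this
      nlinarith [norm_nonneg ζ]
    have h3 : 0 < Complex.normSq (1 - ζ) := Complex.normSq_pos.2 h1
    rw [Complex.div_re, ← add_div]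
    apply div_pos _ h3
    simp
    nlinarith
  have hTim : ∀ ζ : ℂ, ‖ζ‖ < 1 → |(T ζ).im| < τ := by
    intro ζ hζ
    have h1 : (T ζ).im = b * Complex.arg ((1 + ζ) / (1 - ζ)) := by
      simp [hT, Complex.log_im]
    rw [h1, abs_mul, abs_of_pos hbpos]
    have := Complex.abs_arg_lt_pi_div_two_iff.2 (Or.inl (hre ζ hζ).2)
    calc b * _ < b * (Real.pi / 2) := by gcongr
      _ = τ := by rw [hb]; field_simp
  have hTd : ∀ ζ : ℂ, ‖ζ‖ < 1 → DifferentiableAt ℂ T ζ := by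
    intro ζ hζ
    obtain ⟨h1, h2⟩ := hre ζ hζ
    have : DifferentiableAt ℂ (fun ζ : ℂ => (1 + ζ) / (1 - ζ)) ζ := by
      fun_prop (disch := assumption)
    exact (((this.clog (Or.inl h2)).const_mul (b : ℂ)).const_add _)
  have hh : AnalyticOnNhd ℂ (V ∘ T) (Metric.closedBall 0 R) := by
    have : DifferentiableOn ℂ (V ∘ T) (Metric.ball 0 1) := by
      intro ζ hζ
      have hζ' : ‖ζ‖ < 1 := by simpa using hζ
      exact ((hV _ (hTim ζ hζ')).comp ζ (hTd ζ hζ')).differentiableWithinAt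
    exact (this.analyticOnNhd Metric.isOpen_ball).mono (Metric.closedBall_subset_ball hR1)
  have hT0 : T 0 = t₀ := by simp [hT]
  set Y : ℝ → ℝ := fun t => (Real.exp ((t - t₀) / b) - 1) / (Real.exp ((t - t₀) / b) + 1) with hY
  have hYone : ∀ t, (1 + Y t) / (1 - Y t) = Real.exp ((t - t₀) / b) := by
    intro t
    have := Real.exp_pos ((t - t₀) / b)
    have h2 : 1 - Y t = 2 / (Real.exp ((t - t₀) / b) + 1) := by
      simp only [hY]; field_simp; ring
    rw [h2]
    simp only [hY]; field_simp; ring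
  have hTY : ∀ t, T (Y t) = t := by
    intro t
    have h1 : (1 + (Y t : ℂ)) / (1 - (Y t : ℂ)) = ((Real.exp ((t - t₀) / b) : ℝ) : ℂ) := by
      rw [← hYone t]; push_cast; rfl
    simp only [hT]
    rw [h1, ← Complex.ofReal_log (Real.exp_pos _).le, Real.log_exp]
    push_cast
    have : (b : ℂ) ≠ 0 := by exact_mod_cast hbpos.ne'
    field_simp
    ring
  have hYinj : Function.Injective (fun t => (Y t : ℂ)) := by
    intro s t hst
    have := hTY s
    simp only at hst
    rw [hst, hTY t] at this
    exact_mod_cast this.symm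
  have hYr : ∀ t ∈ Set.Icc 0 L, |Y t| ≤ r := by
    intro t ht
    have hpos := Real.exp_pos ((t - t₀) / b)
    have h1 : Real.exp ((t - t₀) / b) ≤ E := by
      apply Real.exp_le_exp.2; gcongr; linarith [ht.2, ht₀.1]
    have h2 : 1 ≤ E * Real.exp ((t - t₀) / b) := by
      rw [← Real.exp_add, ← add_div]
      apply Real.one_le_exp
      apply div_nonneg _ hbpos.le
      linarith [ht.1, ht₀.2]
    rw [abs_le]
    constructor
    · simp only [hY, hr]
      rw [← neg_div, div_le_div_iff₀ (by linarith) (by linarith)]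
      nlinarith
    · simp only [hY, hr]
      rw [div_le_div_iff₀ (by linarith) (by linarith)]
      nlinarith
  have key := card_zeros_le_of_analyticOnNhd_closedBall (h := V ∘ T) (M := M) hr0 hrR hh
    (by simpa [hT0] using hV0)
    (hVM _ (hTim 0 (by simp)))
    (fun z hz => hVM _ (hTim z (by
      have : ‖z‖ = R := by simpa using hz
      rwa [this])))
    (S.image (fun t => (Y t : ℂ)))
    (by
      intro z hz
      obtain ⟨t, ht, rfl⟩ := Finset.mem_image.1 hz
      refine ⟨?_, ?_⟩
      · rw [Complex.norm_real]; exact hYr t (hS t ht).1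
      · simp only [Function.comp, hTY]; exact (hS t ht).2)
  rw [Finset.card_image_of_injective _ hYinj] at key
  simp only [Function.comp, hT0] at key
  calc _ ≤ _ := key
    _ = _ := by ring

/-- The Fourier integral `∫₀ᴸ g(t) exp(-iωkt) dt`. -/
noncomputable def fourierInt (L ω : ℝ) (g : ℝ → ℂ) (k : ℤ) : ℂ :=
  ∫ t in (0 : ℝ)..L, g t * Complex.exp (-(Complex.I * ω * k * t))

/-- The exponential sum `∑ bₖ exp(iωkz)`. -/
noncomputable def expSum (ω : ℝ) (b : ℤ → ℂ) (z : ℂ) : ℂ :=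
  ∑' k : ℤ, b k * Complex.exp (Complex.I * ω * k * z)

theorem exp_omega_period {L ω : ℝ} (hω : ω * L = 2 * Real.pi) (k : ℤ) :
    Complex.exp (Complex.I * ω * k * L) = 1 := by
  rw [Complex.exp_eq_one_iff]
  refine ⟨k, ?_⟩
  have : (ω : ℂ) * L = 2 * Real.pi := by exact_mod_cast hω
  linear_combination Complex.I * k * this

theorem norm_exp_omega (ω : ℝ) (k : ℤ) (z : ℂ) :
    ‖Complex.exp (Complex.I * ω * k * z)‖ = Real.exp (-(ω * k * z.im)) := by
  rw [Complex.norm_exp]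
  congr 1
  simp [mul_assoc]

theorem norm_exp_neg_omega (ω : ℝ) (k : ℤ) (t : ℝ) :
    ‖Complex.exp (-(Complex.I * ω * k * t))‖ = 1 := by
  rw [Complex.norm_exp]
  simp [mul_assoc]

theorem norm_fourierInt_le {L ω : ℝ} (hL : 0 ≤ L) {g : ℝ → ℂ} {C : ℝ}
    (hg : ∀ t ∈ Set.Icc 0 L, ‖g t‖ ≤ C) (k : ℤ) : ‖fourierInt L ω g k‖ ≤ C * L := by
  refine (intervalIntegral.norm_integral_le_of_norm_le_const (C := C) fun t ht => ?_).trans ?_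
  · rw [norm_mul, norm_exp_neg_omega, mul_one]
    rw [Set.uIoc_of_le hL] at ht
    exact hg t ⟨ht.1.le, ht.2⟩
  · simp [abs_of_nonneg hL]

theorem norm_fourierInt_le_integral {L ω : ℝ} (hL : 0 ≤ L) {g : ℝ → ℂ} (k : ℤ) :
    ‖fourierInt L ω g k‖ ≤ ∫ t in (0 : ℝ)..L, ‖g t‖ := by
  refine (intervalIntegral.norm_integral_le_integral_norm hL).trans_eq ?_
  refine intervalIntegral.integral_congr fun t _ => ?_
  simp only [norm_mul, norm_exp_neg_omega, mul_one]

theorem fourierInt_of_hasDerivAt {L ω : ℝ} (hω : ω * L = 2 * Real.pi) {g g' : ℝ → ℂ}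
    (hg : ∀ t, HasDerivAt g (g' t) t) (hg' : Continuous g') (hper : g L = g 0) (k : ℤ) :
    fourierInt L ω g' k = Complex.I * ω * k * fourierInt L ω g k := by
  have hv : ∀ t : ℝ, HasDerivAt (fun t : ℝ => Complex.exp (-(Complex.I * ω * k * t)))
      (Complex.exp (-(Complex.I * ω * k * t)) * (-(Complex.I * ω * k))) t := fun t => by
    have h1 : HasDerivAt (fun t : ℝ => -(Complex.I * ω * k * (t : ℂ))) (-(Complex.I * ω * k)) t := by
      simpa using ((Complex.ofRealCLM.hasDerivAt (x := t)).const_mul (Complex.I * ω * k)).fun_neg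
    exact h1.cexp
  have h := intervalIntegral.integral_deriv_mul_eq_sub (a := 0) (b := L)
    (fun t _ => hg t) (fun t _ => hv t) (hg'.intervalIntegrable _ _)
    (Continuous.intervalIntegrable (by fun_prop) _ _)
  have hc : Continuous g := continuous_iff_continuousAt.2 fun t => (hg t).continuousAt
  rw [intervalIntegral.integral_add (Continuous.intervalIntegrable (by fun_prop) _ _)
    (Continuous.intervalIntegrable (by fun_prop) _ _)] at h
  have e1 : Complex.exp (-(Complex.I * ω * k * (L : ℝ))) = 1 := by
    rw [Complex.exp_neg, exp_omega_period hω, inv_one]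
  rw [e1, hper] at h
  have e2 : ∫ t in (0 : ℝ)..L, g t * (Complex.exp (-(Complex.I * ω * k * t)) *
      (-(Complex.I * ω * k))) = (-(Complex.I * ω * k)) * fourierInt L ω g k := by
    rw [fourierInt, ← intervalIntegral.integral_const_mul]
    congr 1; ext t; ring
  rw [e2] at h
  simp only [Complex.ofReal_zero, mul_zero, neg_zero, Complex.exp_zero, sub_self] at h
  unfold fourierInt at h ⊢
  linear_combination h

theorem hasSum_fourierInt {L ω : ℝ} (hL : 0 < L) (hω : ω * L = 2 * Real.pi) {g : ℝ → ℂ}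
    (hg : Continuous g) (hper : ∀ t, g (t + L) = g t)
    (hs : Summable fun k => ‖fourierInt L ω g k‖) (t : ℝ) :
    HasSum (fun k : ℤ => fourierInt L ω g k / L * Complex.exp (Complex.I * ω * k * t)) (g t) := by
  have := Fact.mk hL
  have hP : Function.Periodic g L := hper
  let G : C(AddCircle L, ℂ) := ⟨hP.lift, by
    exact continuous_coinduced_dom.2 hg⟩
  have hG : ∀ t : ℝ, G (t : AddCircle L) = g t := fun t => rfl
  have hωL : (ω : ℂ) * L = 2 * Real.pi := by exact_mod_cast hω
  have hL0 : (L : ℂ) ≠ 0 := by exact_mod_cast hL.ne'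
  have hωe : (ω : ℂ) = 2 * Real.pi / L := by field_simp; exact hωL
  have he : ∀ (k : ℤ) (t : ℝ), fourier k (t : AddCircle L) =
      Complex.exp (Complex.I * ω * k * t) := fun k t => by
    rw [fourier_coe_apply, hωe]; congr 1; ring
  have hco : ∀ k, fourierCoeff G k = fourierInt L ω g k / L := fun k => by
    rw [fourierCoeff_eq_intervalIntegral _ _ 0, zero_add, fourierInt, Complex.real_smul]
    have : ∀ x : ℝ, fourier (-k) (x : AddCircle L) • G (x : AddCircle L) =
        g x * Complex.exp (-(Complex.I * ω * k * x)) := fun x => by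
      rw [he, hG, smul_eq_mul, mul_comm]; congr 2; push_cast; ring
    simp only [this]
    push_cast; ring
  have hsum : Summable (fourierCoeff G) := by
    refine Summable.of_norm ?_
    simp only [hco, norm_div]
    exact hs.div_const _
  have := has_pointwise_sum_fourier_series_of_summable hsum (t : AddCircle L)
  simpa only [hco, he, hG, smul_eq_mul] using this

theorem summable_exp_neg_abs {x : ℝ} (hx : 0 < x) :
    Summable fun k : ℤ => Real.exp (-(x * |(k : ℝ)|)) := by
  have h : Summable fun n : ℕ => Real.exp (-(x * n)) := by
    have := Real.summable_exp_nat_mul_of_ge (c := -x) (by linarith) (f := fun n => (n : ℝ))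
      (fun n => le_rfl)
    refine this.congr fun n => ?_
    ring_nf
  refine Summable.of_nat_of_neg ?_ ?_
  · simpa using h
  · simpa using h

section expSum
variable {ω A x : ℝ} {b : ℤ → ℂ}

theorem norm_expSum_term_le (hω : 0 < ω) (hb : ∀ k, ‖b k‖ ≤ A * Real.exp (-(x * |(k : ℝ)|)))
    {y : ℝ} {z : ℂ} (hz : ω * |z.im| ≤ y) (k : ℤ) :
    ‖b k * Complex.exp (Complex.I * ω * k * z)‖ ≤ A * Real.exp (-((x - y) * |(k : ℝ)|)) := by
  rw [norm_mul, norm_exp_omega]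
  have h1 : -(ω * k * z.im) ≤ y * |(k : ℝ)| := by
    refine (neg_le_abs _).trans ?_
    rw [abs_mul, abs_mul, abs_of_pos hω]
    nlinarith [abs_nonneg (k : ℝ)]
  have hA : 0 ≤ A := by
    have := (norm_nonneg _).trans (hb k)
    exact nonneg_of_mul_nonneg_left this (Real.exp_pos _)
  calc ‖b k‖ * Real.exp (-(ω * k * z.im))
      ≤ A * Real.exp (-(x * |(k : ℝ)|)) * Real.exp (y * |(k : ℝ)|) := by
        gcongr; exact hb k
    _ = _ := by
        rw [mul_assoc, ← Real.exp_add]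
        congr 2; ring

theorem hasSum_expSum (hω : 0 < ω) (hb : ∀ k, ‖b k‖ ≤ A * Real.exp (-(x * |(k : ℝ)|)))
    {z : ℂ} (hz : ω * |z.im| < x) :
    HasSum (fun k : ℤ => b k * Complex.exp (Complex.I * ω * k * z)) (expSum ω b z) := by
  refine Summable.hasSum (Summable.of_norm_bounded
    ((summable_exp_neg_abs (sub_pos.2 hz)).mul_left A)
    fun k => norm_expSum_term_le hω hb le_rfl k)

theorem isOpen_strip (ω y : ℝ) : IsOpen {z : ℂ | ω * |z.im| < y} :=
  isOpen_lt (by fun_prop) continuous_const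

theorem expSum_hasDerivAt (hω : 0 < ω) (hb : ∀ k, ‖b k‖ ≤ A * Real.exp (-(x * |(k : ℝ)|)))
    {z : ℂ} (hz : ω * |z.im| < x) :
    HasDerivAt (expSum ω b) (expSum ω (fun k => Complex.I * ω * k * b k) z) z := by
  obtain ⟨y, hzy, hyx⟩ := exists_between hz
  have hU := isOpen_strip ω y
  have hu := (summable_exp_neg_abs (sub_pos.2 hyx)).mul_left A
  have hd : ∀ (k : ℤ) (w : ℂ), HasDerivAt (fun w => b k * Complex.exp (Complex.I * ω * k * w))
      (Complex.I * ω * k * b k * Complex.exp (Complex.I * ω * k * w)) w := fun k w => by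
    have h1 : HasDerivAt (fun w : ℂ => Complex.I * ω * k * w) (Complex.I * ω * k) w := by
      simpa using (hasDerivAt_id w).const_mul (Complex.I * ω * k)
    exact (h1.cexp.const_mul (b k)).congr_deriv (by ring)
  have hf : ∀ k : ℤ, DifferentiableOn ℂ
      (fun w => b k * Complex.exp (Complex.I * ω * k * w)) {z : ℂ | ω * |z.im| < y} :=
    fun k w _ => (hd k w).differentiableAt.differentiableWithinAt
  have hle : ∀ (k : ℤ) (w : ℂ), w ∈ {z : ℂ | ω * |z.im| < y} →
      ‖b k * Complex.exp (Complex.I * ω * k * w)‖ ≤ A * Real.exp (-((x - y) * |(k : ℝ)|)) :=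
    fun k w hw => norm_expSum_term_le hω hb (le_of_lt hw) k
  have h1 := (Complex.differentiableOn_tsum_of_summable_norm hu hf hU hle).differentiableAt
    (hU.mem_nhds hzy)
  have h2 := Complex.hasSum_deriv_of_summable_norm hu hf hU hle hzy
  have h3 : expSum ω (fun k => Complex.I * ω * k * b k) z =
      deriv (fun w => ∑' k : ℤ, b k * Complex.exp (Complex.I * ω * k * w)) z := by
    rw [← h2.tsum_eq, expSum]
    exact tsum_congr fun k => ((hd k z).deriv).symm
  rw [h3]
  exact h1.hasDerivAt

theorem norm_freq_mul_le (hω : 0 < ω) (hb : ∀ k, ‖b k‖ ≤ A * Real.exp (-(x * |(k : ℝ)|)))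
    {y : ℝ} (hy : y < x) (k : ℤ) :
    ‖Complex.I * ω * k * b k‖ ≤ ω * A / (x - y) * Real.exp (-(y * |(k : ℝ)|)) := by
  have hA : 0 ≤ A := by
    have := (norm_nonneg _).trans (hb k)
    exact nonneg_of_mul_nonneg_left this (Real.exp_pos _)
  have hxy := sub_pos.2 hy
  have h3 : |(k : ℝ)| ≤ 1 / (x - y) * Real.exp ((x - y) * |(k : ℝ)|) := by
    rw [div_mul_eq_mul_div, le_div_iff₀ hxy, one_mul]
    have := Real.add_one_le_exp ((x - y) * |(k : ℝ)|)
    linarith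
  have e : ‖Complex.I * ω * k * b k‖ = ω * |(k : ℝ)| * ‖b k‖ := by
    simp [abs_of_pos hω]
  rw [e]
  calc ω * |(k : ℝ)| * ‖b k‖ ≤ ω * (1 / (x - y) * Real.exp ((x - y) * |(k : ℝ)|)) *
        (A * Real.exp (-(x * |(k : ℝ)|))) := by
        gcongr; exact hb k
    _ = ω * A / (x - y) * (Real.exp ((x - y) * |(k : ℝ)|) * Real.exp (-(x * |(k : ℝ)|))) := by ring
    _ = _ := by rw [← Real.exp_add]; ring_nf

theorem expSum_periodic {L : ℝ} (hω : ω * L = 2 * Real.pi) (b : ℤ → ℂ) (z : ℂ) :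
    expSum ω b (z + L) = expSum ω b z := by
  refine tsum_congr fun k => ?_
  rw [mul_add, Complex.exp_add, exp_omega_period hω, mul_one]

theorem norm_expSum_le (hω : 0 < ω) (hb : ∀ k, ‖b k‖ ≤ A * Real.exp (-(x * |(k : ℝ)|)))
    {y : ℝ} (hy : y < x) {z : ℂ} (hz : ω * |z.im| ≤ y) :
    ‖expSum ω b z‖ ≤ A * ∑' k : ℤ, Real.exp (-((x - y) * |(k : ℝ)|)) := by
  rw [← tsum_mul_left]
  exact tsum_of_norm_bounded ((summable_exp_neg_abs (sub_pos.2 hy)).mul_left A).hasSum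
    fun k => norm_expSum_term_le hω hb hz k

end expSum

theorem exists_holomorphic_extension_of_analyticAt {c : ℝ → ℂ} {t : ℝ} (hc : AnalyticAt ℝ c t) :
    ∃ r > 0, ∃ g : ℂ → ℂ, DifferentiableOn ℂ g (Metric.ball (t : ℂ) r) ∧
      ∀ s ∈ Metric.ball t r, c s = g s := by
  obtain ⟨p, ρ, hp⟩ := hc
  obtain ⟨r, hr0, hr⟩ := ENNReal.lt_iff_exists_nnreal_btwn.1 hp.r_pos
  have hr0' : (0 : ℝ) < r := by exact_mod_cast hr0
  obtain ⟨C, hC0, hC⟩ := p.norm_mul_pow_le_of_lt_radius (hr.trans_le hp.r_le)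
  have hdiff : DifferentiableOn ℂ (fun w : ℂ => ∑' n : ℕ, (w - t) ^ n * p.coeff n)
      (Metric.ball (t : ℂ) (r / 2)) := by
    refine Complex.differentiableOn_tsum_of_summable_norm (u := fun n => C * (1 / 2 : ℝ) ^ n)
      (summable_geometric_two.mul_left C) (fun n => by fun_prop) Metric.isOpen_ball
      fun n w hw => ?_
    rw [norm_mul, norm_pow]
    have h1 : ‖w - t‖ ≤ r / 2 := (mem_ball_iff_norm.1 hw).le
    have h2 : ‖p.coeff n‖ ≤ ‖p n‖ := by
      refine ((p n).le_opNorm _).trans_eq ?_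
      simp
    calc ‖w - t‖ ^ n * ‖p.coeff n‖ ≤ (r / 2) ^ n * ‖p n‖ := by gcongr
      _ = (‖p n‖ * r ^ n) * (1 / 2) ^ n := by rw [div_pow, one_div, inv_pow]; ring
      _ ≤ C * (1 / 2) ^ n := by gcongr; exact hC n
  refine ⟨r / 2, by positivity, _, hdiff, fun s hs => ?_⟩
  have hmem : s - t ∈ Metric.eball (0 : ℝ) ρ := by
    refine Metric.eball_subset_eball hr.le ?_
    rw [Metric.eball_coe, mem_ball_zero_iff]
    have := mem_ball_iff_norm.1 hs
    linarith
  have h := (hp.hasSum hmem).tsum_eq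
  rw [add_sub_cancel] at h
  rw [← h]
  refine tsum_congr fun n => ?_
  rw [FormalMultilinearSeries.apply_eq_pow_smul_coeff, Complex.real_smul]
  push_cast; rfl

theorem iteratedDeriv_eq_of_eqOn_ball {c : ℝ → ℂ} {t r : ℝ} {g : ℂ → ℂ}
    (hg : DifferentiableOn ℂ g (Metric.ball (t : ℂ) r))
    (h : ∀ s ∈ Metric.ball t r, c s = g s) (n : ℕ) :
    ∀ s ∈ Metric.ball t r, iteratedDeriv n c s = iteratedDeriv n g s := by
  have hmem : ∀ s : ℝ, s ∈ Metric.ball t r → (s : ℂ) ∈ Metric.ball (t : ℂ) r := fun s hs => by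
    rw [mem_ball_iff_norm] at hs ⊢
    rwa [← Complex.ofReal_sub, Complex.norm_real]
  induction n with
  | zero => simpa using h
  | succ n ih =>
    intro s hs
    rw [iteratedDeriv_succ, iteratedDeriv_succ]
    have h1 : DifferentiableAt ℂ (iteratedDeriv n g) (s : ℂ) := by
      have h2 : AnalyticOnNhd ℂ g (Metric.ball (t : ℂ) r) := hg.analyticOnNhd Metric.isOpen_ball
      have h3 := h2.iterated_deriv n
      rw [← iteratedDeriv_eq_iterate] at h3
      exact (h3 s (hmem s hs)).differentiableAt
    have h4 := h1.hasDerivAt.comp_ofReal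
    rw [← h4.deriv]
    refine Filter.EventuallyEq.deriv_eq ?_
    filter_upwards [Metric.isOpen_ball.mem_nhds hs] with w hw using ih w hw

theorem exists_iteratedDeriv_bound_of_analyticAt {c : ℝ → ℂ} {t : ℝ} (hc : AnalyticAt ℝ c t) :
    ∃ r > 0, ∃ C R : ℝ, 0 ≤ C ∧ 0 ≤ R ∧ ∀ s ∈ Metric.ball t r, ∀ n : ℕ,
      ‖iteratedDeriv n c s‖ ≤ C * n.factorial * R ^ n := by
  obtain ⟨r, hr, g, hg, hgc⟩ := exists_holomorphic_extension_of_analyticAt hc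
  have hsub : Metric.closedBall (t : ℂ) (2 * r / 3) ⊆ Metric.ball (t : ℂ) r :=
    Metric.closedBall_subset_ball (by linarith)
  obtain ⟨C, hC⟩ := (isCompact_closedBall (t : ℂ) (2 * r / 3)).exists_bound_of_continuousOn
    (hg.continuousOn.mono hsub)
  have hC0 : 0 ≤ C := (norm_nonneg _).trans (hC t (Metric.mem_closedBall_self (by positivity)))
  refine ⟨r / 3, by positivity, C, 3 / r, hC0, by positivity, fun s hs n => ?_⟩
  rw [iteratedDeriv_eq_of_eqOn_ball hg hgc n s (Metric.ball_subset_ball (by linarith) hs)]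
  have hs' : dist (s : ℂ) t < r / 3 := by
    rw [dist_eq_norm, ← Complex.ofReal_sub, Complex.norm_real]
    exact mem_ball_iff_norm.1 hs
  have hsub2 : Metric.closedBall (s : ℂ) (r / 3) ⊆ Metric.closedBall (t : ℂ) (2 * r / 3) :=
    Metric.closedBall_subset_closedBall' (by linarith)
  have := Complex.norm_iteratedDeriv_le_of_forall_mem_sphere_norm_le (c := (s : ℂ)) (R := r / 3)
    (C := C) (f := g) n (by positivity) (by
      refine (hg.mono ?_).diffContOnCl
      rw [closure_ball _ (by positivity)]
      exact hsub2.trans hsub) fun z hz => hC z (hsub2 (Metric.sphere_subset_closedBall hz))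
  refine this.trans_eq ?_
  rw [div_pow, div_pow]
  field_simp

theorem exists_iteratedDeriv_bound {c : ℝ → ℂ} (hc : AnalyticOnNhd ℝ c Set.univ) (L : ℝ) :
    ∃ C R : ℝ, 0 ≤ C ∧ 0 ≤ R ∧ ∀ s ∈ Set.Icc 0 L, ∀ n : ℕ,
      ‖iteratedDeriv n c s‖ ≤ C * n.factorial * R ^ n := by
  refine (isCompact_Icc (a := (0 : ℝ)) (b := L)).induction_on
    (p := fun S => ∃ C R : ℝ, 0 ≤ C ∧ 0 ≤ R ∧ ∀ s ∈ S, ∀ n : ℕ,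
      ‖iteratedDeriv n c s‖ ≤ C * n.factorial * R ^ n) ⟨0, 0, le_rfl, le_rfl, by simp⟩ ?_ ?_ ?_
  · rintro S T hST ⟨C, R, hC, hR, h⟩
    exact ⟨C, R, hC, hR, fun s hs => h s (hST hs)⟩
  · rintro S T ⟨C, R, hC, hR, h⟩ ⟨C', R', hC', hR', h'⟩
    refine ⟨max C C', max R R', le_max_of_le_left hC, le_max_of_le_left hR, ?_⟩
    rintro s (hs | hs) n
    · refine (h s hs n).trans ?_
      gcongr <;> exact le_max_left _ _
    · refine (h' s hs n).trans ?_
      gcongr <;> exact le_max_right _ _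
  · intro t _
    obtain ⟨r, hr, C, R, hC, hR, h⟩ := exists_iteratedDeriv_bound_of_analyticAt (hc t trivial)
    exact ⟨_, mem_nhdsWithin_of_mem_nhds (Metric.ball_mem_nhds t hr), C, R, hC, hR, h⟩

theorem fourierInt_iteratedDeriv {L ω : ℝ} (hω : ω * L = 2 * Real.pi) {c : ℝ → ℂ}
    (hc : ContDiff ℝ (⊤ : ℕ∞) c) (hper : ∀ t, c (t + L) = c t) (k : ℤ) (n : ℕ) :
    fourierInt L ω (iteratedDeriv n c) k = (Complex.I * ω * k) ^ n * fourierInt L ω c k := by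
  have hcd : ∀ n : ℕ, ContDiff ℝ (⊤ : ℕ∞) (iteratedDeriv n c) := fun n => by
    rw [iteratedDeriv_eq_iterate]; exact hc.iterate_deriv n
  induction n with
  | zero => simp
  | succ n ih =>
    rw [pow_succ', mul_assoc, ← ih]
    refine fourierInt_of_hasDerivAt hω (fun t => ?_) (hcd (n + 1)).continuous ?_ k
    · rw [iteratedDeriv_succ]
      exact ((hcd n).differentiable (by simp) t).hasDerivAt
    · have h1 : iteratedDeriv n (fun z => c (z + L)) 0 = iteratedDeriv n c (0 + L) := by
        rw [iteratedDeriv_comp_add_const]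
      rw [zero_add] at h1
      rw [← h1]
      simp only [hper]

theorem exists_fourierInt_decay {L ω : ℝ} (hL : 0 < L) (hω : ω * L = 2 * Real.pi) {c : ℝ → ℂ}
    (hc : AnalyticOnNhd ℝ c Set.univ) (hper : ∀ t, c (t + L) = c t) :
    ∃ A x : ℝ, 0 < x ∧ ∀ k : ℤ, ‖fourierInt L ω c k‖ ≤ A * Real.exp (-(x * |(k : ℝ)|)) := by
  obtain ⟨C, R, hC, hR, h⟩ := exists_iteratedDeriv_bound hc L
  have hω0 : 0 < ω := by
    by_contra! hn
    nlinarith [Real.pi_pos]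
  have hcd : ContDiff ℝ (⊤ : ℕ∞) c := hc.contDiff
  refine ⟨2 * (C * L), ω * (1 / (2 * R + 1)), by positivity, fun k => ?_⟩
  set y := 1 / (2 * R + 1) with hy
  have hy0 : 0 < y := by positivity
  have hRy : R * y ≤ 1 / 2 := by
    rw [hy, mul_one_div, div_le_div_iff₀ (by positivity) (by norm_num)]; linarith
  rw [Real.exp_neg, ← div_eq_mul_inv, le_div_iff₀ (Real.exp_pos _)]
  have hs := (NormedSpace.expSeries_div_hasSum_exp (𝔸 := ℝ) (ω * y * |(k : ℝ)|)).mul_left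
    ‖fourierInt L ω c k‖
  rw [← Real.exp_eq_exp_ℝ] at hs
  have hs2 := hasSum_geometric_two.mul_left (C * L)
  rw [mul_comm (C * L) 2] at hs2
  refine hasSum_le (fun n => ?_) hs hs2
  have h1 := norm_fourierInt_le (ω := ω) hL.le (fun t ht => h t ht n) k
  rw [fourierInt_iteratedDeriv hω hcd hper, norm_mul, norm_pow] at h1
  have h2 : ‖Complex.I * ω * k‖ = ω * |(k : ℝ)| := by simp [abs_of_pos hω0]
  rw [h2] at h1
  have hn : (0 : ℝ) < n.factorial := by exact_mod_cast n.factorial_pos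
  calc ‖fourierInt L ω c k‖ * ((ω * y * |(k : ℝ)|) ^ n / n.factorial)
      = (ω * |(k : ℝ)|) ^ n * ‖fourierInt L ω c k‖ * (y ^ n / n.factorial) := by
        rw [show ω * y * |(k : ℝ)| = (ω * |(k : ℝ)|) * y by ring, mul_pow]; ring
    _ ≤ C * n.factorial * R ^ n * L * (y ^ n / n.factorial) := by gcongr
    _ = C * L * (R * y) ^ n := by rw [mul_pow]; field_simp
    _ ≤ C * L * (1 / 2) ^ n := by gcongr

section
open Topology

theorem eq_add_int_mul_of_exp_eq {L ω : ℝ} (hω : ω * L = 2 * Real.pi) {z w : ℂ}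
    (h : Complex.exp (Complex.I * ω * z) = Complex.exp (Complex.I * ω * w)) :
    ∃ n : ℤ, z = w + n * L := by
  obtain ⟨n, hn⟩ := Complex.exp_eq_exp_iff_exists_int.1 h
  have h1 : (ω : ℂ) * L = 2 * Real.pi := by exact_mod_cast hω
  have hω0 : ω ≠ 0 := by
    rintro rfl
    linarith [Real.pi_pos]
  have h2 : Complex.I * ω ≠ 0 := mul_ne_zero Complex.I_ne_zero (by exact_mod_cast hω0)
  refine ⟨n, mul_left_cancel₀ h2 ?_⟩
  linear_combination hn - n * Complex.I * h1

theorem exists_strip_injective {L ω : ℝ} (hL : 0 < L) (hω : ω * L = 2 * Real.pi) {f : ℂ → ℂ}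
    (hper : ∀ z, f (z + L) = f z) (hf : ∀ t : ℝ, AnalyticAt ℂ f t)
    (hf' : ∀ t : ℝ, deriv f t ≠ 0) (hinj : ∀ s ∈ Set.Ico 0 L, ∀ t ∈ Set.Ico 0 L,
      f (s : ℝ) = f (t : ℝ) → s = t) :
    ∃ δ > 0, ∀ z w : ℂ, |z.im| < δ → |w.im| < δ → f z = f w → ∃ n : ℤ, z = w + n * L := by
  have hω0 : 0 < ω := by
    by_contra! hn
    nlinarith [Real.pi_pos]
  have hP : Function.Periodic f (L : ℂ) := hper
  have hIω : Complex.I * ω ≠ 0 := mul_ne_zero Complex.I_ne_zero (by exact_mod_cast hω0.ne')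
  set e : ℂ → ℂ := fun z => Complex.exp (Complex.I * ω * z) with he
  set F : ℂ → ℂ := fun w => f (Complex.log w / (Complex.I * ω)) with hF
  have hFe : ∀ z, F (e z) = f z := fun z => by
    have h1 : e (Complex.log (e z) / (Complex.I * ω)) = e z := by
      simp only [he]
      rw [mul_div_cancel₀ _ hIω, Complex.exp_log (Complex.exp_ne_zero _)]
    obtain ⟨n, hn⟩ := eq_add_int_mul_of_exp_eq hω h1
    simp only [hF]
    rw [hn, hP.int_mul n]
  have hesurj : ∀ w ∈ Metric.sphere (0 : ℂ) 1, ∃ t ∈ Set.Ico 0 L, e (t : ℝ) = w := fun w hw => by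
    have hw1 : ‖w‖ = 1 := by simpa using hw
    have h1 : Complex.exp (Complex.arg w * Complex.I) = w := by
      have := Complex.norm_mul_exp_arg_mul_I w
      rwa [hw1, Complex.ofReal_one, one_mul] at this
    obtain ⟨y, hy, n, hn⟩ : ∃ y ∈ Set.Ico 0 L, ∃ n : ℤ, Complex.arg w / ω = y + n * L := by
      refine ⟨toIcoMod hL 0 (Complex.arg w / ω), by simpa using toIcoMod_mem_Ico hL 0 _,
        toIcoDiv hL 0 (Complex.arg w / ω), ?_⟩
      rw [← zsmul_eq_mul, toIcoMod_add_toIcoDiv_zsmul]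
    refine ⟨y, hy, ?_⟩
    rw [← h1]
    simp only [he]
    rw [Complex.exp_eq_exp_iff_exists_int]
    refine ⟨-n, ?_⟩
    have h2 : Complex.arg w = ω * y + n * (2 * Real.pi) := by
      rw [← hω]; field_simp at hn; linarith
    rw [h2]; push_cast; ring
  have hed : ∀ z, HasStrictDerivAt e (e z * (Complex.I * ω)) z := fun z => by
    have h1 : HasStrictDerivAt (fun z : ℂ => Complex.I * ω * z) (Complex.I * ω) z := by
      simpa using (hasStrictDerivAt_id z).const_mul (Complex.I * ω)
    exact h1.cexp
  have hemap : ∀ z, Filter.map e (𝓝 z) = 𝓝 (e z) := fun z =>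
    (hed z).map_nhds_eq (mul_ne_zero (Complex.exp_ne_zero _) hIω)
  obtain ⟨U, hU, hUinj⟩ := Set.InjOn.exists_mem_nhdsSet (f := F) (s := Metric.sphere (0 : ℂ) 1)
    (by
      intro w hw w' hw' h
      obtain ⟨t, ht, rfl⟩ := hesurj w hw
      obtain ⟨t', ht', rfl⟩ := hesurj w' hw'
      rw [hFe, hFe] at h
      rw [hinj t ht t' ht' h]) (isCompact_sphere _ _)
    (by
      intro w hw
      obtain ⟨t, ht, rfl⟩ := hesurj w hw
      rw [ContinuousAt, ← hemap, Filter.tendsto_map'_iff, hFe]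
      have : F ∘ e = f := funext hFe
      rw [this]
      exact (hf t).continuousAt)
    (by
      intro w hw
      obtain ⟨t, ht, rfl⟩ := hesurj w hw
      have h1 := (hf t).hasStrictDerivAt
      have h2 := h1.eventually_left_inverse (hf' t)
      refine ⟨e '' {x | HasStrictDerivAt.localInverse f (deriv f t) t h1 (hf' t) (f x) = x}, ?_, ?_⟩
      · rw [← hemap]
        exact Filter.image_mem_map h2
      · rintro _ ⟨x, hx, rfl⟩ _ ⟨y, hy, rfl⟩ hxy
        rw [hFe, hFe] at hxy
        have hx' : _ = x := hx
        have hy' : _ = y := hy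
        rw [← hx', ← hy', hxy])
  obtain ⟨V, hVo, hKV, hVU⟩ := mem_nhdsSet_iff_exists.1 hU
  obtain ⟨η, hη, hηV⟩ := (isCompact_sphere (0 : ℂ) 1).exists_thickening_subset_open hVo hKV
  have hct : Filter.Tendsto (fun s : ℝ => |Real.exp (-(ω * s)) - 1|) (𝓝 0) (𝓝 0) := by
    have : Continuous fun s : ℝ => |Real.exp (-(ω * s)) - 1| := by fun_prop
    simpa using this.tendsto 0
  obtain ⟨δ, hδ, hδ'⟩ := Metric.eventually_nhds_iff.1 (hct.eventually_lt_const hη)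
  have hmem : ∀ z : ℂ, |z.im| < δ → e z ∈ U := fun z hz => by
    refine hVU (hηV ?_)
    rw [Metric.mem_thickening_iff]
    refine ⟨e (z.re : ℝ), ?_, ?_⟩
    · have := norm_exp_omega ω 1 (z.re : ℝ)
      simpa [he] using this
    · have h1 : e z = e (z.re : ℝ) * Real.exp (-(ω * z.im)) := by
        simp only [he]
        rw [Complex.ofReal_exp, ← Complex.exp_add]
        congr 1
        conv_lhs => rw [← Complex.re_add_im z]
        push_cast
        linear_combination (ω * z.im : ℂ) * Complex.I_mul_I
      have h2 : ‖e (z.re : ℝ)‖ = 1 := by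
        have := norm_exp_omega ω 1 (z.re : ℝ)
        simpa [he] using this
      rw [dist_eq_norm, h1, ← mul_sub_one, norm_mul, h2, one_mul, ← Complex.ofReal_one,
        ← Complex.ofReal_sub, Complex.norm_real]
      exact hδ' (by simpa using hz)
  refine ⟨δ, hδ, fun z w hz hw hzw => ?_⟩
  rw [← hFe z, ← hFe w] at hzw
  exact eq_add_int_mul_of_exp_eq hω (hUinj (hmem z hz) (hmem w hw) hzw)

/-- One of the two sides of a regular closed analytic boundary curve lies in the domain. -/
theorem exists_side_subset {D : Set ℂ} (hD : IsOpen D) {L δ δ' : ℝ} (hL : 0 < L) (hδ : 0 < δ)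
    (hδ' : δ ≤ δ')
    {f : ℂ → ℂ} (hf : ∀ z : ℂ, |z.im| < δ' → DifferentiableAt ℂ f z)
    (hf' : deriv f 0 ≠ 0) (hper : ∀ z, f (z + L) = f z)
    (hfr : frontier D = (fun t : ℝ => f t) '' Set.Ico 0 L)
    (hinj : ∀ z w : ℂ, |z.im| < δ → |w.im| < δ → f z = f w → ∃ n : ℤ, z = w + n * L) :
    ∃ ε : ℝ, (ε = 1 ∨ ε = -1) ∧ ∀ t s : ℝ, s ∈ Set.Ioo 0 δ →
      f (t + s * (ε * Complex.I)) ∈ D := by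
  have hP : Function.Periodic f (L : ℂ) := hper
  have hcont : ContinuousOn f {z : ℂ | |z.im| < δ} := fun z hz =>
    (hf z (lt_of_lt_of_le hz hδ')).continuousAt.continuousWithinAt
  set T : ℝ → Set ℂ := fun ε =>
    (fun p : ℝ × ℝ => f (p.1 + p.2 * (ε * Complex.I))) '' (Set.univ ×ˢ Set.Ioo 0 δ) with hT
  have him : ∀ ε : ℝ, (ε = 1 ∨ ε = -1) → ∀ t s : ℝ,
      ((t : ℂ) + s * (ε * Complex.I)).im = s * ε := fun ε _ t s => by simp
  have habs : ∀ ε : ℝ, (ε = 1 ∨ ε = -1) → ∀ s ∈ Set.Ioo 0 δ, |s * ε| = s := by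
    rintro ε (rfl | rfl) s hs <;> simp [abs_of_pos hs.1]
  have hside : ∀ ε : ℝ, (ε = 1 ∨ ε = -1) → T ε ⊆ D ∨ T ε ⊆ (closure D)ᶜ := by
    intro ε hε
    have hpre : IsPreconnected (T ε) := by
      refine ((isPreconnected_univ).prod isPreconnected_Ioo).image _ ?_
      refine hcont.comp (by fun_prop) ?_
      rintro ⟨t, s⟩ ⟨-, hs⟩
      simp only [Set.mem_ofPred_eq, him ε hε, habs ε hε s hs]
      exact hs.2
    refine hpre.subset_or_subset hD isClosed_closure.isOpen_compl
      (Set.disjoint_compl_right_iff_subset.2 subset_closure) ?_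
    rintro _ ⟨⟨t, s⟩, ⟨-, hs⟩, rfl⟩
    by_contra hn
    rw [Set.mem_union, not_or, Set.mem_compl_iff, not_not] at hn
    have h1 : f (t + s * (ε * Complex.I)) ∈ frontier D := by
      rw [hD.frontier_eq]; exact ⟨hn.2, hn.1⟩
    rw [hfr] at h1
    obtain ⟨r, hr, hr'⟩ := h1
    obtain ⟨n, hn⟩ := hinj (r : ℝ) (t + s * (ε * Complex.I)) (by simpa using hδ)
      (by rw [him ε hε, habs ε hε s hs]; exact hs.2) hr'
    have h2 := congrArg Complex.im hn
    rw [Complex.add_im, him ε hε] at h2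
    have h3 := habs ε hε s hs
    have h4 : s * ε = 0 := by simpa using h2.symm
    rw [h4] at h3
    simp at h3
    exact hs.1.ne h3
  by_contra! hcon
  have hside' : ∀ ε : ℝ, (ε = 1 ∨ ε = -1) → T ε ⊆ (closure D)ᶜ := fun ε hε => by
    refine (hside ε hε).resolve_left fun h => ?_
    obtain ⟨t, s, hs, h1⟩ := hcon ε hε
    exact h1 (h ⟨(t, s), ⟨trivial, hs⟩, rfl⟩)
  have hreal : ∀ t : ℝ, f t ∈ frontier D := fun t => by
    rw [hfr]
    refine ⟨toIcoMod hL 0 t, by simpa using toIcoMod_mem_Ico hL 0 t, ?_⟩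
    have h1 := toIcoMod_add_toIcoDiv_zsmul hL 0 t
    rw [zsmul_eq_mul] at h1
    have h2 : (t : ℂ) = (toIcoMod hL 0 t : ℝ) + (toIcoDiv hL 0 t : ℤ) * L := by
      exact_mod_cast h1.symm
    simp only
    rw [h2, hP.int_mul]
  have hdis : ∀ z : ℂ, |z.im| < δ → f z ∉ D := fun z hz => by
    rcases lt_trichotomy z.im 0 with h | h | h
    · have h1 := hside' (-1) (Or.inr rfl) ⟨(z.re, -z.im), ⟨trivial, by
        rw [abs_of_neg h] at hz; exact ⟨by linarith, hz⟩⟩, rfl⟩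
      have h2 : ((z.re : ℝ) : ℂ) + ((-z.im : ℝ) : ℂ) * (((-1 : ℝ) : ℂ) * Complex.I) = z := by
        conv_rhs => rw [← Complex.re_add_im z]
        push_cast; ring
      simp only [h2] at h1
      exact fun h3 => h1 (subset_closure h3)
    · have h2 : z = (z.re : ℝ) := by
        apply Complex.ext <;> simp [h]
      rw [h2]
      have := hreal z.re
      rw [hD.frontier_eq] at this
      exact this.2
    · have h1 := hside' 1 (Or.inl rfl) ⟨(z.re, z.im), ⟨trivial, by
        rw [abs_of_pos h] at hz; exact ⟨h, hz⟩⟩, rfl⟩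
      have h2 : ((z.re : ℝ) : ℂ) + ((z.im : ℝ) : ℂ) * (((1 : ℝ) : ℂ) * Complex.I) = z := by
        conv_rhs => rw [← Complex.re_add_im z]
        push_cast; ring
      simp only [h2] at h1
      exact fun h3 => h1 (subset_closure h3)
  have hopen : IsOpen {z : ℂ | |z.im| < δ} := isOpen_lt (by fun_prop) continuous_const
  have h0 : (0 : ℂ) ∈ {z : ℂ | |z.im| < δ} := by simpa using hδ
  have han : AnalyticAt ℂ f 0 := by
    refine DifferentiableOn.analyticAt (s := {z : ℂ | |z.im| < δ}) (fun z hz =>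
      (hf z (lt_of_lt_of_le hz hδ')).differentiableWithinAt) (hopen.mem_nhds h0)
  have hnh : f '' {z : ℂ | |z.im| < δ} ∈ 𝓝 (f 0) := by
    rw [← han.hasStrictDerivAt.map_nhds_eq hf']
    exact Filter.image_mem_map (hopen.mem_nhds h0)
  have hcl : f 0 ∈ closure D := by
    have := hreal 0
    rw [Complex.ofReal_zero] at this
    exact frontier_subset_closure this
  obtain ⟨_, ⟨z, hz, rfl⟩, hz2⟩ := mem_closure_iff_nhds.1 hcl _ hnh
  exact hdis z hz hz2

end

section
open Topology

/-- Holomorphic collar coordinates along an analytic boundary curve. -/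
theorem exists_collar {D : Set ℂ} (hD : IsOpen D) {c : ℝ → ℂ} {L ω : ℝ} (hL : 0 < L)
    (hω : ω * L = 2 * Real.pi) (hc : AnalyticOnNhd ℝ c Set.univ) (hper : ∀ t, c (t + L) = c t)
    (hunit : ∀ t, ‖deriv c t‖ = 1) (hinj : Set.InjOn c (Set.Ico 0 L))
    (hfr : frontier D = c '' Set.Ico 0 L) :
    ∃ (A x δ ε : ℝ) (b : ℤ → ℂ), 0 < δ ∧ 4 * (ω * δ) < x ∧
      (∀ k, ‖b k‖ ≤ A * Real.exp (-(x * |(k : ℝ)|))) ∧ (∀ t : ℝ, expSum ω b t = c t) ∧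
      (ε = 1 ∨ ε = -1) ∧
      (∀ t s : ℝ, s ∈ Set.Ioo 0 δ → expSum ω b (t + s * (ε * Complex.I)) ∈ D) ∧
      (∀ z w : ℂ, |z.im| < 2 * δ → |w.im| < 2 * δ → expSum ω b z = expSum ω b w →
        ∃ n : ℤ, z = w + n * L) := by
  have hω0 : 0 < ω := by
    by_contra! hn
    nlinarith [Real.pi_pos]
  obtain ⟨A, x, hx, hA⟩ := exists_fourierInt_decay hL hω hc hper
  set b : ℤ → ℂ := fun k => fourierInt L ω c k / L with hb
  have hbA : ∀ k, ‖b k‖ ≤ A / L * Real.exp (-(x * |(k : ℝ)|)) := fun k => by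
    rw [hb, norm_div, Complex.norm_real, Real.norm_of_nonneg hL.le, div_mul_eq_mul_div]
    gcongr; exact hA k
  have hs : Summable fun k => ‖fourierInt L ω c k‖ :=
    Summable.of_nonneg_of_le (fun _ => norm_nonneg _) hA ((summable_exp_neg_abs hx).mul_left A)
  have hfc : ∀ t : ℝ, expSum ω b t = c t := fun t =>
    (hasSum_fourierInt hL hω hc.continuous hper hs t).tsum_eq
  have hder : ∀ z : ℂ, ω * |z.im| < x → DifferentiableAt ℂ (expSum ω b) z := fun z hz =>
    (expSum_hasDerivAt hω0 hbA hz).differentiableAt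
  have hreal : ∀ t : ℝ, ω * |(t : ℂ).im| < x := fun t => by simpa using hx
  have hf' : ∀ t : ℝ, deriv (expSum ω b) t ≠ 0 := fun t h0 => by
    have h1 := (hder t (hreal t)).hasDerivAt.comp_ofReal
    have h2 : (fun y : ℝ => expSum ω b y) = c := funext hfc
    rw [h2, h0] at h1
    have := hunit t
    rw [h1.deriv, norm_zero] at this
    exact zero_ne_one this
  obtain ⟨δ₀, hδ₀, hδinj⟩ := exists_strip_injective hL hω (expSum_periodic hω b)
    (fun t => DifferentiableOn.analyticAt (s := {z : ℂ | ω * |z.im| < x})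
      (fun z hz => (hder z hz).differentiableWithinAt)
      ((isOpen_strip ω x).mem_nhds (hreal t))) hf' (fun s hs t ht h => by
        rw [hfc, hfc] at h; exact hinj hs ht h)
  set δ := min (δ₀ / 2) (x / (8 * ω)) with hδ
  have hδ0 : 0 < δ := by positivity
  have hδ1 : 2 * δ ≤ δ₀ := by linarith [min_le_left (δ₀ / 2) (x / (8 * ω))]
  have hδ2 : 8 * (ω * δ) ≤ x := by
    have := min_le_right (δ₀ / 2) (x / (8 * ω))
    rw [← hδ, le_div_iff₀ (by positivity)] at this
    linarith
  have hinj' : ∀ z w : ℂ, |z.im| < 2 * δ → |w.im| < 2 * δ → expSum ω b z = expSum ω b w →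
      ∃ n : ℤ, z = w + n * L := fun z w hz hw h =>
    hδinj z w (hz.trans_le hδ1) (hw.trans_le hδ1) h
  obtain ⟨ε, hε, hside⟩ := exists_side_subset hD (δ := δ) (δ' := x / ω) hL hδ0
    (by rw [le_div_iff₀ hω0]; nlinarith [mul_pos hω0 hδ0]) (f := expSum ω b)
    (fun z hz => hder z (by rwa [lt_div_iff₀ hω0, mul_comm] at hz))
    (by simpa using hf' 0) (expSum_periodic hω b)
    (by rw [hfr]; simp only [hfc])
    (fun z w hz hw h => hinj' z w (by linarith) (by linarith) h)
  refine ⟨A / L, x, δ, ε, b, hδ0, ?_, hbA, hfc, hε, hside, hinj'⟩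
  nlinarith [mul_pos hω0 hδ0]

end

theorem nonpos_of_hyperbolic_comparison {κ δ : ℝ} (hδ : 0 ≤ δ) {z z' z'' : ℝ → ℝ}
    (hz : ∀ s ∈ Set.Icc 0 δ, HasDerivAt z (z' s) s)
    (hz' : ∀ s ∈ Set.Icc 0 δ, HasDerivAt z' (z'' s) s)
    (hode : ∀ s ∈ Set.Ioo 0 δ, κ ^ 2 * z s ≤ z'' s) (h0 : z' 0 = 0) (h1 : z δ ≤ 0) :
    ∀ s ∈ Set.Icc 0 δ, z s ≤ 0 := by
  have hch : ∀ s, HasDerivAt (fun s => Real.cosh (κ * s)) (Real.sinh (κ * s) * κ) s := fun s => by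
    simpa using ((hasDerivAt_id s).const_mul κ).cosh
  have hsh : ∀ s, HasDerivAt (fun s => Real.sinh (κ * s)) (Real.cosh (κ * s) * κ) s := fun s => by
    simpa using ((hasDerivAt_id s).const_mul κ).sinh
  set W : ℝ → ℝ := fun s => z' s * Real.cosh (κ * s) - κ * (z s * Real.sinh (κ * s)) with hW
  have hWd : ∀ s ∈ Set.Icc 0 δ, HasDerivAt W ((z'' s - κ ^ 2 * z s) * Real.cosh (κ * s)) s :=
    fun s hs => (((hz' s hs).mul (hch s)).sub
      (((hz s hs).mul (hsh s)).const_mul κ)).congr_deriv (by ring)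
  have hWm : MonotoneOn W (Set.Icc 0 δ) := by
    refine monotoneOn_of_hasDerivWithinAt_nonneg (convex_Icc 0 δ)
      (fun s hs => (hWd s hs).continuousAt.continuousWithinAt)
      (fun s hs => (hWd s (interior_subset hs)).hasDerivWithinAt) fun s hs => ?_
    rw [interior_Icc] at hs
    exact mul_nonneg (sub_nonneg.2 (hode s hs)) (Real.cosh_pos _).le
  have hW0 : ∀ s ∈ Set.Icc 0 δ, 0 ≤ W s := fun s hs => by
    have := hWm ⟨le_rfl, hδ⟩ hs hs.1
    simpa [hW, h0] using this
  have hvd : ∀ s ∈ Set.Icc 0 δ, HasDerivAt (fun s => z s / Real.cosh (κ * s))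
      (W s / Real.cosh (κ * s) ^ 2) s := fun s hs =>
    ((hz s hs).div (hch s) (Real.cosh_pos _).ne').congr_deriv (by simp only [hW]; ring)
  have hvm : MonotoneOn (fun s => z s / Real.cosh (κ * s)) (Set.Icc 0 δ) := by
    refine monotoneOn_of_hasDerivWithinAt_nonneg (convex_Icc 0 δ)
      (fun s hs => (hvd s hs).continuousAt.continuousWithinAt)
      (fun s hs => (hvd s (interior_subset hs)).hasDerivWithinAt) fun s hs => ?_
    exact div_nonneg (hW0 s (interior_subset hs)) (by positivity)
  intro s hs
  have h2 := hvm hs ⟨hδ, le_rfl⟩ hs.2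
  have h3 : z s / Real.cosh (κ * s) ≤ 0 :=
    h2.trans (div_nonpos_of_nonpos_of_nonneg h1 (Real.cosh_pos _).le)
  by_contra! hn
  exact absurd h3 (not_le.2 (div_pos hn (Real.cosh_pos _)))

theorem norm_le_of_barrier {κ lam δ B : ℝ} (hδ : 0 ≤ δ) {y y' y'' q : ℝ → ℂ} {b b' b'' : ℝ → ℝ}
    (hy : ∀ s ∈ Set.Icc 0 δ, HasDerivAt y (y' s) s)
    (hy' : ∀ s ∈ Set.Icc 0 δ, HasDerivAt y' (y'' s) s)
    (hode : ∀ s ∈ Set.Ioo 0 δ, y'' s = κ ^ 2 * y s - lam ^ 2 * q s)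
    (hy0 : y' 0 = 0) (hyδ : ‖y δ‖ ≤ B)
    (hb : ∀ s, HasDerivAt b (b' s) s) (hb' : ∀ s, HasDerivAt b' (b'' s) s) (hb0 : b' 0 = 0)
    (hbδ : B ≤ b δ)
    (hbq : ∀ s ∈ Set.Ioo 0 δ, b'' s + lam ^ 2 * ‖q s‖ ≤ κ ^ 2 * b s) :
    ∀ s ∈ Set.Icc 0 δ, ‖y s‖ ≤ b s := by
  intro s hs
  obtain ⟨u, hu, hus⟩ : ∃ u : ℂ, ‖u‖ = 1 ∧ (u * y s).re = ‖y s‖ := by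
    by_cases h : y s = 0
    · exact ⟨1, by simp, by simp [h]⟩
    · have hn : (‖y s‖ : ℂ) ≠ 0 := by exact_mod_cast norm_ne_zero_iff.2 h
      refine ⟨(starRingEnd ℂ) (y s) / ‖y s‖, ?_, ?_⟩
      · rw [norm_div, RCLike.norm_conj, Complex.norm_real, norm_norm, div_self]
        exact norm_ne_zero_iff.2 h
      · rw [div_mul_eq_mul_div, ← Complex.normSq_eq_conj_mul_self, Complex.normSq_eq_norm_sq,
          ← Complex.ofReal_div, Complex.ofReal_re, sq, mul_div_assoc, div_self, mul_one]
        exact norm_ne_zero_iff.2 h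
  have hre : ∀ w : ℂ, (u * w).re ≤ ‖w‖ := fun w => by
    refine (Complex.re_le_norm _).trans ?_
    rw [norm_mul, hu, one_mul]
  have hd : ∀ (v : ℝ → ℂ) (v' : ℂ) (s : ℝ), HasDerivAt v v' s →
      HasDerivAt (fun s => (u * v s).re) (u * v').re s := fun v v' s h =>
    Complex.reCLM.hasFDerivAt.comp_hasDerivAt s (h.const_mul u)
  have := nonpos_of_hyperbolic_comparison (κ := κ) hδ (z := fun s => (u * y s).re - b s)
    (z' := fun s => (u * y' s).re - b' s) (z'' := fun s => (u * y'' s).re - b'' s)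
    (fun s hs => (hd _ _ s (hy s hs)).sub (hb s)) (fun s hs => (hd _ _ s (hy' s hs)).sub (hb' s))
    (fun s hs => by
      have h1 : (u * y'' s).re = κ ^ 2 * (u * y s).re - lam ^ 2 * (u * q s).re := by
        rw [hode s hs, mul_sub, Complex.sub_re, ← Complex.ofReal_pow, ← Complex.ofReal_pow,
          mul_left_comm, Complex.re_ofReal_mul, mul_left_comm, Complex.re_ofReal_mul]
      have h2 := mul_le_mul_of_nonneg_left (hre (q s)) (sq_nonneg lam)
      have h3 := hbq s hs
      rw [h1]; linarith)
    (by simp [hy0, hb0]) (by have := hre (y δ); linarith) s hs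
  linarith

theorem norm_le_exp_of_bootstrap {ω δ lam Q K B : ℝ} (hω : 0 < ω) (hδ : 0 < δ) (hlam : 0 ≤ lam)
    (hK : 0 ≤ K) (hKQ : 16 * Q ≤ 3 * K ^ 2) (hB : 0 ≤ B) {y y' y'' q : ℤ → ℝ → ℂ}
    (hy : ∀ k, ∀ s ∈ Set.Icc 0 δ, HasDerivAt (y k) (y' k s) s)
    (hy' : ∀ k, ∀ s ∈ Set.Icc 0 δ, HasDerivAt (y' k) (y'' k s) s)
    (hode : ∀ k, ∀ s ∈ Set.Ioo 0 δ, y'' k s = (ω * |(k : ℝ)| : ℝ) ^ 2 * y k s - lam ^ 2 * q k s)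
    (hy0 : ∀ k, y' k 0 = 0) (hyB : ∀ k, ∀ s ∈ Set.Icc 0 δ, ‖y k s‖ ≤ B)
    (hq : ∀ s ∈ Set.Ioo 0 δ, ∀ β : ℤ → ℝ,
      (∀ j k : ℤ, β (k - j) ≤ Real.exp (ω * δ / 2 * |(j : ℝ)|) * β k) →
      (∀ k, ‖y k s‖ ≤ β k) → ∀ k, ‖q k s‖ ≤ Q * β k) (k : ℤ) :
    ‖y k 0‖ ≤ 2 * B * Real.exp (K * lam * δ) * Real.exp (-(ω * δ / 2 * |(k : ℝ)|)) := by
  set M := 2 * B * Real.exp (K * lam * δ) with hM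
  have hexp1 : 1 ≤ Real.exp (K * lam * δ) := Real.one_le_exp (by positivity)
  have hM2 : 2 * B ≤ M := le_mul_of_one_le_right (by positivity) hexp1
  have hM0 : 0 ≤ M := by positivity
  set w : ℤ → ℝ → ℝ := fun k s => Real.exp (-(ω * |(k : ℝ)| / 2 * (δ - s))) with hw
  have hwpos : ∀ k s, 0 < w k s := fun k s => Real.exp_pos _
  have hwshift : ∀ s ∈ Set.Ioo 0 δ, ∀ j k : ℤ,
      w (k - j) s ≤ Real.exp (ω * δ / 2 * |(j : ℝ)|) * w k s := fun s hs j k => by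
    simp only [hw]
    rw [← Real.exp_add, Real.exp_le_exp]
    have h1 : |(k : ℝ)| ≤ |((k - j : ℤ) : ℝ)| + |(j : ℝ)| := by
      have := abs_add_le ((k : ℝ) - j) j
      rw [sub_add_cancel] at this
      push_cast; exact this
    have h2 : 0 ≤ ω / 2 * (δ - s) := mul_nonneg (by positivity) (by linarith [hs.2])
    have h3 := mul_le_mul_of_nonneg_left h1 h2
    have h4 : ω / 2 * s * |(j : ℝ)| ≥ 0 := by have := hs.1; positivity
    nlinarith
  have step : ∀ μ > 0, ∀ N ≥ 0, (∀ k, ∀ s ∈ Set.Icc 0 δ, ‖y k s‖ ≤ N * (w k s + μ)) →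
      ∀ k, ∀ s ∈ Set.Icc 0 δ, ‖y k s‖ ≤ max M (N / 2) * (w k s + μ) := by
    intro μ hμ N hN h k
    set κ := ω * |(k : ℝ)| with hκ
    have hκ0 : 0 ≤ κ := by positivity
    rcases lt_or_ge κ (K * lam) with hlt | hge
    · intro s hs
      have h1 : Real.exp (-(K * lam * δ)) ≤ w k s := by
        simp only [hw]
        rw [Real.exp_le_exp, neg_le_neg_iff, ← hκ]
        have : κ / 2 * (δ - s) ≤ κ * δ := by nlinarith [hs.1, mul_nonneg hκ0 hs.1, mul_nonneg hκ0 hδ.le]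
        nlinarith
      calc ‖y k s‖ ≤ B := hyB k s hs
        _ ≤ 2 * B := by linarith
        _ = M * Real.exp (-(K * lam * δ)) := by
          rw [hM, mul_assoc, ← Real.exp_add, add_neg_cancel, Real.exp_zero, mul_one]
        _ ≤ M * (w k s + μ) := by gcongr; linarith
        _ ≤ _ := by
          have := hwpos k s
          gcongr; exact le_max_left _ _
    · set A := max M (N / 2) with hA
      have hA0 : 0 ≤ A := hM0.trans (le_max_left _ _)
      set E := Real.exp (-(κ / 2 * δ)) with hE
      have hE0 : 0 < E := Real.exp_pos _
      have hwE : ∀ s, w k s = Real.exp (κ / 2 * s) * E := fun s => by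
        simp only [hw, hE]; rw [← Real.exp_add, ← hκ]; congr 1; ring
      have hlow : ∀ s, w k s / 2 ≤ Real.cosh (κ / 2 * s) * E := fun s => by
        rw [hwE, Real.cosh_eq]
        have : 0 < Real.exp (-(κ / 2 * s)) * E := by positivity
        linarith
      have hup : ∀ s, 0 ≤ s → Real.cosh (κ / 2 * s) * E ≤ w k s := fun s hs => by
        rw [hwE, Real.cosh_eq]
        have h2 : Real.exp (-(κ / 2 * s)) ≤ Real.exp (κ / 2 * s) :=
          Real.exp_le_exp.2 (by nlinarith [mul_nonneg hκ0 hs])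
        gcongr; linarith
      have hch : ∀ s, HasDerivAt (fun s => Real.cosh (κ / 2 * s))
          (Real.sinh (κ / 2 * s) * (κ / 2)) s := fun s => by
        simpa using ((hasDerivAt_id s).const_mul (κ / 2)).cosh
      have hsh : ∀ s, HasDerivAt (fun s => Real.sinh (κ / 2 * s))
          (Real.cosh (κ / 2 * s) * (κ / 2)) s := fun s => by
        simpa using ((hasDerivAt_id s).const_mul (κ / 2)).sinh
      have hbar := norm_le_of_barrier (κ := κ) (lam := lam) (B := B) hδ.le (q := q k)
        (hy k) (hy' k) (hode k) (hy0 k) (hyB k δ ⟨hδ.le, le_rfl⟩)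
        (b := fun s => A * (Real.cosh (κ / 2 * s) * E + μ))
        (b' := fun s => A * (Real.sinh (κ / 2 * s) * (κ / 2) * E))
        (b'' := fun s => A * (Real.cosh (κ / 2 * s) * (κ / 2) * (κ / 2) * E))
        (fun s => (((hch s).mul_const E).add_const μ).const_mul A)
        (fun s => (((hsh s).mul_const (κ / 2)).mul_const E).const_mul A) (by simp)
        (by
          have h1 := hlow δ
          have h2 : w k δ = 1 := by simp [hw]
          rw [h2] at h1
          have h3 : 2 * B ≤ A := hM2.trans (le_max_left _ _)
          nlinarith)
        (by
          intro s hs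
          have h1 := hq s hs (fun k => N * (w k s + μ)) (fun j k => by
            have h2 := hwshift s hs j k
            have h3 : 1 ≤ Real.exp (ω * δ / 2 * |(j : ℝ)|) := Real.one_le_exp (by positivity)
            have h4 : w (k - j) s + μ ≤ Real.exp (ω * δ / 2 * |(j : ℝ)|) * (w k s + μ) := by
              nlinarith
            rw [mul_left_comm]
            gcongr) (fun k => h k s ⟨hs.1.le, hs.2.le⟩) k
          have h5 : N / 2 ≤ A := le_max_right _ _
          have h6 := hlow s
          have h7 : (K * lam) ^ 2 ≤ κ ^ 2 := by gcongr
          have hw0 := hwpos k s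
          have h8 : lam ^ 2 * ‖q k s‖ ≤ lam ^ 2 * (Q * (N * (w k s + μ))) := by gcongr
          have h9 : lam ^ 2 * (16 * Q) ≤ lam ^ 2 * (3 * K ^ 2) := by gcongr
          have h10 : 16 * (lam ^ 2 * Q) ≤ 3 * κ ^ 2 := by nlinarith
          have h11 : 16 * (lam ^ 2 * Q) * (N * (w k s + μ)) ≤ 3 * κ ^ 2 * (N * (w k s + μ)) := by
            gcongr
          have h12 : N / 2 * (κ ^ 2 * (w k s + μ)) ≤ A * (κ ^ 2 * (w k s + μ)) := by gcongr
          have h13 : A * κ ^ 2 * (w k s / 2) ≤ A * κ ^ 2 * (Real.cosh (κ / 2 * s) * E) := by gcongr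
          have h14 : 0 ≤ A * κ ^ 2 * μ := by positivity
          nlinarith)
      intro s hs
      refine (hbar s hs).trans ?_
      have := hup s hs.1
      gcongr
  have main : ∀ μ > 0, ∀ k, ∀ s ∈ Set.Icc 0 δ, ‖y k s‖ ≤ M * (w k s + μ) := by
    intro μ hμ
    have iter : ∀ n : ℕ, ∀ k, ∀ s ∈ Set.Icc 0 δ,
        ‖y k s‖ ≤ max M (B / μ / 2 ^ n) * (w k s + μ) := by
      intro n
      induction n with
      | zero =>
        intro k s hs
        have h1 := hwpos k s
        calc ‖y k s‖ ≤ B := hyB k s hs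
          _ = B / μ * μ := by field_simp
          _ ≤ max M (B / μ / 2 ^ 0) * (w k s + μ) := by
            gcongr
            · simp
            · linarith
      | succ n ih =>
        have h1 := step μ hμ _ (hM0.trans (le_max_left _ _)) ih
        intro k s hs
        refine (h1 k s hs).trans ?_
        have h2 := hwpos k s
        refine mul_le_mul_of_nonneg_right (max_le (le_max_left _ _) ?_) (by linarith)
        rw [pow_succ, ← div_div, div_le_iff₀ two_pos]
        exact max_le (by linarith [le_max_left M (B / μ / 2 ^ n / 2)])
          (by linarith [le_max_right M (B / μ / 2 ^ n / 2)])
    intro k s hs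
    have hlim : Filter.Tendsto (fun n : ℕ => B / μ / 2 ^ n) Filter.atTop (nhds 0) :=
      tendsto_const_nhds.div_atTop (tendsto_pow_atTop_atTop_of_one_lt (by norm_num))
    have hlim2 : Filter.Tendsto (fun n : ℕ => max M (B / μ / 2 ^ n) * (w k s + μ)) Filter.atTop
        (nhds (max M 0 * (w k s + μ))) := (tendsto_const_nhds.max hlim).mul_const _
    rw [max_eq_left hM0] at hlim2
    exact ge_of_tendsto' hlim2 fun n => iter n k s hs
  have h1 : ‖y k 0‖ ≤ M * (w k 0 + 0) := by
    have hlim : Filter.Tendsto (fun μ : ℝ => M * (w k 0 + μ)) (nhdsWithin 0 (Set.Ioi 0))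
        (nhds (M * (w k 0 + 0))) := by
      have : Continuous fun μ : ℝ => M * (w k 0 + μ) := by fun_prop
      exact (this.tendsto 0).mono_left nhdsWithin_le_nhds
    refine ge_of_tendsto hlim ?_
    filter_upwards [self_mem_nhdsWithin] with μ hμ using main μ hμ k 0 ⟨le_rfl, hδ.le⟩
  refine h1.trans_eq ?_
  simp only [hw, add_zero, sub_zero]
  congr 2; ring

theorem hasDerivAt_fourierInt_param {L ω x ε : ℝ} (hω : 0 < ω) (hε : ε = 1 ∨ ε = -1)
    {G G' : ℂ → ℂ} (hG' : ContinuousOn G' {z : ℂ | ω * |z.im| < x})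
    (hd : ∀ z : ℂ, ω * |z.im| < x →
      HasDerivAt (fun r : ℝ => G (z + r * (ε * Complex.I))) (G' z) 0)
    (hG : ContinuousOn G {z : ℂ | ω * |z.im| < x})
    (k : ℤ) {s : ℝ} (hs : ω * |s| < x) :
    HasDerivAt (fun s : ℝ => fourierInt L ω (fun t => G (t + s * (ε * Complex.I))) k)
      (fourierInt L ω (fun t => G' (t + s * (ε * Complex.I))) k) s := by
  have him : ∀ t s : ℝ, |((t : ℂ) + s * (ε * Complex.I)).im| = |s| := fun t s => by
    rcases hε with rfl | rfl <;> simp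
  have hd' : ∀ t s : ℝ, ω * |s| < x → HasDerivAt (fun s : ℝ => G (t + s * (ε * Complex.I)))
      (G' (t + s * (ε * Complex.I))) s := fun t s hs => by
    have h := hd (t + s * (ε * Complex.I)) (by rwa [him])
    have h2 := HasDerivAt.comp_sub_const s s (f := fun r : ℝ =>
      G (t + s * (ε * Complex.I) + r * (ε * Complex.I))) (by simpa using h)
    refine h2.congr_of_eventuallyEq (Filter.Eventually.of_forall fun r => ?_)
    simp only; congr 1; push_cast; ring
  obtain ⟨y, hsy, hyx⟩ := exists_between hs
  have hopen : IsOpen {s : ℝ | ω * |s| < y} := isOpen_lt (by fun_prop) continuous_const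
  have hcont : ∀ {H : ℂ → ℂ}, ContinuousOn H {z : ℂ | ω * |z.im| < x} → ∀ s : ℝ, ω * |s| < x →
      Continuous fun t : ℝ => H (t + s * (ε * Complex.I)) := fun {H} hH s hs => by
    refine hH.comp_continuous (by fun_prop) fun t => ?_
    simp only [Set.mem_ofPred_eq, him, hs]
  have hK : IsCompact (Set.uIcc 0 L ×ˢ {s : ℝ | ω * |s| ≤ y}) := by
    refine isCompact_uIcc.prod (Metric.isCompact_of_isClosed_isBounded
      (isClosed_le (by fun_prop) continuous_const) ?_)
    refine (Metric.isBounded_closedBall (x := (0 : ℝ)) (r := y / ω)).subset fun s hs => ?_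
    rw [mem_closedBall_zero_iff, Real.norm_eq_abs, le_div_iff₀ hω, mul_comm]; exact hs
  have hj : ContinuousOn (fun p : ℝ × ℝ => G' (p.1 + p.2 * (ε * Complex.I)))
      (Set.uIcc 0 L ×ˢ {s : ℝ | ω * |s| ≤ y}) := by
    refine hG'.comp (by fun_prop) fun p hp => ?_
    simp only [Set.mem_ofPred_eq, him]
    exact lt_of_le_of_lt hp.2 hyx
  obtain ⟨C, hC⟩ := hK.exists_bound_of_continuousOn hj
  have key := intervalIntegral.hasDerivAt_integral_of_dominated_loc_of_deriv_le (μ := volume)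
    (a := 0) (b := L) (x₀ := s) (s := {s : ℝ | ω * |s| < y}) (bound := fun _ => C)
    (𝕜 := ℝ) (F := fun (s : ℝ) (t : ℝ) => G (t + s * (ε * Complex.I)) * Complex.exp (-(Complex.I * ω * k * t)))
    (F' := fun (s : ℝ) (t : ℝ) => G' (t + s * (ε * Complex.I)) * Complex.exp (-(Complex.I * ω * k * t)))
    (hopen.mem_nhds hsy) ?_ ?_ ?_ ?_ ?_ ?_
  · exact key.2
  · filter_upwards [hopen.mem_nhds hsy] with r hr
    exact ((hcont hG r (lt_trans hr hyx)).mul (by fun_prop)).aestronglyMeasurable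
  · exact ((hcont hG s hs).mul (by fun_prop)).intervalIntegrable _ _
  · exact ((hcont hG' s hs).mul (by fun_prop)).aestronglyMeasurable
  · refine Filter.Eventually.of_forall fun t ht r hr => ?_
    rw [norm_mul, norm_exp_neg_omega, mul_one]
    exact hC (t, r) ⟨Set.uIoc_subset_uIcc ht, (le_of_lt hr : ω * |r| ≤ y)⟩
  · simp
  · refine Filter.Eventually.of_forall fun t _ r hr => ?_
    exact (hd' t r (lt_trans hr hyx)).mul_const _

section directional
variable {ψ : ℂ → ℝ} {f f₁ f₂ : ℂ → ℂ} {z : ℂ}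

theorem hasDerivAt_comp_line (hψ : ContDiff ℝ (⊤ : ℕ∞) ψ) (hf : HasDerivAt f (f₁ z) z) (v : ℂ) :
    HasDerivAt (fun r : ℝ => ψ (f (z + r * v))) (fderiv ℝ ψ (f z) (f₁ z * v)) 0 := by
  have hl : HasDerivAt (fun r : ℝ => z + r * v) v 0 := by
    simpa using ((Complex.ofRealCLM.hasDerivAt (x := 0)).mul_const v).const_add z
  have h1 : HasDerivAt (fun r : ℝ => f (z + r * v)) (f₁ z * v) 0 := by
    have hf' : HasDerivAt f (f₁ z) (z + (0 : ℝ) * v) := by simpa using hf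
    exact HasDerivAt.comp (h₂ := f) (𝕜 := ℝ) (𝕜' := ℂ) 0 hf' hl
  have hd := ((hψ.differentiable (by simp)).differentiableAt (x := f z)).hasFDerivAt
  have hd' : HasFDerivAt ψ (fderiv ℝ ψ (f z)) (f (z + (0 : ℝ) * v)) := by simpa using hd
  exact hd'.comp_hasDerivAt 0 h1

theorem hasDerivAt_fderiv_comp_line (hψ : ContDiff ℝ (⊤ : ℕ∞) ψ) (hf : HasDerivAt f (f₁ z) z)
    (hf₁ : HasDerivAt f₁ (f₂ z) z) (v : ℂ) :
    HasDerivAt (fun r : ℝ => fderiv ℝ ψ (f (z + r * v)) (f₁ (z + r * v) * v))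
      (fderiv ℝ (fderiv ℝ ψ) (f z) (f₁ z * v) (f₁ z * v) + fderiv ℝ ψ (f z) (f₂ z * v * v)) 0 := by
  have hl : HasDerivAt (fun r : ℝ => z + r * v) v 0 := by
    simpa using ((Complex.ofRealCLM.hasDerivAt (x := 0)).mul_const v).const_add z
  have h1 : HasDerivAt (fun r : ℝ => f (z + r * v)) (f₁ z * v) 0 := by
    have hf' : HasDerivAt f (f₁ z) (z + (0 : ℝ) * v) := by simpa using hf
    exact HasDerivAt.comp (h₂ := f) (𝕜 := ℝ) (𝕜' := ℂ) 0 hf' hl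
  have h2 : HasDerivAt (fun r : ℝ => f₁ (z + r * v) * v) (f₂ z * v * v) 0 := by
    have hf' : HasDerivAt f₁ (f₂ z) (z + (0 : ℝ) * v) := by simpa using hf₁
    exact (HasDerivAt.comp (h₂ := f₁) (𝕜 := ℝ) (𝕜' := ℂ) 0 hf' hl).mul_const v
  have hψ' : ContDiff ℝ (⊤ : ℕ∞) (fderiv ℝ ψ) := hψ.fderiv_right (by simp)
  have hd := ((hψ'.differentiable (by simp)).differentiableAt (x := f z)).hasFDerivAt
  have hd' : HasFDerivAt (fderiv ℝ ψ) (fderiv ℝ (fderiv ℝ ψ) (f z)) (f (z + (0 : ℝ) * v)) := by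
    simpa using hd
  have h3 := hd'.comp_hasDerivAt 0 h1
  have h4 := h3.clm_apply h2
  simpa using h4

theorem second_deriv_add_rotate (hψ : ContDiff ℝ (⊤ : ℕ∞) ψ) {ε : ℝ} (hε : ε = 1 ∨ ε = -1)
    (w a b : ℂ) :
    (fderiv ℝ (fderiv ℝ ψ) w (a * (ε * Complex.I)) (a * (ε * Complex.I)) +
        fderiv ℝ ψ w (b * (ε * Complex.I) * (ε * Complex.I))) +
      (fderiv ℝ (fderiv ℝ ψ) w (a * 1) (a * 1) + fderiv ℝ ψ w (b * 1 * 1)) =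
    Complex.normSq a * (fderiv ℝ (fun y => fderiv ℝ ψ y 1) w 1 +
      fderiv ℝ (fun y => fderiv ℝ ψ y Complex.I) w Complex.I) := by
  have hψ' : ContDiff ℝ (⊤ : ℕ∞) (fderiv ℝ ψ) := hψ.fderiv_right (by simp)
  have hd := (hψ'.differentiable (by simp)).differentiableAt (x := w)
  have e : ∀ u : ℂ, fderiv ℝ (fun y => fderiv ℝ ψ y u) w u = fderiv ℝ (fderiv ℝ ψ) w u u :=
    fun u => by rw [fderiv_clm_apply hd (by fun_prop)]; simp
  rw [e, e]
  have hε2 : (ε : ℂ) * ε = 1 := by rcases hε with rfl | rfl <;> simp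
  have hb : b * (ε * Complex.I) * (ε * Complex.I) = -(b * 1 * 1) := by
    linear_combination (b * Complex.I * Complex.I) * hε2 + b * Complex.I_mul_I
  have hεr : ε * ε = 1 := by rcases hε with rfl | rfl <;> simp
  have ha : a * 1 = a.re • (1 : ℂ) + a.im • Complex.I := by
    simp [Complex.re_add_im]
  have ha' : a * (ε * Complex.I) = (-(ε * a.im)) • (1 : ℂ) + (ε * a.re) • Complex.I := by
    apply Complex.ext <;> simp <;> ring
  rw [hb, map_neg, ha', ha, Complex.normSq_apply]
  simp only [map_add, map_smul, add_apply, smul_apply,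
    smul_eq_mul]
  generalize fderiv ℝ (fderiv ℝ ψ) w 1 1 = p
  generalize fderiv ℝ (fderiv ℝ ψ) w 1 Complex.I = q
  generalize fderiv ℝ (fderiv ℝ ψ) w Complex.I 1 = r
  generalize fderiv ℝ (fderiv ℝ ψ) w Complex.I Complex.I = t
  linear_combination (a.im ^ 2 * p - a.im * a.re * (q + r) + a.re ^ 2 * t) * hεr

end directional

theorem norm_fourierInt_mul_le {L ω σ : ℝ} {a : ℤ → ℂ} (hσ : 0 ≤ σ)
    (ha : Summable fun j : ℤ => ‖a j‖ * Real.exp (σ * |(j : ℝ)|)) {g h : ℝ → ℂ}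
    (hg : Continuous g)
    (hh : ∀ t : ℝ, HasSum (fun j : ℤ => a j * Complex.exp (Complex.I * ω * j * t)) (h t))
    {β : ℤ → ℝ} (hβ : ∀ j k : ℤ, β (k - j) ≤ Real.exp (σ * |(j : ℝ)|) * β k)
    (hgβ : ∀ k, ‖fourierInt L ω g k‖ ≤ β k) (k : ℤ) :
    ‖fourierInt L ω (fun t => h t * g t) k‖ ≤
      (∑' j : ℤ, ‖a j‖ * Real.exp (σ * |(j : ℝ)|)) * β k := by
  have ha' : Summable fun j : ℤ => ‖a j‖ := Summable.of_nonneg_of_le (fun _ => norm_nonneg _)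
    (fun j => le_mul_of_one_le_right (norm_nonneg _) (Real.one_le_exp (by positivity))) ha
  obtain ⟨C, hC⟩ := (isCompact_uIcc (a := (0 : ℝ)) (b := L)).exists_bound_of_continuousOn
    hg.continuousOn
  have hne : ∀ (j : ℤ) (t : ℝ), ‖Complex.exp (Complex.I * ω * j * t)‖ = 1 := fun j t => by
    rw [norm_exp_omega]; simp
  have key : HasSum (fun j : ℤ => ∫ t in (0 : ℝ)..L, a j * Complex.exp (Complex.I * ω * j * t) *
      (g t * Complex.exp (-(Complex.I * ω * k * t))))
      (∫ t in (0 : ℝ)..L, h t * (g t * Complex.exp (-(Complex.I * ω * k * t)))) := by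
    refine intervalIntegral.hasSum_integral_of_dominated_convergence (fun j _ => ‖a j‖ * C)
      (fun j => Continuous.aestronglyMeasurable (by fun_prop))
      (fun j => Filter.Eventually.of_forall fun t ht => ?_)
      (Filter.Eventually.of_forall fun t _ => ha'.mul_right C)
      (by simp) (Filter.Eventually.of_forall fun t _ => (hh t).mul_right _)
    rw [norm_mul, norm_mul, norm_mul, hne, norm_exp_neg_omega, mul_one, mul_one]
    exact mul_le_mul_of_nonneg_left (hC t (Set.uIoc_subset_uIcc ht)) (norm_nonneg _)
  have e1 : ∀ j : ℤ, (∫ t in (0 : ℝ)..L, a j * Complex.exp (Complex.I * ω * j * t) *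
      (g t * Complex.exp (-(Complex.I * ω * k * t)))) = a j * fourierInt L ω g (k - j) := fun j => by
    rw [fourierInt, ← intervalIntegral.integral_const_mul]
    refine intervalIntegral.integral_congr fun t _ => ?_
    have : Complex.exp (-(Complex.I * ω * (k - j : ℤ) * t)) =
        Complex.exp (Complex.I * ω * j * t) * Complex.exp (-(Complex.I * ω * k * t)) := by
      rw [← Complex.exp_add]; congr 1; push_cast; ring
    simp only [this]; ring
  simp only [e1] at key
  have e2 : fourierInt L ω (fun t => h t * g t) k =
      ∫ t in (0 : ℝ)..L, h t * (g t * Complex.exp (-(Complex.I * ω * k * t))) := by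
    simp only [fourierInt, mul_assoc]
  rw [e2, ← key.tsum_eq]
  have h3 := ha.mul_right (β k)
  rw [← tsum_mul_right]
  refine tsum_of_norm_bounded h3.hasSum fun j => ?_
  rw [norm_mul, mul_assoc]
  exact mul_le_mul_of_nonneg_left ((hgβ _).trans (hβ j k)) (norm_nonneg _)

/-- Multiplication by `|expSum ω b|²` along a horizontal line, in Fourier space. -/
theorem norm_fourierInt_normSq_mul_le {L ω σ A x : ℝ} {b : ℤ → ℂ} (hω : 0 < ω) (hσ : 0 ≤ σ)
    (hb : ∀ k, ‖b k‖ ≤ A * Real.exp (-(x * |(k : ℝ)|))) {w : ℂ}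
    {y : ℝ} (hy : ω * |w.im| + σ ≤ y) (hyx : y < x) {g : ℝ → ℂ} (hg : Continuous g)
    {β : ℤ → ℝ} (hβ : ∀ j k : ℤ, β (k - j) ≤ Real.exp (σ * |(j : ℝ)|) * β k)
    (hgβ : ∀ k, ‖fourierInt L ω g k‖ ≤ β k) (k : ℤ) :
    ‖fourierInt L ω (fun t => (Complex.normSq (expSum ω b (t + w)) : ℂ) * g t) k‖ ≤
      (A * ∑' j : ℤ, Real.exp (-((x - y) * |(j : ℝ)|))) ^ 2 * β k := by
  have hwx : ∀ t : ℝ, ω * |((t : ℂ) + w).im| < x := fun t => by simp; linarith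
  set a : ℤ → ℂ := fun j => b j * Complex.exp (Complex.I * ω * j * w) with ha
  have hbd : ∀ j : ℤ, ‖a j‖ * Real.exp (σ * |(j : ℝ)|) ≤ A * Real.exp (-((x - y) * |(j : ℝ)|)) :=
    fun j => by
      have h1 := norm_expSum_term_le hω hb (y := y - σ) (z := w) (by linarith) j
      calc ‖a j‖ * Real.exp (σ * |(j : ℝ)|)
          ≤ A * Real.exp (-((x - (y - σ)) * |(j : ℝ)|)) * Real.exp (σ * |(j : ℝ)|) := by gcongr
        _ = _ := by rw [mul_assoc, ← Real.exp_add]; ring_nf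
  have hsT := (summable_exp_neg_abs (sub_pos.2 hyx)).mul_left A
  have hsa : Summable fun j : ℤ => ‖a j‖ * Real.exp (σ * |(j : ℝ)|) :=
    Summable.of_nonneg_of_le (fun j => by positivity) hbd hsT
  set S := ∑' j : ℤ, ‖a j‖ * Real.exp (σ * |(j : ℝ)|) with hS
  have hS0 : 0 ≤ S := tsum_nonneg fun j => by positivity
  have hST : S ≤ A * ∑' j : ℤ, Real.exp (-((x - y) * |(j : ℝ)|)) := by
    rw [← tsum_mul_left]; exact hsa.tsum_le_tsum hbd hsT
  have hh : ∀ t : ℝ, HasSum (fun j : ℤ => a j * Complex.exp (Complex.I * ω * j * t))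
      (expSum ω b (t + w)) := fun t => by
    refine (hasSum_expSum hω hb (hwx t)).congr_fun fun j => ?_
    rw [ha, mul_assoc, ← Complex.exp_add]; congr 2; ring
  have hh' : ∀ t : ℝ, HasSum (fun j : ℤ => star (a (-j)) * Complex.exp (Complex.I * ω * j * t))
      (star (expSum ω b (t + w))) := fun t => by
    have h1 := (hh t).star
    rw [← (Equiv.neg ℤ).hasSum_iff] at h1
    refine h1.congr_fun fun j => ?_
    simp only [Function.comp_apply, Equiv.neg_apply, star_mul']
    congr 1
    rw [Complex.star_def, ← Complex.exp_conj]
    simp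
  have hcont : Continuous fun t : ℝ => expSum ω b (t + w) := continuous_iff_continuousAt.2 fun t =>
    ContinuousAt.comp (g := expSum ω b) (f := fun t : ℝ => (t : ℂ) + w)
      (expSum_hasDerivAt hω hb (hwx t)).continuousAt (by fun_prop)
  have s1 := norm_fourierInt_mul_le hσ hsa hg hh hβ hgβ
  have hsa' : Summable fun j : ℤ => ‖star (a (-j))‖ * Real.exp (σ * |(j : ℝ)|) := by
    have := (Equiv.neg ℤ).summable_iff.2 hsa
    refine this.congr fun j => ?_
    simp
  have hS' : ∑' j : ℤ, ‖star (a (-j))‖ * Real.exp (σ * |(j : ℝ)|) = S := by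
    rw [hS, ← (Equiv.neg ℤ).tsum_eq]
    refine tsum_congr fun j => ?_
    simp
  have s2 := norm_fourierInt_mul_le hσ hsa' (hcont.mul hg) hh' (β := fun k => S * β k)
    (fun j k => by
      have := mul_le_mul_of_nonneg_left (hβ j k) hS0
      linarith) s1 k
  rw [hS'] at s2
  have e : (fun t : ℝ => (Complex.normSq (expSum ω b (t + w)) : ℂ) * g t) =
      fun t : ℝ => star (expSum ω b (t + w)) * (expSum ω b (t + w) * g t) := by
    ext t
    rw [Complex.normSq_eq_conj_mul_self, mul_assoc, Complex.star_def]
  rw [e]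
  have hβ0 : 0 ≤ β k := (norm_nonneg _).trans (hgβ k)
  calc _ ≤ S * (S * β k) := s2
    _ = S ^ 2 * β k := by ring
    _ ≤ _ := by gcongr

theorem fourierInt_const_mul_sub {L ω : ℝ} {g h : ℝ → ℂ} (hg : Continuous g) (hh : Continuous h)
    (c : ℂ) (k : ℤ) : fourierInt L ω (fun t => c * g t - h t) k =
      c * fourierInt L ω g k - fourierInt L ω h k := by
  simp only [fourierInt, sub_mul, mul_assoc]
  rw [intervalIntegral.integral_sub (Continuous.intervalIntegrable (by fun_prop) _ _)
    (Continuous.intervalIntegrable (by fun_prop) _ _), intervalIntegral.integral_const_mul]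

theorem fourierInt_boundary_le {L ω A x δ ε : ℝ} {b : ℤ → ℂ} (hω : 0 < ω)
    (hωL : ω * L = 2 * Real.pi) (hb : ∀ k, ‖b k‖ ≤ A * Real.exp (-(x * |(k : ℝ)|)))
    (hδ : 0 < δ) (hδx : 4 * (ω * δ) < x) (hε : ε = 1 ∨ ε = -1) :
    ∃ K : ℝ, 0 ≤ K ∧ ∀ (ψ : ℂ → ℝ) (lam B : ℝ), ContDiff ℝ (⊤ : ℕ∞) ψ → 0 ≤ lam → 0 ≤ B →
      (∀ t s : ℝ, s ∈ Set.Ioo 0 δ →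
        fderiv ℝ (fun y => fderiv ℝ ψ y 1) (expSum ω b (t + s * (ε * Complex.I))) 1 +
        fderiv ℝ (fun y => fderiv ℝ ψ y Complex.I) (expSum ω b (t + s * (ε * Complex.I))) Complex.I
          = -lam ^ 2 * ψ (expSum ω b (t + s * (ε * Complex.I)))) →
      (∀ t : ℝ, fderiv ℝ ψ (expSum ω b t)
        (expSum ω (fun k => Complex.I * ω * k * b k) t * Complex.I) = 0) →
      (∀ k, ∀ s ∈ Set.Icc 0 δ,
        ‖fourierInt L ω (fun t => (ψ (expSum ω b (t + s * (ε * Complex.I))) : ℂ)) k‖ ≤ B) →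
      ∀ k, ‖fourierInt L ω (fun t => (ψ (expSum ω b t) : ℂ)) k‖ ≤
        2 * B * Real.exp (K * lam * δ) * Real.exp (-(ω * δ / 2 * |(k : ℝ)|)) := by
  have hωδ : 0 < ω * δ := by positivity
  set f := expSum ω b with hf
  set f₁ := expSum ω (fun k => Complex.I * ω * k * b k) with hf₁
  set f₂ := expSum ω (fun k => Complex.I * ω * k * (Complex.I * ω * k * b k)) with hf₂
  set f₃ := expSum ω (fun k => Complex.I * ω * k * (Complex.I * ω * k * (Complex.I * ω * k * b k)))
    with hf₃
  have d0 : ∀ z : ℂ, ω * |z.im| < x → HasDerivAt f (f₁ z) z := fun z hz =>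
    expSum_hasDerivAt hω hb hz
  have d1 : ∀ z : ℂ, ω * |z.im| < x → HasDerivAt f₁ (f₂ z) z := fun z hz => by
    obtain ⟨y, hzy, hyx⟩ := exists_between hz
    exact expSum_hasDerivAt hω (norm_freq_mul_le hω hb hyx) hzy
  have d2 : ∀ z : ℂ, ω * |z.im| < x → HasDerivAt f₂ (f₃ z) z := fun z hz => by
    obtain ⟨y, hzy, hyx⟩ := exists_between hz
    obtain ⟨y', hyy', hyx'⟩ := exists_between hyx
    exact expSum_hasDerivAt hω (norm_freq_mul_le hω (norm_freq_mul_le hω hb hyx') hyy') hzy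
  set S : Set ℂ := {z : ℂ | ω * |z.im| < x} with hS
  have c0 : ContinuousOn f S := fun z hz => (d0 z hz).continuousAt.continuousWithinAt
  have c1 : ContinuousOn f₁ S := fun z hz => (d1 z hz).continuousAt.continuousWithinAt
  have c2 : ContinuousOn f₂ S := fun z hz => (d2 z hz).continuousAt.continuousWithinAt
  set A₁ := ω * A / (x - 3 * (ω * δ)) with hA₁
  have hb₁ : ∀ k : ℤ, ‖Complex.I * ω * k * b k‖ ≤
      A₁ * Real.exp (-(3 * (ω * δ) * |(k : ℝ)|)) :=
    norm_freq_mul_le hω hb (by linarith)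
  set Q := (A₁ * ∑' j : ℤ, Real.exp (-((3 * (ω * δ) - 2 * (ω * δ)) * |(j : ℝ)|))) ^ 2 with hQ
  have hQ0 : 0 ≤ Q := by positivity
  refine ⟨3 * (1 + Q), by positivity, ?_⟩
  intro ψ lam B hψ hlam hB heq hneu hyB k
  have hψ1 : ContDiff ℝ (⊤ : ℕ∞) (fderiv ℝ ψ) := hψ.fderiv_right (by simp)
  have hψ2 : ContDiff ℝ (⊤ : ℕ∞) (fderiv ℝ (fderiv ℝ ψ)) := hψ1.fderiv_right (by simp)
  set G0 : ℂ → ℂ := fun z => (ψ (f z) : ℂ) with hG0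
  set G1 : ℂ → ℂ → ℂ := fun v z => (fderiv ℝ ψ (f z) (f₁ z * v) : ℂ) with hG1
  set G2 : ℂ → ℂ → ℂ := fun v z => ((fderiv ℝ (fderiv ℝ ψ) (f z) (f₁ z * v) (f₁ z * v) +
      fderiv ℝ ψ (f z) (f₂ z * v * v) : ℝ) : ℂ) with hG2
  have cG0 : ContinuousOn G0 S :=
    Complex.continuous_ofReal.comp_continuousOn (hψ.continuous.comp_continuousOn c0)
  have cG1 : ∀ v, ContinuousOn (G1 v) S := fun v =>
    Complex.continuous_ofReal.comp_continuousOn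
      ((hψ1.continuous.comp_continuousOn c0).clm_apply (c1.mul continuousOn_const))
  have cG2 : ∀ v, ContinuousOn (G2 v) S := fun v =>
    Complex.continuous_ofReal.comp_continuousOn
      ((((hψ2.continuous.comp_continuousOn c0).clm_apply (c1.mul continuousOn_const)).clm_apply
        (c1.mul continuousOn_const)).add
      ((hψ1.continuous.comp_continuousOn c0).clm_apply
        ((c2.mul continuousOn_const).mul continuousOn_const)))
  have dG0 : ∀ v : ℂ, ∀ z : ℂ, ω * |z.im| < x →
      HasDerivAt (fun r : ℝ => G0 (z + r * v)) (G1 v z) 0 := fun v z hz =>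
    (hasDerivAt_comp_line hψ (d0 z hz) v).ofReal_comp
  have dG1 : ∀ v : ℂ, ∀ z : ℂ, ω * |z.im| < x →
      HasDerivAt (fun r : ℝ => G1 v (z + r * v)) (G2 v z) 0 := fun v z hz =>
    (hasDerivAt_fderiv_comp_line hψ (d0 z hz) (d1 z hz) v).ofReal_comp
  have him : ∀ t s : ℝ, |((t : ℂ) + s * (ε * Complex.I)).im| = |s| := fun t s => by
    rcases hε with rfl | rfl <;> simp
  have hsx : ∀ s ∈ Set.Icc 0 δ, ω * |s| < x := fun s hs => by
    rw [abs_of_nonneg hs.1]; nlinarith [hs.2]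
  have hcont : ∀ {H : ℂ → ℂ}, ContinuousOn H S → ∀ s ∈ Set.Icc 0 δ,
      Continuous fun t : ℝ => H (t + s * (ε * Complex.I)) := fun {H} hH s hs => by
    refine hH.comp_continuous (by fun_prop) fun t => ?_
    simp only [hS, Set.mem_ofPred_eq, him, hsx s hs]
  have shift : ∀ {H H' : ℂ → ℂ}, (∀ z : ℂ, ω * |z.im| < x →
      HasDerivAt (fun r : ℝ => H (z + r * (1 : ℂ))) (H' z) 0) → ∀ s ∈ Set.Icc 0 δ, ∀ t : ℝ,
      HasDerivAt (fun t : ℝ => H (t + s * (ε * Complex.I))) (H' (t + s * (ε * Complex.I))) t :=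
    fun {H H'} hH s hs t => by
      have h := hH (t + s * (ε * Complex.I)) (by rw [him]; exact hsx s hs)
      have h2 := HasDerivAt.comp_sub_const t t (f := fun r : ℝ =>
        H (t + s * (ε * Complex.I) + r * (1 : ℂ))) (by simpa using h)
      refine h2.congr_of_eventuallyEq (Filter.Eventually.of_forall fun r => ?_)
      simp only; congr 1; push_cast; ring
  have perf : ∀ z : ℂ, f (z + L) = f z := expSum_periodic hωL b
  have perf₁ : ∀ z : ℂ, f₁ (z + L) = f₁ z := expSum_periodic hωL _
  have hLz : ∀ w : ℂ, (L : ℂ) + w = (0 : ℝ) + w + L := fun w => by push_cast; ring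
  have key := norm_le_exp_of_bootstrap (ω := ω) (δ := δ) (lam := lam) (Q := Q) (K := 3 * (1 + Q))
    (B := B) hω hδ hlam (by positivity) (by nlinarith) hB
    (y := fun k s => fourierInt L ω (fun t => G0 (t + s * (ε * Complex.I))) k)
    (y' := fun k s => fourierInt L ω (fun t => G1 (ε * Complex.I) (t + s * (ε * Complex.I))) k)
    (y'' := fun k s => fourierInt L ω (fun t => G2 (ε * Complex.I) (t + s * (ε * Complex.I))) k)
    (q := fun k s => fourierInt L ω (fun t => (Complex.normSq (f₁ (t + s * (ε * Complex.I))) : ℂ) *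
      G0 (t + s * (ε * Complex.I))) k)
    (fun k s hs => hasDerivAt_fourierInt_param hω hε (cG1 _) (dG0 _) cG0 k (hsx s hs))
    (fun k s hs => hasDerivAt_fourierInt_param hω hε (cG2 _) (dG1 _) (cG1 _) k (hsx s hs))
    ?_ ?_ hyB ?_ k
  · simpa [hG0] using key
  · intro k s hs
    have hs' : s ∈ Set.Icc 0 δ := ⟨hs.1.le, hs.2.le⟩
    have e1 := fourierInt_of_hasDerivAt hωL (shift (dG0 1) s hs') (hcont (cG1 1) s hs')
      (by rw [hLz]; simp only [hG0, perf]) k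
    have e2 := fourierInt_of_hasDerivAt hωL (shift (dG1 1) s hs') (hcont (cG2 1) s hs')
      (by rw [hLz]; simp only [hG1, perf, perf₁]) k
    have cN : Continuous fun t : ℝ => (Complex.normSq (f₁ (t + s * (ε * Complex.I))) : ℂ) *
        G0 (t + s * (ε * Complex.I)) :=
      (hcont (H := fun z => (Complex.normSq (f₁ z) : ℂ)) (Complex.continuous_ofReal.comp_continuousOn
        (Complex.continuous_normSq.comp_continuousOn c1)) s hs').mul (hcont cG0 s hs')
    have e3 : ∀ t : ℝ, G2 (ε * Complex.I) (t + s * (ε * Complex.I)) =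
        -(lam : ℂ) ^ 2 * ((Complex.normSq (f₁ (t + s * (ε * Complex.I))) : ℂ) *
          G0 (t + s * (ε * Complex.I))) - G2 1 (t + s * (ε * Complex.I)) := fun t => by
      have h := second_deriv_add_rotate hψ hε (f (t + s * (ε * Complex.I)))
        (f₁ (t + s * (ε * Complex.I))) (f₂ (t + s * (ε * Complex.I)))
      rw [heq t s hs] at h
      simp only [hG2, hG0]
      rw [eq_sub_iff_add_eq]
      rw [← Complex.ofReal_add, h]
      push_cast; ring
    have e4 : fourierInt L ω (fun t => G2 (ε * Complex.I) (t + s * (ε * Complex.I))) k =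
        -(lam : ℂ) ^ 2 * fourierInt L ω (fun t =>
          (Complex.normSq (f₁ (t + s * (ε * Complex.I))) : ℂ) * G0 (t + s * (ε * Complex.I))) k -
        fourierInt L ω (fun t => G2 1 (t + s * (ε * Complex.I))) k := by
      simp only [e3]
      exact fourierInt_const_mul_sub cN (hcont (cG2 1) s hs') _ k
    rw [e4, e2, e1]
    have : ((ω * |(k : ℝ)| : ℝ) : ℂ) ^ 2 = (ω : ℂ) ^ 2 * k ^ 2 := by
      rw [← Complex.ofReal_pow, mul_pow, sq_abs]; push_cast; ring
    rw [this]
    linear_combination -(ω : ℂ) ^ 2 * k ^ 2 * fourierInt L ω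
      (fun t => G0 (t + s * (ε * Complex.I))) k * Complex.I_sq
  · intro k
    have : ∀ t : ℝ, G1 (ε * Complex.I) (t + (0 : ℝ) * (ε * Complex.I)) = 0 := fun t => by
      have h0 := hneu t
      simp only [hG1, Complex.ofReal_zero, zero_mul, add_zero]
      have : f₁ t * (ε * Complex.I) = ε • (f₁ t * Complex.I) := by
        rw [Complex.real_smul]; ring
      rw [this, map_smul, h0]; simp
    simp only [this, fourierInt, zero_mul, intervalIntegral.integral_zero]
  · intro s hs β hβ hyβ k
    have hs' : s ∈ Set.Icc 0 δ := ⟨hs.1.le, hs.2.le⟩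
    refine norm_fourierInt_normSq_mul_le hω (by positivity) hb₁ (y := 2 * (ω * δ)) ?_
      (by linarith) (hcont cG0 s hs') hβ hyβ k
    have := him 0 s
    rw [Complex.ofReal_zero, zero_add] at this
    rw [this, abs_of_pos hs.1]
    nlinarith [hs.2]

theorem det_collar_deriv (a : ℂ) (ε : ℝ) :
    (Complex.reCLM.smulRight a + Complex.imCLM.smulRight (a * (ε * Complex.I)) : ℂ →L[ℝ] ℂ).det =
      ε * Complex.normSq a := by
  rw [ContinuousLinearMap.det, ← LinearMap.det_toMatrix Complex.basisOneI, Matrix.det_fin_two]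
  simp [LinearMap.toMatrix_apply, Complex.normSq_apply]
  ring

theorem setIntegral_normSq_deriv_mul_le {D : Set ℂ} {f f₁ : ℂ → ℂ}
    {L δ ε : ℝ} (hε : ε = 1 ∨ ε = -1)
    (hf : ∀ t s : ℝ, s ∈ Set.Ioo 0 δ →
      HasDerivAt f (f₁ (t + s * (ε * Complex.I))) (t + s * (ε * Complex.I)))
    (hfD : ∀ t s : ℝ, s ∈ Set.Ioo 0 δ → f (t + s * (ε * Complex.I)) ∈ D)
    (hinj : ∀ t t' s s' : ℝ, t ∈ Set.Ioo 0 L → t' ∈ Set.Ioo 0 L → s ∈ Set.Ioo 0 δ →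
      s' ∈ Set.Ioo 0 δ → f (t + s * (ε * Complex.I)) = f (t' + s' * (ε * Complex.I)) →
      t = t' ∧ s = s')
    {h : ℂ → ℝ} (hh : ∀ z, 0 ≤ h z) (hi : IntegrableOn h D) :
    ∫ p in Set.Ioo 0 L ×ˢ Set.Ioo 0 δ, Complex.normSq (f₁ (p.1 + p.2 * (ε * Complex.I))) *
      h (f (p.1 + p.2 * (ε * Complex.I))) ≤ ∫ z in D, h z := by
  set P : ℂ → ℂ := fun z => z.re + z.im * (ε * Complex.I) with hP
  set R : Set ℂ := Complex.measurableEquivRealProd ⁻¹' (Set.Ioo 0 L ×ˢ Set.Ioo 0 δ) with hR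
  have hRm : MeasurableSet R :=
    Complex.measurableEquivRealProd.measurable (measurableSet_Ioo.prod measurableSet_Ioo)
  have hmem : ∀ z : ℂ, z ∈ R ↔ z.re ∈ Set.Ioo 0 L ∧ z.im ∈ Set.Ioo 0 δ := fun z => by
    simp [hR, Complex.measurableEquivRealProd_apply, Set.mem_prod]
  have hder : ∀ z ∈ R, HasFDerivWithinAt (fun z => f (P z))
      (Complex.reCLM.smulRight (f₁ (P z)) +
        Complex.imCLM.smulRight (f₁ (P z) * (ε * Complex.I)) : ℂ →L[ℝ] ℂ) R z := fun z hz => by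
    have h1 : HasFDerivAt P (Complex.reCLM.smulRight 1 +
        Complex.imCLM.smulRight (ε * Complex.I) : ℂ →L[ℝ] ℂ) z := by
      have := (Complex.reCLM.smulRight 1 +
        Complex.imCLM.smulRight (ε * Complex.I) : ℂ →L[ℝ] ℂ).hasFDerivAt (x := z)
      refine this.congr_of_eventuallyEq (Filter.Eventually.of_forall fun w => ?_)
      simp [hP]
    have h2 := ((hf z.re z.im ((hmem z).1 hz).2).hasFDerivAt.restrictScalars ℝ).comp z h1
    refine (h2.congr_fderiv ?_).hasFDerivWithinAt
    ext w
    simp [hP]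
    ring
  have hinjR : Set.InjOn (fun z => f (P z)) R := fun z hz w hw hzw => by
    rw [hmem] at hz hw
    obtain ⟨h1, h2⟩ := hinj _ _ _ _ hz.1 hw.1 hz.2 hw.2 hzw
    exact Complex.ext h1 h2
  have hcv := integral_image_eq_integral_abs_det_fderiv_smul volume hRm hder hinjR h
  have e := Complex.volume_preserving_equiv_real_prod.setIntegral_preimage_emb
    Complex.measurableEquivRealProd.measurableEmbedding
    (fun p : ℝ × ℝ => Complex.normSq (f₁ (p.1 + p.2 * (ε * Complex.I))) *
      h (f (p.1 + p.2 * (ε * Complex.I)))) (Set.Ioo 0 L ×ˢ Set.Ioo 0 δ)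
  rw [← e]
  have hdet : ∀ a : ℂ, |(Complex.reCLM.smulRight a +
      Complex.imCLM.smulRight (a * (ε * Complex.I)) : ℂ →L[ℝ] ℂ).det| = Complex.normSq a :=
    fun a => by
      rw [det_collar_deriv, abs_mul, abs_of_nonneg (Complex.normSq_nonneg a)]
      rcases hε with rfl | rfl <;> simp
  simp only [hdet, smul_eq_mul] at hcv
  change ∫ z in R, Complex.normSq (f₁ (P z)) * h (f (P z)) ≤ _
  rw [← hcv]
  refine setIntegral_mono_set hi (Filter.Eventually.of_forall hh) (LE.le.eventuallyLE ?_)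
  rintro _ ⟨z, hz, rfl⟩
  exact hfD _ _ ((hmem z).1 hz).2

theorem le_half_add_sq_div {m : ℝ} (hm : 0 < m) (u : ℝ) : |u| ≤ (m + u ^ 2 / m) / 2 := by
  have h : u ^ 2 / m * m = u ^ 2 := by field_simp
  nlinarith [sq_nonneg (|u| - m), sq_abs u]

/-- The `L¹` norm on a horizontal line of the collar is controlled by the boundary `L²` norm and
the energy in the collar. -/
theorem integral_abs_collar_le {Φ Φ' : ℝ → ℝ → ℝ} {L δ m E : ℝ} (hL : 0 < L) (hm : 0 < m)
    (hΦ : ∀ t, ∀ s ∈ Set.Icc 0 δ, HasDerivAt (Φ t) (Φ' t s) s)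
    (hc : ∀ s ∈ Set.Icc 0 δ, Continuous fun t => Φ t s)
    (hΦ' : ContinuousOn (fun p : ℝ × ℝ => Φ' p.1 p.2) (Set.Icc 0 L ×ˢ Set.Icc 0 δ))
    (hE : ∫ p in Set.Ioo 0 L ×ˢ Set.Ioo 0 δ, Φ' p.1 p.2 ^ 2 ≤ E) {s : ℝ} (hs : s ∈ Set.Icc 0 δ) :
    ∫ t in (0 : ℝ)..L, |Φ t s| ≤
      (m * L + (∫ t in (0 : ℝ)..L, Φ t 0 ^ 2) / m) / 2 + (m * δ * L + E / m) / 2 := by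
  have hδ : 0 ≤ δ := hs.1.trans hs.2
  have h0 : (0 : ℝ) ∈ Set.Icc 0 δ := ⟨le_rfl, hδ⟩
  have hsq : IntegrableOn (fun p : ℝ × ℝ => Φ' p.1 p.2 ^ 2) (Set.Ioc 0 L ×ˢ Set.Ioc 0 δ) :=
    ((hΦ'.pow 2).integrableOn_compact (isCompact_Icc.prod isCompact_Icc)).mono_set
      (Set.prod_mono Set.Ioc_subset_Icc_self Set.Ioc_subset_Icc_self)
  have hsq' : Integrable (fun p : ℝ × ℝ => Φ' p.1 p.2 ^ 2)
      ((volume.restrict (Set.Ioc 0 L)).prod (volume.restrict (Set.Ioc 0 δ))) := by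
    rw [Measure.prod_restrict]; exact hsq
  set N : ℝ → ℝ := fun t => ∫ r in (0 : ℝ)..δ, Φ' t r ^ 2 with hN
  have hNi : IntervalIntegrable N volume 0 L := by
    rw [intervalIntegrable_iff_integrableOn_Ioc_of_le hL.le]
    have := hsq'.integral_prod_left
    have e : N = fun t => ∫ r in Set.Ioc 0 δ, Φ' t r ^ 2 := by
      funext t; exact intervalIntegral.integral_of_le hδ
    rw [e]; exact this
  have hNE : ∫ t in (0 : ℝ)..L, N t ≤ E := by
    refine le_trans (le_of_eq ?_) hE
    have h1 : volume.restrict (Set.Ioo (0 : ℝ) L ×ˢ Set.Ioo (0 : ℝ) δ) =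
        (volume.restrict (Set.Ioc 0 L)).prod (volume.restrict (Set.Ioc 0 δ)) := by
      rw [Measure.volume_eq_prod, ← Measure.prod_restrict, Measure.restrict_congr_set Ioo_ae_eq_Ioc,
        Measure.restrict_congr_set Ioo_ae_eq_Ioc]
    rw [h1, integral_prod _ hsq']
    simp only [hN, intervalIntegral.integral_of_le hδ, intervalIntegral.integral_of_le hL.le]
  have hpt : ∀ t ∈ Set.Icc 0 L, |Φ t s| ≤ (m + Φ t 0 ^ 2 / m) / 2 + (m * δ + N t / m) / 2 := by
    intro t ht
    have hc' : ContinuousOn (Φ' t) (Set.Icc 0 δ) :=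
      hΦ'.comp (f := fun r : ℝ => (t, r)) (by fun_prop) fun r hr => ⟨ht, hr⟩
    have hi : ∀ r ∈ Set.Icc 0 δ, ∀ g : ℝ → ℝ, Continuous g →
        IntervalIntegrable (fun r => g (Φ' t r)) volume 0 r := fun r hr g hg =>
      ((hg.comp_continuousOn hc').mono (by
        rw [Set.uIcc_of_le hr.1]; exact Set.Icc_subset_Icc_right hr.2)).intervalIntegrable
    have hFTC : ∫ r in (0 : ℝ)..s, Φ' t r = Φ t s - Φ t 0 :=
      intervalIntegral.integral_eq_sub_of_hasDerivAt (fun r hr => by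
        rw [Set.uIcc_of_le hs.1] at hr
        exact hΦ t r ⟨hr.1, hr.2.trans hs.2⟩) (hi s hs id continuous_id)
    have h2 : |∫ r in (0 : ℝ)..s, Φ' t r| ≤ (m * δ + N t / m) / 2 := by
      have hg : Continuous fun u : ℝ => (m + u ^ 2 / m) / 2 := by fun_prop
      calc |∫ r in (0 : ℝ)..s, Φ' t r| ≤ ∫ r in (0 : ℝ)..s, |Φ' t r| :=
            intervalIntegral.abs_integral_le_integral_abs hs.1
        _ ≤ ∫ r in (0 : ℝ)..s, (m + Φ' t r ^ 2 / m) / 2 :=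
            intervalIntegral.integral_mono_on hs.1 (hi s hs _ continuous_abs) (hi s hs _ hg)
              fun r _ => le_half_add_sq_div hm _
        _ ≤ ∫ r in (0 : ℝ)..δ, (m + Φ' t r ^ 2 / m) / 2 := by
            refine intervalIntegral.integral_mono_interval le_rfl hs.1 hs.2
              (Filter.Eventually.of_forall fun r => ?_) (hi δ ⟨hδ, le_rfl⟩ _ hg)
            simp only [Pi.zero_apply]; positivity
        _ = (m * δ + N t / m) / 2 := by
            rw [intervalIntegral.integral_div, intervalIntegral.integral_add (by simp)
              ((hi δ ⟨hδ, le_rfl⟩ (fun u => u ^ 2 / m) (by fun_prop))),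
              intervalIntegral.integral_div]
            simp [hN, mul_comm]
    calc |Φ t s| = |Φ t 0 + ∫ r in (0 : ℝ)..s, Φ' t r| := by rw [hFTC]; ring_nf
      _ ≤ |Φ t 0| + |∫ r in (0 : ℝ)..s, Φ' t r| := abs_add_le _ _
      _ ≤ _ := add_le_add (le_half_add_sq_div hm _) h2
  have c0 := hc 0 h0
  have i1 : IntervalIntegrable (fun t => (m + Φ t 0 ^ 2 / m) / 2) volume 0 L :=
    Continuous.intervalIntegrable (by fun_prop) _ _
  have i2 : IntervalIntegrable (fun t => (m * δ + N t / m) / 2) volume 0 L :=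
    (IntervalIntegrable.add (by simp) (hNi.div_const m)).div_const 2
  calc ∫ t in (0 : ℝ)..L, |Φ t s|
      ≤ ∫ t in (0 : ℝ)..L, ((m + Φ t 0 ^ 2 / m) / 2 + (m * δ + N t / m) / 2) :=
        intervalIntegral.integral_mono_on hL.le ((hc s hs).abs.intervalIntegrable _ _) (i1.add i2) hpt
    _ = (m * L + (∫ t in (0 : ℝ)..L, Φ t 0 ^ 2) / m) / 2 +
        (m * δ * L + (∫ t in (0 : ℝ)..L, N t) / m) / 2 := by
        rw [intervalIntegral.integral_add i1 i2, intervalIntegral.integral_div,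
          intervalIntegral.integral_div, intervalIntegral.integral_add (by simp)
            (Continuous.intervalIntegrable (by fun_prop) _ _),
          intervalIntegral.integral_add (by simp) (hNi.div_const m),
          intervalIntegral.integral_div, intervalIntegral.integral_div]
        simp; ring
    _ ≤ _ := by gcongr

theorem fderiv_apply_sq_le (ψ : ℂ → ℝ) (w a : ℂ) : fderiv ℝ ψ w a ^ 2 ≤
    Complex.normSq a * (fderiv ℝ ψ w 1 ^ 2 + fderiv ℝ ψ w Complex.I ^ 2) := by
  have ha : a = a.re • (1 : ℂ) + a.im • Complex.I := by simp [Complex.re_add_im]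
  have h : fderiv ℝ ψ w a = a.re * fderiv ℝ ψ w 1 + a.im * fderiv ℝ ψ w Complex.I := by
    conv_lhs => rw [ha]
    simp only [map_add, map_smul, smul_eq_mul]
  rw [h, Complex.normSq_apply]
  nlinarith [sq_nonneg (a.re * fderiv ℝ ψ w Complex.I - a.im * fderiv ℝ ψ w 1)]

theorem exists_boundary_fourier_decay {D : Set ℂ} (hD : IsOpen D) (hDb : Bornology.IsBounded D)
    {c : ℝ → ℂ} {L ω : ℝ} (hL : 0 < L) (hωL : ω * L = 2 * Real.pi)
    (hc : AnalyticOnNhd ℝ c Set.univ) (hper : ∀ t, c (t + L) = c t)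
    (hunit : ∀ t, ‖deriv c t‖ = 1) (hinj : Set.InjOn c (Set.Ico 0 L))
    (hfr : frontier D = c '' Set.Ico 0 L) :
    ∃ δ K : ℝ, 0 < δ ∧ 0 ≤ K ∧ ∀ (ψ : ℂ → ℝ) (lam m E : ℝ), ContDiff ℝ (⊤ : ℕ∞) ψ → 0 ≤ lam →
      0 < m → 0 ≤ E →
      (∀ x ∈ D, fderiv ℝ (fun y => fderiv ℝ ψ y 1) x 1 +
        fderiv ℝ (fun y => fderiv ℝ ψ y Complex.I) x Complex.I = -lam ^ 2 * ψ x) →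
      (∀ t : ℝ, fderiv ℝ ψ (c t) (deriv c t * Complex.I) = 0) →
      ∫ x in D, (fderiv ℝ ψ x 1 ^ 2 + fderiv ℝ ψ x Complex.I ^ 2) ≤ E →
      ∀ k, ‖fourierInt L ω (fun t => (ψ (c t) : ℂ)) k‖ ≤
        2 * ((m * L + (∫ t in (0 : ℝ)..L, ψ (c t) ^ 2) / m) / 2 + (m * δ * L + E / m) / 2) *
          Real.exp (K * lam * δ) * Real.exp (-(ω * δ / 2 * |(k : ℝ)|)) := by
  have hω : 0 < ω := by
    by_contra! hn
    nlinarith [Real.pi_pos]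
  obtain ⟨A, x, δ, ε, b, hδ, hδx, hb, hfc, hε, hfD, hfinj⟩ :=
    exists_collar hD hL hωL hc hper hunit hinj hfr
  obtain ⟨K, hK, hmain⟩ := fourierInt_boundary_le hω hωL hb hδ hδx hε
  refine ⟨δ, K, hδ, hK, ?_⟩
  intro ψ lam m E hψ hlam hm hE hlap hneu hen k
  set f := expSum ω b with hf
  set f₁ := expSum ω (fun k => Complex.I * ω * k * b k) with hf₁
  have hωδ : 0 < ω * δ := by positivity
  have d0 : ∀ z : ℂ, ω * |z.im| < x → HasDerivAt f (f₁ z) z := fun z hz =>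
    expSum_hasDerivAt hω hb hz
  have c1 : ContinuousOn f₁ {z : ℂ | ω * |z.im| < x} := fun z hz => by
    obtain ⟨y, hzy, hyx⟩ := exists_between (show ω * |z.im| < x from hz)
    exact (expSum_hasDerivAt hω
      (norm_freq_mul_le hω hb hyx) hzy).continuousAt.continuousWithinAt
  have c0 : ContinuousOn f {z : ℂ | ω * |z.im| < x} := fun z hz =>
    (d0 z hz).continuousAt.continuousWithinAt
  have hx : 0 < x := by linarith
  have hc' : ∀ t : ℝ, deriv c t = f₁ t := fun t => by
    have h1 : HasDerivAt (fun t : ℝ => f t) (f₁ t) t := (d0 t (by simpa using hx)).comp_ofReal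
    have h2 : (fun t : ℝ => f t) = c := funext hfc
    rw [h2] at h1
    exact h1.deriv
  have him : ∀ t s : ℝ, |((t : ℂ) + s * (ε * Complex.I)).im| = |s| := fun t s => by
    rcases hε with rfl | rfl <;> simp
  have hsx : ∀ s ∈ Set.Icc 0 δ, ω * |s| < x := fun s hs => by
    rw [abs_of_nonneg hs.1]; nlinarith [hs.2]
  have hψ1 : ContDiff ℝ (⊤ : ℕ∞) (fderiv ℝ ψ) := hψ.fderiv_right (by simp)
  set Φ : ℝ → ℝ → ℝ := fun t s => ψ (f (t + s * (ε * Complex.I))) with hΦ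
  set Φ' : ℝ → ℝ → ℝ := fun t s => fderiv ℝ ψ (f (t + s * (ε * Complex.I)))
    (f₁ (t + s * (ε * Complex.I)) * (ε * Complex.I)) with hΦ'
  have hder : ∀ t, ∀ s ∈ Set.Icc 0 δ, HasDerivAt (Φ t) (Φ' t s) s := fun t s hs => by
    have h := hasDerivAt_comp_line hψ (d0 (t + s * (ε * Complex.I)) (by rw [him]; exact hsx s hs))
      (ε * Complex.I)
    have h2 := HasDerivAt.comp_sub_const s s (f := fun r : ℝ =>
      ψ (f (t + s * (ε * Complex.I) + r * (ε * Complex.I)))) (by simpa using h)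
    refine h2.congr_of_eventuallyEq (Filter.Eventually.of_forall fun r => ?_)
    simp only [hΦ]; congr 2; push_cast; ring
  have cΦ : ∀ s ∈ Set.Icc 0 δ, Continuous fun t => Φ t s := fun s hs => by
    refine (hψ.continuous.comp_continuousOn c0).comp_continuous
      (f := fun t : ℝ => (t : ℂ) + s * (ε * Complex.I)) (by fun_prop) fun t => ?_
    simp only [Set.mem_ofPred_eq, him, hsx s hs]
  have cΦ' : ContinuousOn (fun p : ℝ × ℝ => Φ' p.1 p.2) (Set.Icc 0 L ×ˢ Set.Icc 0 δ) := by
    have hg : ContinuousOn (fun z => fderiv ℝ ψ (f z) (f₁ z * (ε * Complex.I)))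
        {z : ℂ | ω * |z.im| < x} :=
      (hψ1.continuous.comp_continuousOn c0).clm_apply (c1.mul continuousOn_const)
    refine hg.comp (f := fun p : ℝ × ℝ => (p.1 : ℂ) + p.2 * (ε * Complex.I)) (by fun_prop)
      fun p hp => ?_
    simp only [Set.mem_ofPred_eq, him, hsx p.2 hp.2]
  set h : ℂ → ℝ := fun z => fderiv ℝ ψ z 1 ^ 2 + fderiv ℝ ψ z Complex.I ^ 2 with hh
  have hhc : Continuous h := by
    have e1 : Continuous fun z => fderiv ℝ ψ z 1 := hψ1.continuous.clm_apply continuous_const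
    have e2 : Continuous fun z => fderiv ℝ ψ z Complex.I :=
      hψ1.continuous.clm_apply continuous_const
    exact (e1.pow 2).add (e2.pow 2)
  have hcol := setIntegral_normSq_deriv_mul_le (D := D) (f := f) (f₁ := f₁) (L := L) (δ := δ) hε
    (fun t s hs => d0 _ (by rw [him]; exact hsx s ⟨hs.1.le, hs.2.le⟩)) hfD
    (fun t t' s s' ht ht' hs hs' heq => by
      obtain ⟨n, hn⟩ := hfinj _ _ (by rw [him, abs_of_pos hs.1]; linarith [hs.2])
        (by rw [him, abs_of_pos hs'.1]; linarith [hs'.2]) heq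
      have hre := congrArg Complex.re hn
      have hi := congrArg Complex.im hn
      simp only [Complex.add_re, Complex.mul_re, Complex.add_im, Complex.mul_im, Complex.ofReal_re,
        Complex.ofReal_im, Complex.I_re, Complex.I_im, Complex.intCast_re, Complex.intCast_im]
        at hre hi
      have hs2 : s = s' := by rcases hε with rfl | rfl <;> linarith
      have ht2 : t = t' + n * L := by linarith
      have h1 : n < 1 := by
        by_contra! hn1
        have : (1 : ℝ) ≤ n := by exact_mod_cast hn1
        nlinarith [ht.2, ht'.1]
      have h2 : -1 < n := by
        by_contra! hn1
        have : (n : ℝ) ≤ -1 := by exact_mod_cast hn1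
        nlinarith [ht.1, ht'.2]
      have h3 : n = 0 := by omega
      exact ⟨by rw [ht2, h3]; simp, hs2⟩)
    (h := h) (fun z => by positivity)
    ((hhc.continuousOn.integrableOn_compact hDb.isCompact_closure).mono_set subset_closure)
  have hE2 : ∫ p in Set.Ioo 0 L ×ˢ Set.Ioo 0 δ, Φ' p.1 p.2 ^ 2 ≤ E := by
    refine le_trans ?_ (hcol.trans hen)
    have hsub : Set.Ioo (0 : ℝ) L ×ˢ Set.Ioo (0 : ℝ) δ ⊆ Set.Icc 0 L ×ˢ Set.Icc 0 δ :=
      Set.prod_mono Set.Ioo_subset_Icc_self Set.Ioo_subset_Icc_self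
    have hK := (isCompact_Icc (a := (0 : ℝ)) (b := L)).prod (isCompact_Icc (a := (0 : ℝ)) (b := δ))
    refine setIntegral_mono_on (((cΦ'.pow 2).integrableOn_compact hK).mono_set hsub)
      ((ContinuousOn.integrableOn_compact hK ?_).mono_set hsub)
      (measurableSet_Ioo.prod measurableSet_Ioo) fun p hp => ?_
    · have hg : ContinuousOn (fun z => Complex.normSq (f₁ z) * h (f z))
          {z : ℂ | ω * |z.im| < x} :=
        (Complex.continuous_normSq.comp_continuousOn c1).mul (hhc.comp_continuousOn c0)
      refine hg.comp (f := fun p : ℝ × ℝ => (p.1 : ℂ) + p.2 * (ε * Complex.I)) (by fun_prop)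
        fun p hp => ?_
      simp only [Set.mem_ofPred_eq, him, hsx p.2 hp.2]
    · refine (fderiv_apply_sq_le ψ _ _).trans_eq ?_
      have : Complex.normSq (ε * Complex.I) = 1 := by rcases hε with rfl | rfl <;> simp
      rw [map_mul, this, mul_one]
  have hB : ∀ s ∈ Set.Icc 0 δ, ∫ t in (0 : ℝ)..L, |Φ t s| ≤
      (m * L + (∫ t in (0 : ℝ)..L, ψ (c t) ^ 2) / m) / 2 + (m * δ * L + E / m) / 2 := fun s hs => by
    have := integral_abs_collar_le hL hm hder cΦ cΦ' hE2 hs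
    simpa [hΦ, hfc] using this
  have key := hmain ψ lam ((m * L + (∫ t in (0 : ℝ)..L, ψ (c t) ^ 2) / m) / 2 +
    (m * δ * L + E / m) / 2) hψ hlam ?_ (fun t s hs => hlap _ (hfD t s hs))
    (fun t => by have := hneu t; rwa [hc', ← hfc] at this) ?_ k
  · simpa only [hfc] using key
  · have h1 : 0 ≤ ∫ t in (0 : ℝ)..L, ψ (c t) ^ 2 :=
      intervalIntegral.integral_nonneg hL.le fun t _ => sq_nonneg _
    positivity
  · intro k s hs
    refine (norm_fourierInt_le_integral hL.le k).trans ?_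
    simpa using hB s hs

theorem sq_add_sq_of_normal_eq_zero {ψ : ℂ → ℝ} {w a : ℂ} (ha : ‖a‖ = 1)
    (hn : fderiv ℝ ψ w (a * Complex.I) = 0) :
    fderiv ℝ ψ w 1 ^ 2 + fderiv ℝ ψ w Complex.I ^ 2 = fderiv ℝ ψ w a ^ 2 := by
  have e1 : a = a.re • (1 : ℂ) + a.im • Complex.I := by simp [Complex.re_add_im]
  have e2 : a * Complex.I = (-a.im) • (1 : ℂ) + a.re • Complex.I := by
    apply Complex.ext <;> simp
  have h : fderiv ℝ ψ w a = a.re * fderiv ℝ ψ w 1 + a.im * fderiv ℝ ψ w Complex.I := by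
    conv_lhs => rw [e1]
    simp only [map_add, map_smul, smul_eq_mul]
  have h' : fderiv ℝ ψ w (a * Complex.I) =
      -a.im * fderiv ℝ ψ w 1 + a.re * fderiv ℝ ψ w Complex.I := by
    rw [e2]
    simp only [map_add, map_smul, smul_eq_mul]
  rw [h'] at hn
  have ha2 : a.re ^ 2 + a.im ^ 2 = 1 := by
    have := Complex.sq_norm a
    rw [ha, Complex.normSq_apply] at this
    nlinarith
  rw [h]
  generalize fderiv ℝ ψ w 1 = p at *
  generalize fderiv ℝ ψ w Complex.I = q at *
  linear_combination (-(p ^ 2 + q ^ 2)) * ha2 + (-a.im * p + a.re * q) * hn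

/-- A function with exponentially decaying Fourier coefficients has few critical points. -/
theorem exists_card_critical_le_of_fourier_decay {L ω x : ℝ} (hL : 0 < L)
    (hωL : ω * L = 2 * Real.pi) (hx : 0 < x) :
    ∃ K C : ℝ, 0 < K ∧ 0 < C ∧ ∀ (u u' : ℝ → ℝ) (A t₀ : ℝ), (∀ t, HasDerivAt u (u' t) t) →
      (∀ t, u (t + L) = u t) →
      (∀ k, ‖fourierInt L ω (fun t => (u t : ℂ)) k‖ ≤ A * Real.exp (-(x * |(k : ℝ)|))) →
      t₀ ∈ Set.Icc 0 L → u' t₀ ≠ 0 → ∀ S : Finset ℝ, (∀ t ∈ S, t ∈ Set.Icc 0 L ∧ u' t = 0) →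
      0 < C * A / |u' t₀| ∧ (S.card : ℝ) ≤ K * Real.log (C * A / |u' t₀|) := by
  have hω : 0 < ω := by
    by_contra! hn
    nlinarith [Real.pi_pos]
  obtain ⟨K, hK, hcount⟩ := exists_card_zeros_le_of_strip hL (show 0 < x / (4 * ω) by positivity)
  set T := ∑' k : ℤ, Real.exp (-((x / 2 - x / 4) * |(k : ℝ)|)) with hT
  have hT0 : 0 < T := (summable_exp_neg_abs (by linarith)).tsum_pos
    (fun _ => (Real.exp_pos _).le) 0 (Real.exp_pos _)
  refine ⟨K, ω / (L * (x - x / 2)) * T, hK, ?_, ?_⟩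
  · have : 0 < x - x / 2 := by linarith
    positivity
  intro u u' A t₀ hu hper hA ht₀ hne S hS
  set g : ℝ → ℂ := fun t => (u t : ℂ) with hg
  have huc : Continuous u := continuous_iff_continuousAt.2 fun t => (hu t).continuousAt
  set b : ℤ → ℂ := fun k => fourierInt L ω g k / L with hb
  have hbA : ∀ k, ‖b k‖ ≤ A / L * Real.exp (-(x * |(k : ℝ)|)) := fun k => by
    rw [hb, norm_div, Complex.norm_real, Real.norm_of_nonneg hL.le, div_mul_eq_mul_div]
    gcongr
    exact hA k
  have hsum : Summable fun k => ‖fourierInt L ω g k‖ :=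
    Summable.of_nonneg_of_le (fun _ => norm_nonneg _) hA ((summable_exp_neg_abs hx).mul_left A)
  have hbu : ∀ t : ℝ, expSum ω b t = u t := fun t =>
    (hasSum_fourierInt hL hωL (Complex.continuous_ofReal.comp huc)
      (fun t => congrArg Complex.ofReal (hper t)) hsum t).tsum_eq
  set V := expSum ω (fun k => Complex.I * ω * k * b k) with hV
  have hVu : ∀ t : ℝ, V t = u' t := fun t => by
    have h1 : HasDerivAt (fun t : ℝ => expSum ω b t) (V t) t :=
      (expSum_hasDerivAt hω hbA (z := t) (by simpa using hx)).comp_ofReal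
    have h2 : (fun t : ℝ => expSum ω b t) = fun t : ℝ => (u t : ℂ) := funext hbu
    rw [h2] at h1
    exact h1.unique (hu t).ofReal_comp
  have hb1 := norm_freq_mul_le hω hbA (y := x / 2) (by linarith)
  have him : ∀ z : ℂ, |z.im| < x / (4 * ω) → ω * |z.im| ≤ x / 4 := fun z hz => by
    rw [lt_div_iff₀ (by positivity)] at hz
    linarith
  have hVd : ∀ z : ℂ, |z.im| < x / (4 * ω) → DifferentiableAt ℂ V z := fun z hz =>
    (expSum_hasDerivAt hω hb1 (lt_of_le_of_lt (him z hz) (by linarith))).differentiableAt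
  have hconst : ω * (A / L) / (x - x / 2) * T = ω / (L * (x - x / 2)) * T * A := by
    rw [div_mul_eq_mul_div, div_mul_eq_mul_div, div_mul_eq_mul_div, ← div_div]
    congr 1
    ring
  have hVM : ∀ z : ℂ, |z.im| < x / (4 * ω) → ‖V z‖ ≤ ω / (L * (x - x / 2)) * T * A :=
    fun z hz => by
      rw [← hconst]
      exact norm_expSum_le hω hb1 (y := x / 4) (by linarith) (him z hz)
  have hV0 : ‖V t₀‖ = |u' t₀| := by rw [hVu, Complex.norm_real, Real.norm_eq_abs]
  have h0 : 0 < |u' t₀| := abs_pos.2 hne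
  have h1 : |u' t₀| ≤ ω / (L * (x - x / 2)) * T * A := by
    rw [← hV0]; exact hVM _ (by simp; positivity)
  refine ⟨div_pos (h0.trans_le h1) h0, ?_⟩
  rw [← hV0]
  exact hcount V _ t₀ hVd hVM ht₀ (by rw [hVu]; exact_mod_cast hne) S fun t ht =>
    ⟨(hS t ht).1, by rw [hVu, (hS t ht).2]; simp⟩

theorem exists_sq_mul_ge_integral {L : ℝ} (hL : 0 < L) {v : ℝ → ℝ} (hv : Continuous v) :
    ∃ t₀ ∈ Set.Icc 0 L, ∫ t in (0 : ℝ)..L, v t ^ 2 ≤ v t₀ ^ 2 * L := by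
  obtain ⟨t₀, ht₀, hmax⟩ := isCompact_Icc.exists_isMaxOn (Set.nonempty_Icc.2 hL.le)
    ((hv.pow 2).continuousOn (s := Set.Icc 0 L))
  refine ⟨t₀, ht₀, ?_⟩
  calc ∫ t in (0 : ℝ)..L, v t ^ 2 ≤ ∫ _t in (0 : ℝ)..L, v t₀ ^ 2 :=
        intervalIntegral.integral_mono_on hL.le ((hv.pow 2).intervalIntegrable _ _) (by simp)
          fun t ht => hmax ht
    _ = v t₀ ^ 2 * L := by simp [mul_comm]

set_option maxHeartbeats 1000000 in
theorem exists_card_critical_le_of_neumann {D : Set ℂ} (hD : IsOpen D)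
    (hDb : Bornology.IsBounded D) {c : ℝ → ℂ} {L : ℝ} (hL : 0 < L)
    (hc : AnalyticOnNhd ℝ c Set.univ) (hper : ∀ t, c (t + L) = c t)
    (hunit : ∀ t, ‖deriv c t‖ = 1) (hinj : Set.InjOn c (Set.Ico 0 L))
    (hfr : frontier D = c '' Set.Ico 0 L) {a : ℝ} (ha : 0 < a) :
    ∃ C > (0 : ℝ), ∀ lam : ℝ, 0 < lam → ∀ ψ : ℂ → ℝ, ContDiff ℝ (⊤ : ℕ∞) ψ →
      HasCompactSupport ψ →
      (∀ x ∈ D, fderiv ℝ (fun y => fderiv ℝ ψ y 1) x 1 +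
        fderiv ℝ (fun y => fderiv ℝ ψ y Complex.I) x Complex.I = -lam ^ 2 * ψ x) →
      (∀ t : ℝ, fderiv ℝ ψ (c t) (deriv c t * Complex.I) = 0) →
      ¬ (∀ x ∈ D, ψ x = 0) →
      (∫ t in (0:ℝ)..L, (fderiv ℝ ψ (c t) (deriv c t)) ^ 2) ≥
          Real.exp (-2 * a * lam) * ∫ t in (0:ℝ)..L, (ψ (c t)) ^ 2 →
      ∀ S : Finset ℝ, (∀ t ∈ S, t ∈ Set.Icc 0 L ∧ fderiv ℝ ψ (c t) (deriv c t) = 0) →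
        (S.card : ℝ) ≤ C * (1 + lam) := by
  have hωL : 2 * Real.pi / L * L = 2 * Real.pi := by field_simp
  set ω := 2 * Real.pi / L with hω
  have hω0 : 0 < ω := by positivity
  have hcd : ∀ t, HasDerivAt c (deriv c t) t := fun t =>
    (hc t (Set.mem_univ t)).differentiableAt.hasDerivAt
  have hcc : Continuous c := continuous_iff_continuousAt.2 fun t => (hcd t).continuousAt
  have hc'c : Continuous (deriv c) := continuous_iff_continuousAt.2 fun t =>
    (hc.deriv t (Set.mem_univ t)).continuousAt
  have hlip : LipschitzWith 1 c := by
    refine lipschitzWith_of_nnnorm_deriv_le (fun t => (hcd t).differentiableAt) fun t => ?_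
    rw [← NNReal.coe_le_coe, coe_nnnorm, hunit]; simp
  obtain ⟨ρ, hρ0, hρ⟩ : ∃ ρ, 0 ≤ ρ ∧ ∀ t, ‖c t‖ ≤ ρ := by
    obtain ⟨M, hM⟩ := (isCompact_Icc (a := (0 : ℝ)) (b := L)).exists_bound_of_continuousOn
      hcc.continuousOn
    have hP : Function.Periodic c L := hper
    refine ⟨max M 0, le_max_right _ _, fun t => ?_⟩
    obtain ⟨s, hs, hst⟩ := hP.exists_mem_Ico₀ hL t
    rw [hst]
    exact (hM s ⟨hs.1, hs.2.le⟩).trans (le_max_left _ _)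
  obtain ⟨δ, K, hδ, hK, hdecay⟩ :=
    exists_boundary_fourier_decay hD hDb hL hωL hc hper hunit hinj hfr
  obtain ⟨K', C, hK', hC, hcount⟩ :=
    exists_card_critical_le_of_fourier_decay hL hωL (show 0 < ω * δ / 2 by positivity)
  set C₁ := 32 * Real.pi * ρ + 8 * Real.pi with hC₁
  have hC₁0 : 0 < C₁ := by positivity
  set C₂ := L + 1 + δ * L + 2 * C₁ with hC₂
  have hC₂0 : 0 < C₂ := by positivity
  set N := |Real.log (C * C₂ * Real.sqrt L)| + (1 + a + K * δ) with hN
  have hN0 : 0 < N := by positivity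
  refine ⟨K' * N, by positivity, ?_⟩
  intro lam hlam ψ hψ hψs hlap hneu hne hsch S hS
  set u : ℝ → ℝ := fun t => ψ (c t) with hu
  set u' : ℝ → ℝ := fun t => fderiv ℝ ψ (c t) (deriv c t) with hu'
  have hψ1 : ContDiff ℝ (⊤ : ℕ∞) (fderiv ℝ ψ) := hψ.fderiv_right (by simp)
  have hud : ∀ t, HasDerivAt u (u' t) t := fun t =>
    ((hψ.differentiable (by simp)).differentiableAt (x := c t)).hasFDerivAt.comp_hasDerivAt t (hcd t)
  have huc : Continuous u := hψ.continuous.comp hcc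
  have hu'c : Continuous u' := (hψ1.continuous.comp hcc).clm_apply hc'c
  set W := ∫ t in (0 : ℝ)..L, u' t ^ 2 with hW
  set U := ∫ t in (0 : ℝ)..L, u t ^ 2 with hU
  have hW0 : 0 ≤ W := intervalIntegral.integral_nonneg hL.le fun t _ => sq_nonneg _
  have hU0 : 0 ≤ U := intervalIntegral.integral_nonneg hL.le fun t _ => sq_nonneg _
  have hUW : U ≤ Real.exp (2 * a * lam) * W := by
    have h1 : Real.exp (2 * a * lam) * Real.exp (-2 * a * lam) = 1 := by
      rw [← Real.exp_add]; simp
    calc U = Real.exp (2 * a * lam) * (Real.exp (-2 * a * lam) * U) := by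
          rw [← mul_assoc, h1, one_mul]
      _ ≤ _ := by gcongr
  have hgrad : ∀ t, fderiv ℝ ψ (c t) 1 ^ 2 + fderiv ℝ ψ (c t) Complex.I ^ 2 = u' t ^ 2 := fun t =>
    sq_add_sq_of_normal_eq_zero (hunit t) (hneu t)
  obtain ⟨r1, r2⟩ := rellich_energy_le hD hDb hL hlip hper hfr hρ hψ hψs hlap
  have i1 : ∫ t in (0 : ℝ)..L, (fderiv ℝ ψ (c t) 1 ^ 2 + fderiv ℝ ψ (c t) Complex.I ^ 2
      + lam ^ 2 * ψ (c t) ^ 2) = W + lam ^ 2 * U := by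
    simp only [hgrad]
    rw [hW, hU, ← intervalIntegral.integral_const_mul, ← intervalIntegral.integral_add]
    · exact Continuous.intervalIntegrable (by fun_prop) _ _
    · exact Continuous.intervalIntegrable (by fun_prop) _ _
  have i2 : ∫ t in (0 : ℝ)..L, (fderiv ℝ ψ (c t) 1 ^ 2 + fderiv ℝ ψ (c t) Complex.I ^ 2
      + ψ (c t) ^ 2) = W + U := by
    simp only [hgrad]
    rw [hW, hU, ← intervalIntegral.integral_add]
    · exact Continuous.intervalIntegrable (by fun_prop) _ _
    · exact Continuous.intervalIntegrable (by fun_prop) _ _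
  rw [i1] at r1
  rw [i2] at r2
  have hWpos : 0 < W := by
    refine hW0.lt_of_ne fun h0 => hne ?_
    have hU00 : U = 0 := le_antisymm (by rw [← h0, mul_zero] at hUW; exact hUW) hU0
    rw [← h0, hU00] at r1
    have h2 : ∫ x in D, ψ x ^ 2 ≤ 0 := by
      have : 0 < lam ^ 2 := by positivity
      nlinarith
    have h3 : ∫ x in D, ψ x ^ 2 = 0 :=
      le_antisymm h2 (setIntegral_nonneg hD.measurableSet fun x _ => sq_nonneg _)
    have hint : IntegrableOn (fun x => ψ x ^ 2) D :=
      ((hψ.continuous.pow 2).continuousOn.integrableOn_compact hDb.isCompact_closure).mono_set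
        subset_closure
    have h4 := (setIntegral_eq_zero_iff_of_nonneg_ae
      (Filter.Eventually.of_forall fun x => sq_nonneg (ψ x)) hint).1 h3
    have h5 := Measure.eqOn_open_of_ae_eq h4 hD (hψ.continuous.pow 2).continuousOn
      continuousOn_const
    intro x hx
    have := h5 hx
    simpa using this
  set m := Real.exp ((1 + a) * lam) * Real.sqrt W with hm
  have hm0 : 0 < m := by positivity
  have hm2 : m ^ 2 = Real.exp (2 * lam) * (Real.exp (2 * a * lam) * W) := by
    rw [hm, mul_pow, Real.sq_sqrt hW0, ← mul_assoc, ← Real.exp_add, ← Real.exp_nat_mul]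
    congr 2
    push_cast; ring
  have he1 : 1 ≤ Real.exp (2 * lam) := Real.one_le_exp (by positivity)
  have he2 : 1 ≤ Real.exp (2 * a * lam) := Real.one_le_exp (by positivity)
  have he3 : 1 + lam ^ 2 ≤ Real.exp (2 * lam) := by
    have h1 : 1 + lam ≤ Real.exp lam := by linarith [Real.add_one_le_exp lam]
    have h2 : Real.exp (2 * lam) = Real.exp lam * Real.exp lam := by
      rw [← Real.exp_add]; ring_nf
    rw [h2]
    nlinarith
  have hUm : U ≤ m ^ 2 := by
    rw [hm2]
    exact hUW.trans (le_mul_of_one_le_left (by positivity) he1)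
  have hWU : W + U ≤ 2 * (Real.exp (2 * a * lam) * W) := by
    have := le_mul_of_one_le_left hW0 he2
    linarith
  have hE : ∫ x in D, (fderiv ℝ ψ x 1 ^ 2 + fderiv ℝ ψ x Complex.I ^ 2) ≤ 2 * C₁ * m ^ 2 := by
    have h1 : W + lam ^ 2 * U ≤ (1 + lam ^ 2) * (W + U) := by
      have := mul_nonneg (sq_nonneg lam) hW0
      nlinarith
    have h2 : W + U ≤ (1 + lam ^ 2) * (W + U) := by
      have := mul_nonneg (sq_nonneg lam) (add_nonneg hW0 hU0)
      nlinarith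
    have h3 : (1 + lam ^ 2) * (W + U) ≤ 2 * m ^ 2 := by
      calc (1 + lam ^ 2) * (W + U)
          ≤ Real.exp (2 * lam) * (2 * (Real.exp (2 * a * lam) * W)) := by gcongr
        _ = 2 * m ^ 2 := by rw [hm2]; ring
    calc _ ≤ _ := r2
      _ ≤ 32 * Real.pi * ρ * (W + lam ^ 2 * U) + 8 * Real.pi * (W + U) := by gcongr
      _ ≤ 32 * Real.pi * ρ * (2 * m ^ 2) + 8 * Real.pi * (2 * m ^ 2) := by
          gcongr
          · exact h1.trans h3
          · exact h2.trans h3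
      _ = _ := by rw [hC₁]; ring
  have hdec := hdecay ψ lam m (2 * C₁ * m ^ 2) hψ hlam.le hm0 (by positivity) hlap hneu hE
  have hA : ∀ k, ‖fourierInt L ω (fun t => (u t : ℂ)) k‖ ≤
      m * C₂ * Real.exp (K * lam * δ) * Real.exp (-(ω * δ / 2 * |(k : ℝ)|)) := fun k => by
    refine (hdec k).trans ?_
    have h1 : U / m ≤ m := by
      rw [div_le_iff₀ hm0]; linarith [hUm, sq m]
    have h2 : 2 * C₁ * m ^ 2 / m = 2 * C₁ * m := by field_simp
    refine mul_le_mul_of_nonneg_right (mul_le_mul_of_nonneg_right ?_ (Real.exp_pos _).le)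
      (Real.exp_pos _).le
    rw [h2, hC₂]
    change 2 * ((m * L + U / m) / 2 + (m * δ * L + 2 * C₁ * m) / 2) ≤ _
    linarith
  obtain ⟨t₀, ht₀, hmax⟩ := exists_sq_mul_ge_integral hL hu'c
  have hne0 : u' t₀ ≠ 0 := fun h0 => by
    rw [h0] at hmax
    change W ≤ _ at hmax
    simp at hmax
    linarith
  obtain ⟨hpos, hcard⟩ := hcount u u' _ t₀ hud (fun t => by simp only [hu, hper]) hA ht₀ hne0 S hS
  have hsqrt : Real.sqrt W ≤ |u' t₀| * Real.sqrt L := by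
    rw [← Real.sqrt_sq_eq_abs, ← Real.sqrt_mul (sq_nonneg _)]
    exact Real.sqrt_le_sqrt hmax
  have hle : C * (m * C₂ * Real.exp (K * lam * δ)) / |u' t₀| ≤
      C * C₂ * Real.sqrt L * Real.exp ((1 + a + K * δ) * lam) := by
    rw [div_le_iff₀ (abs_pos.2 hne0)]
    have : Real.exp ((1 + a + K * δ) * lam) = Real.exp ((1 + a) * lam) * Real.exp (K * lam * δ) := by
      rw [← Real.exp_add]; ring_nf
    rw [this, hm]
    calc _ = C * C₂ * Real.exp ((1 + a) * lam) * Real.exp (K * lam * δ) * Real.sqrt W := by ring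
      _ ≤ C * C₂ * Real.exp ((1 + a) * lam) * Real.exp (K * lam * δ) *
          (|u' t₀| * Real.sqrt L) := by gcongr
      _ = _ := by ring
  have hlog : Real.log (C * (m * C₂ * Real.exp (K * lam * δ)) / |u' t₀|) ≤ N * (1 + lam) := by
    refine (Real.log_le_log hpos hle).trans ?_
    rw [Real.log_mul (by positivity) (Real.exp_pos _).ne', Real.log_exp, hN]
    have h1 := le_abs_self (Real.log (C * C₂ * Real.sqrt L))
    have h2 := mul_nonneg (abs_nonneg (Real.log (C * C₂ * Real.sqrt L))) hlam.le
    have h3 : 0 < 1 + a + K * δ := by positivity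
    nlinarith
  calc (S.card : ℝ) ≤ _ := hcard
    _ ≤ K' * (N * (1 + lam)) := by gcongr
    _ = K' * N * (1 + lam) := by ring

theorem exists_contDiff_hasCompactSupport_eventuallyEq {E : Type*} [NormedAddCommGroup E]
    [NormedSpace ℝ E] [FiniteDimensional ℝ E] {K U : Set E} (hK : IsCompact K) (hU : IsOpen U)
    (hKU : K ⊆ U) {φ : E → ℝ} (hφ : ContDiffOn ℝ (⊤ : ℕ∞) φ U) :
    ∃ φ' : E → ℝ, ContDiff ℝ (⊤ : ℕ∞) φ' ∧ HasCompactSupport φ' ∧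
      ∀ x ∈ K, φ' =ᶠ[nhds x] φ := by
  obtain ⟨V, hV, hKV, hVU⟩ := exists_compact_between hK hU hKU
  obtain ⟨f, hf1, hf0, -⟩ := exists_contMDiffMap_one_nhds_of_subset_interior (n := (⊤ : ℕ∞))
    (modelWithCornersSelf ℝ E) hK.isClosed hKV
  refine ⟨fun x => f x * φ x, contDiff_iff_contDiffAt.2 fun x => ?_,
    HasCompactSupport.intro hV fun x hx => by simp [hf0 x hx], fun x hx => ?_⟩
  · by_cases hx : x ∈ U
    · exact (f.contMDiff.contDiff.contDiffAt).mul (hφ.contDiffAt (hU.mem_nhds hx))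
    · have hxV : x ∈ Vᶜ := fun h => hx (hVU h)
      refine contDiffAt_const (c := (0 : ℝ)) |>.congr_of_eventuallyEq ?_
      filter_upwards [hV.isClosed.isOpen_compl.mem_nhds hxV] with y hy
      simp [hf0 y hy]
  · filter_upwards [Filter.Eventually.filter_mono (nhds_le_nhdsSet hx) hf1] with y hy
    simp [hy]

theorem Complex.orthonormalBasisOneI_repr_one :
    Complex.orthonormalBasisOneI.repr 1 = EuclideanSpace.single (0 : Fin 2) (1 : ℝ) := by
  ext i; fin_cases i <;> simp [Complex.orthonormalBasisOneI_repr_apply]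

theorem Complex.orthonormalBasisOneI_repr_I :
    Complex.orthonormalBasisOneI.repr Complex.I = EuclideanSpace.single (1 : Fin 2) (1 : ℝ) := by
  ext i; fin_cases i <;> simp [Complex.orthonormalBasisOneI_repr_apply]

theorem Complex.inner_mul_I_self (z : ℂ) : inner ℝ z (z * Complex.I) = 0 := by
  rw [Complex.inner]; simp; ring

theorem Set.finite_and_ncard_le_of_forall_finset_card_le {α : Type*} {s : Set α} {B : ℝ}
    (h : ∀ S : Finset α, ↑S ⊆ s → (S.card : ℝ) ≤ B) : s.Finite ∧ (s.ncard : ℝ) ≤ B := by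
  have hfin : s.Finite := by
    by_contra hinf
    obtain ⟨n, hn⟩ := exists_nat_gt B
    obtain ⟨S, hS, hc⟩ := Set.Infinite.exists_subset_card_eq hinf n
    have := h S hS
    rw [hc] at this
    linarith
  refine ⟨hfin, ?_⟩
  rw [Set.ncard_eq_toFinset_card s hfin]
  exact h _ (by simp)

/-- **Counting boundary critical points of Neumann eigenfunctions**
(Toth–Zelditch). For a bounded plane domain Ω with connected real-analytic
boundary and every a > 0 there is C = C(Ω, a) > 0 such that every Neumann
eigenfunction with eigenvalue λ² whose boundary trace satisfies the asymptotic
Schiffer condition ∫₀^L ((φ∘γ)′)² ≥ e^{-2aλ} ∫₀^L (φ∘γ)² has at most C(1+λ)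
critical points on the boundary. -/
theorem boundary_critical_points_bound
    (Ω : Set (EuclideanSpace ℝ (Fin 2))) (hΩo : IsOpen Ω)
    (hΩb : Bornology.IsBounded Ω)
    (L : ℝ) (hL : 0 < L) (γ : ℝ → EuclideanSpace ℝ (Fin 2))
    (hγa : AnalyticOnNhd ℝ γ Set.univ)
    (hper : ∀ t, γ (t + L) = γ t)
    (hunit : ∀ t, ‖deriv γ t‖ = 1)
    (hinj : Set.InjOn γ (Set.Ico 0 L))
    (himg : γ '' Set.Ico 0 L = frontier Ω)
    (a : ℝ) (ha : 0 < a) :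
    ∃ C > (0 : ℝ), ∀ lam : ℝ, 0 < lam →
      ∀ φ : EuclideanSpace ℝ (Fin 2) → ℝ,
        IsNeumannEigenfunction Ω γ lam φ →
        (∫ t in (0:ℝ)..L, (deriv (fun s => φ (γ s)) t) ^ 2) ≥
          Real.exp (-2 * a * lam) * ∫ t in (0:ℝ)..L, (φ (γ t)) ^ 2 →
        {t ∈ Set.Ico 0 L | deriv (fun s => φ (γ s)) t = 0}.Finite ∧
          ({t ∈ Set.Ico 0 L | deriv (fun s => φ (γ s)) t = 0}.ncard : ℝ) ≤ C * (1 + lam) := by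
  set J := Complex.orthonormalBasisOneI.repr with hJ
  have hγd : ∀ t, HasDerivAt γ (deriv γ t) t := fun t =>
    (hγa t (Set.mem_univ t)).differentiableAt.hasDerivAt
  have hcd : ∀ t, HasDerivAt (fun s => J.symm (γ s)) (J.symm (deriv γ t)) t := fun t =>
    J.symm.toContinuousLinearEquiv.toContinuousLinearMap.hasFDerivAt.comp_hasDerivAt t (hγd t)
  have hc' : ∀ t, deriv (fun s => J.symm (γ s)) t = J.symm (deriv γ t) := fun t => (hcd t).deriv
  have hγfr : ∀ t, γ t ∈ closure Ω := fun t => by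
    have hP : Function.Periodic γ L := hper
    obtain ⟨s, hs, hst⟩ := hP.exists_mem_Ico₀ hL t
    rw [hst]
    exact frontier_subset_closure (himg ▸ Set.mem_image_of_mem γ hs)
  obtain ⟨C, hC, H⟩ := exists_card_critical_le_of_neumann (D := J ⁻¹' Ω)
    (hΩo.preimage J.continuous) (J.antilipschitz.isBounded_preimage hΩb)
    (c := fun s => J.symm (γ s)) hL
    (fun t ht => (J.symm.toContinuousLinearEquiv.toContinuousLinearMap.analyticAt _).comp
      (hγa t ht))
    (fun t => by simp only [hper])
    (fun t => by rw [hc', LinearIsometryEquiv.norm_map, hunit])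
    (fun s hs t ht hst => hinj hs ht (J.symm.injective hst))
    (by
      rw [← show J ⁻¹' frontier Ω = frontier (J ⁻¹' Ω) from
        J.toHomeomorph.preimage_frontier Ω, ← himg]
      ext z
      simp only [Set.mem_preimage, Set.mem_image]
      refine exists_congr fun t => and_congr_right fun _ => ?_
      exact ⟨fun h => by simp [h], fun h => by simp [← h]⟩) ha
  refine ⟨C, hC, ?_⟩
  rintro lam hlam φ ⟨⟨U, hU, hΩU, hφU⟩, hne, hlap, hneu⟩ hsch
  obtain ⟨φ', hφ', hφs, heq⟩ := exists_contDiff_hasCompactSupport_eventuallyEq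
    hΩb.isCompact_closure hU hΩU hφU
  have hφd : Differentiable ℝ φ' := hφ'.differentiable (by simp)
  have hψf : ∀ z w : ℂ, fderiv ℝ (fun y => φ' (J y)) z w = fderiv ℝ φ' (J z) (J w) := fun z w => by
    have := (hφd (J z)).hasFDerivAt.comp z
      J.toContinuousLinearEquiv.toContinuousLinearMap.hasFDerivAt
    rw [HasFDerivAt.fderiv (f := fun y => φ' (J y)) this]
    rfl
  have hder : ∀ t, deriv (fun s => φ (γ s)) t =
      fderiv ℝ (fun y => φ' (J y)) (J.symm (γ t)) (deriv (fun s => J.symm (γ s)) t) := fun t => by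
    rw [hψf, hc', J.apply_symm_apply, J.apply_symm_apply, (heq _ (hγfr t)).fderiv_eq]
    have h1 : DifferentiableAt ℝ φ (γ t) :=
      (hφd (γ t)).congr_of_eventuallyEq (heq _ (hγfr t)).symm
    exact (h1.hasFDerivAt.comp_hasDerivAt t (hγd t)).deriv
  have hval : ∀ t, φ (γ t) = φ' (J (J.symm (γ t))) := fun t => by
    rw [J.apply_symm_apply, (heq _ (hγfr t)).eq_of_nhds]
  have key := H lam hlam (fun z => φ' (J z)) (hφ'.comp J.contDiff)
    (hφs.comp_homeomorph J.toHomeomorph) ?_ ?_ ?_ ?_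
  · refine Set.finite_and_ncard_le_of_forall_finset_card_le fun S hS => key S fun t ht => ?_
    obtain ⟨h1, h2⟩ := hS ht
    exact ⟨⟨h1.1, h1.2.le⟩, by rw [← hder]; exact h2⟩
  · intro z hz
    have h1 : J z ∈ closure Ω := subset_closure hz
    rw [← (heq _ h1).eq_of_nhds.symm, ← hlap _ hz, lap2, Fin.sum_univ_two]
    have h2 : ∀ v : ℂ, fderiv ℝ (fun y => fderiv ℝ (fun y => φ' (J y)) y v) z v =
        fderiv ℝ (fun y => fderiv ℝ φ y (J v)) (J z) (J v) := fun v => by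
      have h3 : ContDiff ℝ (⊤ : ℕ∞) (fderiv ℝ φ') := hφ'.fderiv_right (by simp)
      have h4 : DifferentiableAt ℝ (fun y => fderiv ℝ φ' y (J v)) (J z) :=
        ((h3.differentiable (by simp)) (J z)).clm_apply (differentiableAt_const _)
      have h5 := h4.hasFDerivAt.comp z
        J.toContinuousLinearEquiv.toContinuousLinearMap.hasFDerivAt
      simp only [hψf]
      rw [HasFDerivAt.fderiv (f := fun y => fderiv ℝ φ' (J y) (J v)) h5]
      have h6 : (fun y => fderiv ℝ φ' y (J v)) =ᶠ[nhds (J z)] fun y => fderiv ℝ φ y (J v) := by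
        filter_upwards [(heq _ h1).fderiv (𝕜 := ℝ)] with y hy
        rw [hy]
      rw [← h6.fderiv_eq]
      rfl
    rw [h2, h2, hJ, Complex.orthonormalBasisOneI_repr_one, Complex.orthonormalBasisOneI_repr_I]
  · intro t
    obtain ⟨k, hk⟩ := hneu t
    have h1 : DifferentiableAt ℝ φ (γ t) :=
      (hφd (γ t)).congr_of_eventuallyEq (heq _ (hγfr t)).symm
    rw [hψf, hc', J.apply_symm_apply, (heq _ (hγfr t)).fderiv_eq,
      h1.hasGradientAt.hasFDerivAt.fderiv, hk, InnerProductSpace.toDual_apply_apply,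
      real_inner_smul_left]
    nth_rewrite 1 [← J.apply_symm_apply (deriv γ t)]
    rw [LinearIsometryEquiv.inner_map_map, Complex.inner_mul_I_self, mul_zero]
  · intro h0
    refine hne fun x hx => ?_
    have h1 : Set.EqOn φ' 0 Ω := fun y hy => by
      have := h0 (J.symm y) (by simpa using hy)
      simpa using this
    have h2 := h1.closure hφ'.continuous continuous_const
    rw [← (heq x hx).eq_of_nhds]
    exact h2 hx
  · simp only [hder] at hsch
    simp only [hval] at hsch
    exact hsch
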